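/- Let d ≥ 1, let (q,r) be an admissible pair, and let (α,β) be a dual admissible pair (i.e. (α',β') is admissible). There exists a constant C > 0 such that for every Schwartz function F : ℝ × ℝ^d → ℂ, the retarded Duhamel integral u(t) = ∫_{-∞}^{t} e^{i(t-s)Δ}F(s,·) ds (a Bochner integral in L²(ℝ^d) for each t) satisfies ‖u‖_{L^q_t L^r_x(ℝ×ℝ^d)} ≤ C ‖F‖_{L^α_t L^β_x(ℝ×ℝ^d)}. -/

import Mathlib

open MeasureTheory Complex
open scoped ENNReal NNReal FourierTransform

noncomputable section

/-- The free Schrödinger propagator `e^{itΔ}`: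
`(e^{itΔ}φ)(x) = (4πit)^{-d/2} ∫ e^{i|x-y|²/(4t)} φ(y) dy`. -/
def schrod (d : ℕ) (t : ℝ) (φ : EuclideanSpace ℝ (Fin d) → ℂ)
    (x : EuclideanSpace ℝ (Fin d)) : ℂ :=
  (((4 * Real.pi * t : ℝ) : ℂ) * Complex.I) ^ (-(d : ℂ) / 2) *
    ∫ y : EuclideanSpace ℝ (Fin d),
      Complex.exp (Complex.I * ((‖x - y‖ : ℝ) : ℂ) ^ 2 / ((4 * t : ℝ) : ℂ)) * φ y

/-- `(q,r)` is a Schrödinger-admissible pair in dimension `d`: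
`2 ≤ q, r ≤ ∞`, `2/q + d/r = d/2`, and `(d,q,r) ≠ (2,2,∞)`. -/
def IsAdmissible (d : ℕ) (q r : ℝ≥0∞) : Prop :=
  2 ≤ q ∧ 2 ≤ r ∧ 2 / q + (d : ℝ≥0∞) / r = (d : ℝ≥0∞) / 2 ∧ ¬(d = 2 ∧ q = 2 ∧ r = ∞)

/-- The mixed (time) norm `( ∫_ℝ g(t)^q dt )^{1/q}`, with the essential supremum when
`q = ∞`. -/
def mixedLNorm (q : ℝ≥0∞) (g : ℝ → ℝ≥0∞) : ℝ≥0∞ :=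
  if q = ∞ then essSup g (volume : Measure ℝ)
  else (∫⁻ t : ℝ, g t ^ q.toReal) ^ (1 / q.toReal)

set_option linter.unusedSectionVars false

section

lemma mul_le_sq_add_sq (a b : ℝ≥0∞) : a * b ≤ a ^ 2 + b ^ 2 := by
  rcases le_total a b with h | h
  · calc a * b ≤ b * b := by gcongr
      _ = b ^ 2 := by ring
      _ ≤ _ := le_add_self
  · calc a * b ≤ a * a := by gcongr
      _ = a ^ 2 := by ring
      _ ≤ _ := le_self_add

lemma schur_conv {k a b : ℝ → ℝ≥0∞} (hk : Measurable k) (ha : Measurable a) (hb : Measurable b) :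
    ∫⁻ z : ℝ × ℝ, k (z.2 - z.1) * (a z.1 * b z.2) ≤
      (∫⁻ x, k x) * ((∫⁻ x, a x ^ 2) + ∫⁻ x, b x ^ 2) := by
  have h1 : ∫⁻ z : ℝ × ℝ, k (z.2 - z.1) * (a z.1 ^ 2) = (∫⁻ x, k x) * ∫⁻ x, a x ^ 2 := by
    rw [Measure.volume_eq_prod, lintegral_prod _ (by fun_prop)]
    have : ∀ x : ℝ, ∫⁻ y : ℝ, k (y - x) * a x ^ 2 = (∫⁻ y, k y) * a x ^ 2 := fun x => by
      rw [lintegral_mul_const _ (by fun_prop), lintegral_sub_right_eq_self]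
    simp only [this]
    rw [lintegral_const_mul _ (by fun_prop)]
  have h2 : ∫⁻ z : ℝ × ℝ, k (z.2 - z.1) * (b z.2 ^ 2) = (∫⁻ x, k x) * ∫⁻ x, b x ^ 2 := by
    rw [Measure.volume_eq_prod, lintegral_prod_symm _ (by fun_prop)]
    have : ∀ x : ℝ, ∫⁻ y : ℝ, k (x - y) * b x ^ 2 = (∫⁻ y, k y) * b x ^ 2 := fun x => by
      rw [lintegral_mul_const _ (by fun_prop), lintegral_sub_left_eq_self]
    simp only [this]
    rw [lintegral_const_mul _ (by fun_prop)]
  rw [mul_add, ← h1, ← h2, ← lintegral_add_left (by fun_prop)]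
  refine lintegral_mono fun z => ?_
  simp only [← mul_add]
  gcongr
  exact mul_le_sq_add_sq _ _

lemma lintegral_Ioi_pow {σ R B : ℝ} (hσ : 1 < σ) (hR : 0 < R) (hB : 0 ≤ B) :
    ∫⁻ τ in Set.Ioi R, ENNReal.ofReal (B * τ ^ (-σ)) =
      ENNReal.ofReal (B * R ^ (1 - σ) / (σ - 1)) := by
  rw [← ofReal_integral_eq_lintegral_ofReal]
  · rw [integral_const_mul, integral_Ioi_rpow_of_lt (by linarith) hR]
    congr 1
    rw [show -σ + 1 = 1 - σ by ring]
    have : (1 - σ) ≠ 0 := by linarith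
    have : (σ - 1) ≠ 0 := by linarith
    field_simp
    ring
  · exact (integrableOn_Ioi_rpow_of_lt (by linarith) hR).const_mul _
  · filter_upwards [ae_restrict_mem measurableSet_Ioi] with x hx
    have : 0 < x := hR.trans hx
    positivity

lemma ker_far {σ R B : ℝ} (hσ : 1 < σ) (hR : 0 < R) (hB : 0 ≤ B) :
    ∫⁻ τ, (Set.Ici R).indicator (fun τ => ENNReal.ofReal (B * τ ^ (-σ))) τ =
      ENNReal.ofReal (B * R ^ (1 - σ) / (σ - 1)) := by
  rw [lintegral_indicator measurableSet_Ici, ← lintegral_Ioi_pow hσ hR hB]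
  exact setLIntegral_congr Ioi_ae_eq_Ici.symm

lemma ker_near {σ R E B : ℝ} (hσ : 1 < σ) (hR : 0 < R) (hE : 0 ≤ E) (hB : 0 ≤ B) :
    ∫⁻ τ, (if |τ| < R then ENNReal.ofReal E else ENNReal.ofReal (B * |τ| ^ (-σ))) ≤
      ENNReal.ofReal (2 * R * E + 2 * (B * R ^ (1 - σ) / (σ - 1))) := by
  have h0 : ∀ τ : ℝ, (if |τ| < R then ENNReal.ofReal E else ENNReal.ofReal (B * |τ| ^ (-σ)))
      ≤ (Set.Ioo (-R) R).indicator (fun _ => ENNReal.ofReal E) τ +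
        ((Set.Ici R).indicator (fun τ => ENNReal.ofReal (B * τ ^ (-σ))) τ +
         (Set.Ici R).indicator (fun τ => ENNReal.ofReal (B * τ ^ (-σ))) (-τ)) := by
    intro τ
    split_ifs with h
    · rw [Set.indicator_of_mem (by simpa [abs_lt] using h)]
      exact le_self_add
    · rcases le_abs'.1 (not_lt.1 h) with h' | h'
      · rw [Set.indicator_of_mem (a := -τ) (by simpa using (by linarith : R ≤ -τ)),
          abs_of_neg (by linarith)]
        exact le_add_self.trans le_add_self
      · rw [Set.indicator_of_mem (a := τ) (s := Set.Ici R) (by simpa using h'),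
          abs_of_pos (by linarith)]
        exact le_self_add.trans le_add_self
  refine (lintegral_mono h0).trans ?_
  have hm : Measurable ((Set.Ici R).indicator (fun τ : ℝ => ENNReal.ofReal (B * τ ^ (-σ)))) :=
    Measurable.indicator (by fun_prop) measurableSet_Ici
  have h1 : 0 ≤ B * R ^ (1 - σ) / (σ - 1) := by
    have : 0 < σ - 1 := by linarith
    positivity
  rw [lintegral_add_left (measurable_const.indicator measurableSet_Ioo), lintegral_add_left hm,
    lintegral_neg_eq_self, ker_far hσ hR hB, lintegral_indicator measurableSet_Ioo]
  simp only [lintegral_const, Measure.restrict_apply MeasurableSet.univ, Set.univ_inter,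
    Real.volume_Ioo]
  rw [← ENNReal.ofReal_mul hE, ← ENNReal.ofReal_add h1 h1, ← ENNReal.ofReal_add (by nlinarith) (by linarith)]
  apply ENNReal.ofReal_le_ofReal
  linarith

section Hilb
variable {H : Type*} [NormedAddCommGroup H] [InnerProductSpace ℂ H] [CompleteSpace H]

lemma integrable_inner_prod {f g : ℝ → H} (hf : Integrable f) (hg : Integrable g) :
    Integrable (fun z : ℝ × ℝ => inner ℂ (f z.1) (g z.2)) := by
  have h1 : Integrable (fun z : ℝ × ℝ => ‖f z.1‖ * ‖g z.2‖) := hf.norm.mul_prod hg.norm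
  refine h1.mono ?_ (ae_of_all _ fun z => ?_)
  · exact (hf.aestronglyMeasurable.comp_fst).inner (hg.aestronglyMeasurable.comp_snd)
  · simpa using norm_inner_le_norm (𝕜 := ℂ) (f z.1) (g z.2)

lemma norm_integral_sq_le {g : ℝ → H} {μ : Measure ℝ} [SFinite μ] (hg : Integrable g μ) :
    ‖∫ t, g t ∂μ‖ₑ ^ 2 ≤ ∫⁻ z : ℝ × ℝ, ‖inner ℂ (g z.1) (g z.2)‖ₑ ∂(μ.prod μ) := by
  have e : inner ℂ (∫ t, g t ∂μ) (∫ t, g t ∂μ) =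
      ∫ z : ℝ × ℝ, inner ℂ (g z.1) (g z.2) ∂(μ.prod μ) := by
    have hI : Integrable (fun z : ℝ × ℝ => inner ℂ (g z.1) (g z.2)) (μ.prod μ) := by
      have h1 : Integrable (fun z : ℝ × ℝ => ‖g z.1‖ * ‖g z.2‖) (μ.prod μ) :=
        hg.norm.mul_prod hg.norm
      refine h1.mono ?_ (ae_of_all _ fun z => ?_)
      · exact (hg.aestronglyMeasurable.comp_fst).inner (hg.aestronglyMeasurable.comp_snd)
      · simpa using norm_inner_le_norm (𝕜 := ℂ) (g z.1) (g z.2)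
    rw [integral_prod _ hI]
    simp only [integral_inner hg]
    rw [← inner_conj_symm, ← integral_inner hg, ← integral_conj]
    simp only [inner_conj_symm]
  have : ‖∫ t, g t ∂μ‖ₑ ^ 2 = ‖inner ℂ (∫ t, g t ∂μ) (∫ t, g t ∂μ)‖ₑ := by
    rw [inner_self_eq_norm_sq_to_K]
    rw [← ofReal_norm, ← ofReal_norm, ← ENNReal.ofReal_pow (norm_nonneg _)]
    simp
  rw [this, e]
  exact enorm_integral_le_lintegral_enorm _

/-- near-diagonal part -/
lemma near_bound {f g : ℝ → H} (hf : Integrable f) (hg : Integrable g)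
    {a b κ : ℝ → ℝ≥0∞} (ha : Measurable a) (hb : Measurable b) (hκ : Measurable κ)
    {Ef : ℝ≥0∞} (hfa : ∀ s, ‖f s‖ₑ ≤ Ef * a s)
    (hgg : ∀ t t', ‖inner ℂ (g t) (g t')‖ₑ ≤ κ (t' - t) * (b t * b t'))
    {R η : ℝ} (hR : 0 < R) (hη : 0 < η) :
    ‖∫ z in {z : ℝ × ℝ | z.1 < z.2 ∧ z.2 < z.1 + R}, inner ℂ (f z.1) (g z.2)‖ₑ ≤
      ENNReal.ofReal η * Ef ^ 2 * (∫⁻ s, a s ^ 2) +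
      ENNReal.ofReal η⁻¹ * (ENNReal.ofReal R * (∫⁻ x, κ x) * ((∫⁻ s, b s ^ 2) + ∫⁻ s, b s ^ 2)) := by
  have hS : MeasurableSet {z : ℝ × ℝ | z.1 < z.2 ∧ z.2 < z.1 + R} :=
    (measurableSet_lt measurable_fst measurable_snd).inter
      (measurableSet_lt measurable_snd (by fun_prop))
  set W : ℝ → H := fun s => ∫ t in Set.Ioo s (s + R), g t with hW
  have e1 : ∫ z in {z : ℝ × ℝ | z.1 < z.2 ∧ z.2 < z.1 + R}, inner ℂ (f z.1) (g z.2) =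
      ∫ s, inner ℂ (f s) (W s) := by
    rw [← integral_indicator hS, Measure.volume_eq_prod,
      integral_prod _ ((integrable_inner_prod hf hg).indicator hS)]
    congr 1 with s
    rw [hW]
    simp only
    rw [← integral_inner hg.integrableOn, ← integral_indicator measurableSet_Ioo]
    rfl
  have hWs : ∀ s, ‖W s‖ₑ ^ 2 ≤ ∫⁻ z : ℝ × ℝ, (Set.Ioo s (s+R)).indicator 1 z.1 *
      (κ (z.2 - z.1) * (b z.1 * b z.2)) := by
    intro s
    refine (norm_integral_sq_le hg.integrableOn).trans ?_
    rw [Measure.prod_restrict, ← lintegral_indicator (measurableSet_Ioo.prod measurableSet_Ioo),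
      ← Measure.volume_eq_prod]
    refine lintegral_mono fun z => ?_
    by_cases h : z.1 ∈ Set.Ioo s (s+R)
    · rw [Set.indicator_of_mem h]
      refine (Set.indicator_le_self _ _ _).trans ?_
      simpa using hgg z.1 z.2
    · rw [Set.indicator_of_notMem]
      · simp
      · exact fun h' => h h'.1
  have hkm : Measurable fun z : ℝ × ℝ => κ (z.2 - z.1) * (b z.1 * b z.2) := by fun_prop
  have hWint : ∫⁻ s, ‖W s‖ₑ ^ 2 ≤ ENNReal.ofReal R * (∫⁻ x, κ x) *
      ((∫⁻ s, b s ^ 2) + ∫⁻ s, b s ^ 2) := by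
    refine (lintegral_mono hWs).trans ?_
    rw [lintegral_lintegral_swap]
    · have : ∀ z : ℝ × ℝ, ∫⁻ s, (Set.Ioo s (s+R)).indicator (1 : ℝ → ℝ≥0∞) z.1 *
          (κ (z.2 - z.1) * (b z.1 * b z.2)) =
          ENNReal.ofReal R * (κ (z.2 - z.1) * (b z.1 * b z.2)) := by
        intro z
        have : ∀ s, (Set.Ioo s (s+R)).indicator (1 : ℝ → ℝ≥0∞) z.1 =
            (Set.Ioo (z.1 - R) z.1).indicator 1 s := by
          intro s
          simp only [Set.indicator_apply, Set.mem_Ioo]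
          congr 1
          apply propext
          constructor <;> rintro ⟨h1, h2⟩ <;> constructor <;> linarith
        simp only [this]
        rw [lintegral_mul_const _ (measurable_one.indicator measurableSet_Ioo),
          lintegral_indicator_one measurableSet_Ioo]
        simp
      simp only [this]
      rw [lintegral_const_mul _ hkm, mul_assoc]
      gcongr
      exact schur_conv hκ hb hb
    · apply Measurable.aemeasurable
      apply Measurable.mul
      · have : MeasurableSet {p : ℝ × ℝ × ℝ | p.1 < p.2.1 ∧ p.2.1 < p.1 + R} :=
          (measurableSet_lt measurable_fst measurable_snd.fst).inter
            (measurableSet_lt measurable_snd.fst (measurable_fst.add_const R))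
        exact (measurable_one (α := ℝ≥0∞)).indicator this
      · fun_prop
  rw [e1]
  refine (enorm_integral_le_lintegral_enorm _).trans ?_
  calc ∫⁻ s, ‖inner ℂ (f s) (W s)‖ₑ
      ≤ ∫⁻ s, (ENNReal.ofReal η * Ef ^ 2 * a s ^ 2 + ENNReal.ofReal η⁻¹ * ‖W s‖ₑ ^ 2) := by
        refine lintegral_mono fun s => ?_
        have h1 : ‖inner ℂ (f s) (W s)‖ₑ ≤ ENNReal.ofReal η * ‖f s‖ₑ ^ 2 +
            ENNReal.ofReal η⁻¹ * ‖W s‖ₑ ^ 2 := by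
          rw [← ofReal_norm, ← ofReal_norm, ← ofReal_norm,
            ← ENNReal.ofReal_pow (norm_nonneg _), ← ENNReal.ofReal_pow (norm_nonneg _),
            ← ENNReal.ofReal_mul hη.le, ← ENNReal.ofReal_mul (by positivity),
            ← ENNReal.ofReal_add (by positivity) (by positivity)]
          apply ENNReal.ofReal_le_ofReal
          refine (norm_inner_le_norm _ _).trans ?_
          have : η * ‖f s‖^2 + η⁻¹ * ‖W s‖^2 - ‖f s‖ * ‖W s‖ =
            η⁻¹ * ((η * ‖f s‖ - ‖W s‖/2)^2 + 3/4 * ‖W s‖^2) := by field_simp; ring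
          have : 0 ≤ η⁻¹ * ((η * ‖f s‖ - ‖W s‖/2)^2 + 3/4 * ‖W s‖^2) := by positivity
          linarith
        refine h1.trans ?_
        refine add_le_add ?_ le_rfl
        rw [mul_assoc, ← mul_pow]
        gcongr
        exact hfa s
    _ = ENNReal.ofReal η * Ef ^ 2 * (∫⁻ s, a s ^ 2) + ENNReal.ofReal η⁻¹ * ∫⁻ s, ‖W s‖ₑ ^ 2 := by
        rw [lintegral_add_left (by fun_prop), lintegral_const_mul _ (by fun_prop),
          lintegral_const_mul' _ _ (by simp)]
    _ ≤ _ := by gcongr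

end Hilb

end

section

section Hilb
variable {H : Type*} [NormedAddCommGroup H] [InnerProductSpace ℂ H] [CompleteSpace H]

/-- The retarded bilinear form. -/
def Bil (f g : ℝ → H) : ℂ := ∫ z in {z : ℝ × ℝ | z.1 < z.2}, inner ℂ (f z.1) (g z.2)

lemma measurableSet_ltset : MeasurableSet {z : ℝ × ℝ | z.1 < z.2} :=
  measurableSet_lt measurable_fst measurable_snd

lemma Bil_reverse (f g : ℝ → H) :
    Bil f g = (starRingEnd ℂ) (Bil (fun t => g (-t)) (fun s => f (-s))) := by
  unfold Bil
  rw [← integral_conj]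
  simp only [inner_conj_symm]
  rw [← integral_indicator measurableSet_ltset, ← integral_indicator measurableSet_ltset]
  have hmp : MeasurePreserving (fun z : ℝ × ℝ => (-z.2, -z.1)) volume volume := by
    have h1 : MeasurePreserving (Prod.swap : ℝ × ℝ → ℝ × ℝ) volume volume :=
      Measure.measurePreserving_swap
    have h2 : MeasurePreserving (Prod.map (fun x : ℝ => -x) (fun x : ℝ => -x))
      (volume : Measure (ℝ × ℝ)) volume :=
      (Measure.measurePreserving_neg volume).prod (Measure.measurePreserving_neg volume)
    exact h2.comp h1
  have he : MeasurableEmbedding (fun z : ℝ × ℝ => (-z.2, -z.1)) :=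
    ((MeasurableEquiv.prodComm).trans
      ((MeasurableEquiv.neg ℝ).prodCongr (MeasurableEquiv.neg ℝ))).measurableEmbedding
  rw [← hmp.integral_comp he]
  congr 1 with z
  simp [Set.indicator_apply]

lemma pair_pow (σ x y : ℝ) (hσ : 1 < σ) :
    (2:ℝ) ^ ((x + y) * ((σ - 1) / (2 * σ))) * ((2:ℝ) ^ ((3 * x + y) / (4 * σ))) ^ (1 - σ) =
      2 ^ (-((σ - 1) / (4 * σ) * (x - y))) := by
  rw [← Real.rpow_mul (by norm_num), ← Real.rpow_add (by norm_num)]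
  congr 1
  field_simp
  ring

lemma pair_bound {σ A : ℝ} (hσ : 1 < σ) (hA : 0 ≤ A) {f g : ℝ → H}
    (hf : Integrable f) (hg : Integrable g) {a b : ℝ → ℝ≥0∞} (ha : Measurable a)
    (hb : Measurable b) {x y : ℝ} (hxy : y ≤ x)
    (hfa : ∀ s, ‖f s‖ₑ ≤ ENNReal.ofReal (2 ^ (-x / (2 * σ))) * a s)
    (hgb : ∀ s, ‖g s‖ₑ ≤ ENNReal.ofReal (2 ^ (-y / (2 * σ))) * b s)
    (hfg : ∀ s t, s ≠ t → ‖inner ℂ (f s) (g t)‖ₑ ≤ ENNReal.ofReal (A * |t - s| ^ (-σ)) *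
      (ENNReal.ofReal (2 ^ (x * ((σ - 1) / (2 * σ)))) * a s) *
      (ENNReal.ofReal (2 ^ (y * ((σ - 1) / (2 * σ)))) * b t))
    (hgg : ∀ s t, s ≠ t → ‖inner ℂ (g s) (g t)‖ₑ ≤ ENNReal.ofReal (A * |t - s| ^ (-σ)) *
      (ENNReal.ofReal (2 ^ (y * ((σ - 1) / (2 * σ)))) * b s) *
      (ENNReal.ofReal (2 ^ (y * ((σ - 1) / (2 * σ)))) * b t)) :
    ‖Bil f g‖ₑ ≤ ENNReal.ofReal ((A / (σ - 1) + 1 + 2 * (2 + 2 * (A / (σ - 1)))) *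
        2 ^ (- (min (1 / (8 * σ)) ((σ - 1) / (4 * σ)) * (x - y)))) *
      ((∫⁻ s, a s ^ 2) + ∫⁻ s, b s ^ 2) := by
  have hσ1 : 0 < σ - 1 := by linarith
  have hσ0 : 0 < σ := by linarith
  set R : ℝ := 2 ^ ((3 * x + y) / (4 * σ)) with hRdef
  have hR : 0 < R := by positivity
  set c := min (1 / (8 * σ)) ((σ - 1) / (4 * σ)) with hc
  set E : ℝ := 2 ^ (- (c * (x - y))) with hE
  have hEpos : 0 < E := by positivity
  set D : ℝ := 2 + 2 * (A / (σ - 1)) with hD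
  have hAσ : 0 ≤ A / (σ - 1) := by positivity
  have hD0 : 0 ≤ D := by positivity
  -- far
  have hfar : ‖∫ z in {z : ℝ × ℝ | z.1 + R ≤ z.2}, inner ℂ (f z.1) (g z.2)‖ₑ ≤
      ENNReal.ofReal (A / (σ - 1) * E) * ((∫⁻ s, a s ^ 2) + ∫⁻ s, b s ^ 2) := by
    have hS : MeasurableSet {z : ℝ × ℝ | z.1 + R ≤ z.2} :=
      measurableSet_le (by fun_prop) measurable_snd
    refine (enorm_integral_le_lintegral_enorm _).trans ?_
    rw [← lintegral_indicator hS]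
    set B : ℝ := A * 2 ^ ((x + y) * ((σ - 1) / (2 * σ))) with hB
    have hB0 : 0 ≤ B := by positivity
    have hkm : Measurable ((Set.Ici R).indicator (fun τ : ℝ => ENNReal.ofReal (B * τ ^ (-σ)))) :=
      Measurable.indicator (by fun_prop) measurableSet_Ici
    calc _ ≤ ∫⁻ z : ℝ × ℝ, (Set.Ici R).indicator (fun τ => ENNReal.ofReal (B * τ ^ (-σ)))
            (z.2 - z.1) * (a z.1 * b z.2) := by
          refine lintegral_mono fun z => ?_
          by_cases h : z.1 + R ≤ z.2
          · rw [Set.indicator_of_mem (by exact h), Set.indicator_of_mem (by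
              simp only [Set.mem_Ici]; linarith)]
            refine (hfg _ _ (by linarith)).trans (le_of_eq ?_)
            rw [abs_of_nonneg (by linarith : 0 ≤ z.2 - z.1)]
            have h0 : 0 ≤ z.2 - z.1 := by linarith
            rw [hB, add_mul, Real.rpow_add (by norm_num)]
            rw [ENNReal.ofReal_mul hA, ENNReal.ofReal_mul (by positivity), ENNReal.ofReal_mul hA,
              ENNReal.ofReal_mul (by positivity)]
            ring
          · rw [Set.indicator_of_notMem (by exact h)]
            exact zero_le
      _ ≤ _ := schur_conv hkm ha hb
      _ ≤ _ := by
          rw [ker_far hσ hR hB0]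
          gcongr
          rw [hB, mul_assoc, pair_pow σ x y hσ, mul_div_right_comm]
          gcongr
          rw [hE]
          apply Real.rpow_le_rpow_of_exponent_le (by norm_num)
          have : c * (x - y) ≤ (σ - 1) / (4 * σ) * (x - y) := by
            exact mul_le_mul_of_nonneg_right (min_le_right _ _) (by linarith)
          linarith
  -- near
  set κ : ℝ → ℝ≥0∞ := fun τ => if |τ| < 2 ^ (y / σ) then ENNReal.ofReal (2 ^ (-y / σ)) else
    ENNReal.ofReal ((A * 2 ^ (y * ((σ - 1) / σ))) * |τ| ^ (-σ)) with hκdef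
  have hκ : Measurable κ := by
    apply Measurable.ite
    · exact measurableSet_lt (by fun_prop) measurable_const
    · fun_prop
    · fun_prop
  have hκint : ∫⁻ τ, κ τ ≤ ENNReal.ofReal D := by
    refine (ker_near hσ (by positivity) (by positivity) (by positivity)).trans ?_
    apply ENNReal.ofReal_le_ofReal
    apply le_of_eq
    have e1 : (2:ℝ) ^ (y / σ) * 2 ^ (-y / σ) = 1 := by
      rw [← Real.rpow_add (by norm_num)]
      convert Real.rpow_zero 2 using 2
      ring
    have e2 : (2:ℝ) ^ (y * ((σ - 1) / σ)) * (2 ^ (y / σ)) ^ (1 - σ) = 1 := by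
      rw [← Real.rpow_mul (by norm_num), ← Real.rpow_add (by norm_num)]
      convert Real.rpow_zero 2 using 2
      field_simp; ring
    rw [mul_assoc, e1, mul_assoc A, e2, hD]; ring
  have hgg' : ∀ t t', ‖inner ℂ (g t) (g t')‖ₑ ≤ κ (t' - t) * (b t * b t') := by
    intro t t'
    rw [hκdef]
    simp only
    split_ifs with h
    · have h1 : ‖inner ℂ (g t) (g t')‖ₑ ≤ ‖g t‖ₑ * ‖g t'‖ₑ := by
        rw [← ofReal_norm, ← ofReal_norm, ← ofReal_norm, ← ENNReal.ofReal_mul (norm_nonneg _)]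
        exact ENNReal.ofReal_le_ofReal (norm_inner_le_norm _ _)
      refine h1.trans ((mul_le_mul' (hgb t) (hgb t')).trans (le_of_eq ?_))
      have : (2:ℝ) ^ (-y / σ) = 2 ^ (-y / (2 * σ)) * 2 ^ (-y / (2 * σ)) := by
        rw [← Real.rpow_add (by norm_num)]; congr 1; field_simp; ring
      rw [this, ENNReal.ofReal_mul (by positivity)]
      ring
    · have hne : t ≠ t' := by
        rintro rfl
        simp only [sub_self, abs_zero, not_lt] at h
        have : (0:ℝ) < 2 ^ (y / σ) := by positivity
        linarith
      refine (hgg t t' hne).trans (le_of_eq ?_)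
      have : (2:ℝ) ^ (y * ((σ - 1) / σ)) =
          2 ^ (y * ((σ - 1) / (2 * σ))) * 2 ^ (y * ((σ - 1) / (2 * σ))) := by
        rw [← Real.rpow_add (by norm_num)]; congr 1; field_simp; ring
      rw [this, ENNReal.ofReal_mul hA, ENNReal.ofReal_mul (by positivity), ENNReal.ofReal_mul hA,
        ENNReal.ofReal_mul (by positivity)]
      ring
  set η : ℝ := 2 ^ ((7 * x + y) / (8 * σ)) with hη
  have hη0 : 0 < η := by positivity
  have hnear := near_bound hf hg ha hb hκ hfa hgg' hR hη0
  have hE' : (2:ℝ) ^ (-(1 / (8 * σ) * (x - y))) ≤ E := by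
    rw [hE]
    apply Real.rpow_le_rpow_of_exponent_le (by norm_num)
    have : c * (x - y) ≤ 1 / (8 * σ) * (x - y) := by
      exact mul_le_mul_of_nonneg_right (min_le_left _ _) (by linarith)
    linarith
  have hn1 : ENNReal.ofReal η * ENNReal.ofReal (2 ^ (-x / (2 * σ))) ^ 2 ≤ ENNReal.ofReal E := by
    rw [← ENNReal.ofReal_pow (by positivity), ← ENNReal.ofReal_mul hη0.le]
    apply ENNReal.ofReal_le_ofReal
    refine le_trans (le_of_eq ?_) hE'
    rw [hη, ← Real.rpow_natCast, ← Real.rpow_mul (by norm_num), ← Real.rpow_add (by norm_num)]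
    congr 1; push_cast; field_simp; ring
  have hn2 : ENNReal.ofReal η⁻¹ * ENNReal.ofReal R ≤ ENNReal.ofReal E := by
    rw [← ENNReal.ofReal_mul (by positivity)]
    apply ENNReal.ofReal_le_ofReal
    refine le_trans (le_of_eq ?_) hE'
    rw [hη, hRdef, ← Real.rpow_neg (by norm_num), ← Real.rpow_add (by norm_num)]
    congr 1; field_simp; ring
  have hsplit : Bil f g = (∫ z in {z : ℝ × ℝ | z.1 < z.2 ∧ z.2 < z.1 + R}, inner ℂ (f z.1) (g z.2))
      + ∫ z in {z : ℝ × ℝ | z.1 + R ≤ z.2}, inner ℂ (f z.1) (g z.2) := by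
    rw [← setIntegral_union]
    · unfold Bil
      congr 2
      ext z
      simp only [Set.mem_ofPred_eq, Set.mem_union]
      constructor
      · intro h
        by_cases h' : z.2 < z.1 + R
        · exact Or.inl ⟨h, h'⟩
        · exact Or.inr (not_lt.1 h')
      · rintro (h | h)
        · exact h.1
        · linarith
    · rw [Set.disjoint_left]
      rintro z ⟨_, h⟩ h'
      exact absurd h (not_lt.2 h')
    · exact measurableSet_le (by fun_prop) measurable_snd
    · exact (integrable_inner_prod hf hg).integrableOn
    · exact (integrable_inner_prod hf hg).integrableOn
  set IA := ∫⁻ s, a s ^ 2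
  set IB := ∫⁻ s, b s ^ 2
  rw [hsplit]
  refine (enorm_add_le _ _).trans ((add_le_add hnear hfar).trans ?_)
  calc _ ≤ ENNReal.ofReal E * IA + ENNReal.ofReal E * (ENNReal.ofReal D * (IB + IB)) +
        ENNReal.ofReal (A / (σ - 1) * E) * (IA + IB) := by
        refine add_le_add (add_le_add ?_ ?_) le_rfl
        · gcongr
        · rw [mul_assoc (ENNReal.ofReal R), ← mul_assoc]
          gcongr
    _ ≤ ENNReal.ofReal E * (IA + IB) + ENNReal.ofReal E * (ENNReal.ofReal (2 * D) * (IA + IB)) +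
        ENNReal.ofReal (A / (σ - 1) * E) * (IA + IB) := by
        refine add_le_add (add_le_add ?_ ?_) le_rfl
        · gcongr; exact le_self_add
        · gcongr ENNReal.ofReal E * ?_
          rw [ENNReal.ofReal_mul (by norm_num), ← two_mul, ENNReal.ofReal_ofNat]
          calc ENNReal.ofReal D * (2 * IB) = 2 * ENNReal.ofReal D * IB := by ring
            _ ≤ _ := by gcongr; exact le_add_self
    _ = _ := by
        rw [show (A / (σ - 1) + 1 + 2 * D) * E = E + E * (2 * D) + (A / (σ - 1) * E) by ring,
          ENNReal.ofReal_add (by positivity) (by positivity),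
          ENNReal.ofReal_add (by positivity) (by positivity),
          ENNReal.ofReal_mul (p := E) (by positivity)]
        ring

end Hilb

end

section

section atoms
variable {X : Type*} [MeasurableSpace X] {μ : Measure X}

/-- indicator cut of an L2 function -/
def cutLp (f : Lp ℂ 2 μ) (E : Set X) (hE : MeasurableSet E) : Lp ℂ 2 μ :=
  ((Lp.memLp f).indicator hE).toLp _

/-- nice functions: bounded above and below where nonzero -/
def Nice (f : Lp ℂ 2 μ) : Prop :=
  ∃ ε > (0:ℝ), ∃ M : ℝ, ∀ᵐ x ∂μ, f x = 0 ∨ (ε ≤ ‖f x‖ ∧ ‖f x‖ ≤ M)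

/-- dyadic level -/
def lev (f : Lp ℂ 2 μ) (n : ℤ) : Set X := {x | (2:ℝ) ^ n ≤ ‖f x‖ ∧ ‖f x‖ < (2:ℝ) ^ (n + 1)}

lemma lev_meas (f : Lp ℂ 2 μ) (n : ℤ) : MeasurableSet (lev f n) := by
  have hf : Measurable f := (Lp.stronglyMeasurable f).measurable
  exact (measurableSet_le measurable_const hf.norm).inter (measurableSet_lt hf.norm measurable_const)

lemma lev_disj (f : Lp ℂ 2 μ) {n m : ℤ} (h : n ≠ m) : Disjoint (lev f n) (lev f m) := by
  rw [Set.disjoint_left]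
  rintro x ⟨h1, h2⟩ ⟨h3, h4⟩
  apply h
  have a1 := (zpow_lt_zpow_iff_right₀ (by norm_num : (1:ℝ) < 2)).1 (h1.trans_lt h4)
  have a2 := (zpow_lt_zpow_iff_right₀ (by norm_num : (1:ℝ) < 2)).1 (h3.trans_lt h2)
  omega

lemma lev_finite (f : Lp ℂ 2 μ) (n : ℤ) : μ (lev f n) ≠ ∞ := by
  have hf := Lp.memLp f
  have := hf.meas_ge_lt_top (by norm_num) (by norm_num) (ε := ((2:ℝ≥0)^n)) (by positivity)
  refine (lt_of_le_of_lt (measure_mono ?_) this).ne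
  rintro x ⟨h1, _⟩
  simp only [Set.mem_ofPred_eq]
  rw [← NNReal.coe_le_coe]
  push_cast
  simpa using h1

lemma lev_e1 (f : Lp ℂ 2 μ) (n k : ℤ) (h : μ (lev f n) ≤ ENNReal.ofReal (2 ^ (k+1))) :
    eLpNorm (cutLp f (lev f n) (lev_meas f n)) 1 μ ≤ ENNReal.ofReal (2 ^ (n+1) * 2 ^ (k+1)) := by
  rw [cutLp, eLpNorm_congr_ae (MemLp.coeFn_toLp _), eLpNorm_one_eq_lintegral_enorm]
  calc _ ≤ ∫⁻ x, (lev f n).indicator (fun _ => ENNReal.ofReal (2^(n+1))) x ∂μ := by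
        refine lintegral_mono fun x => ?_
        by_cases hx : x ∈ lev f n
        · rw [Set.indicator_of_mem hx, Set.indicator_of_mem hx, ← ofReal_norm]
          exact ENNReal.ofReal_le_ofReal hx.2.le
        · rw [Set.indicator_of_notMem hx]; simp
    _ = ENNReal.ofReal (2^(n+1)) * μ (lev f n) := by
        rw [lintegral_indicator_const (lev_meas f n)]
    _ ≤ _ := by
        rw [ENNReal.ofReal_mul (by positivity)]
        gcongr

lemma lev_e2 (f : Lp ℂ 2 μ) (n k : ℤ) (h : μ (lev f n) ≤ ENNReal.ofReal (2 ^ (k+1))) :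
    ‖cutLp f (lev f n) (lev_meas f n)‖ₑ ≤
      ENNReal.ofReal (2 ^ (n+1) * (2:ℝ) ^ (((k+1 : ℤ):ℝ)/2)) := by
  rw [cutLp, Lp.enorm_def, eLpNorm_congr_ae (MemLp.coeFn_toLp _)]
  calc _ ≤ eLpNorm ((lev f n).indicator (fun _ => (2:ℝ)^(n+1))) 2 μ := by
        refine eLpNorm_mono fun x => ?_
        by_cases hx : x ∈ lev f n
        · rw [Set.indicator_of_mem hx, Set.indicator_of_mem hx]
          rw [Real.norm_of_nonneg (by positivity)]
          exact hx.2.le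
        · rw [Set.indicator_of_notMem hx]; simp
    _ = ENNReal.ofReal (2^(n+1)) * μ (lev f n) ^ (1/2:ℝ) := by
        rw [eLpNorm_indicator_const (lev_meas f n) (by norm_num) (by norm_num), ← ofReal_norm,
          Real.norm_of_nonneg (by positivity)]
        norm_num
    _ ≤ _ := by
        rw [ENNReal.ofReal_mul (by positivity)]
        gcongr
        refine (ENNReal.rpow_le_rpow h (by norm_num)).trans (le_of_eq ?_)
        rw [ENNReal.ofReal_rpow_of_pos (by positivity), ← Real.rpow_intCast, ← Real.rpow_mul (by norm_num)]
        congr 2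
        ring

lemma geo_int (G : Finset ℤ) (N : ℤ) (h : ∀ n ∈ G, n ≤ N) : ∑ n ∈ G, (2:ℝ) ^ n ≤ 2 * 2 ^ N := by
  have hinj : Function.Injective (fun n : ℤ => N - n) := fun a b h => by simpa using h
  set g : ℤ → ℕ := fun n => (N - n).toNat with hg
  have hgi : Set.InjOn g G := by
    intro a ha b hb hab
    have := h a ha
    have := h b hb
    simp only [hg] at hab
    omega
  have : ∀ n ∈ G, (2:ℝ)^n = 2^N * (1/2:ℝ)^(g n) := by
    intro n hn
    have h1 := h n hn
    have : n = N - (g n : ℤ) := by simp only [hg]; omega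
    conv_lhs => rw [this, zpow_sub₀ (by norm_num)]
    simp [div_eq_mul_inv]
  rw [Finset.sum_congr rfl this, ← Finset.mul_sum, mul_comm]
  gcongr
  rw [← Finset.sum_image (f := fun m : ℕ => (1/2:ℝ)^m) hgi]
  calc _ ≤ ∑' m : ℕ, (1/2:ℝ)^m := summable_geometric_two.sum_le_tsum _ (fun _ _ => by positivity)
    _ = 2 := tsum_geometric_two

lemma atoms {p : ℝ} (hp : 1 ≤ p) (hp2 : p ≤ 2) (f : Lp ℂ 2 μ) (hf : Nice f)
    (hfp : ∫⁻ x, ‖f x‖ₑ ^ p ∂μ ≤ 1) :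
    ∃ (K : Finset ℤ) (fk : ℤ → Lp ℂ 2 μ) (a : ℤ → ℝ), (∀ k, 0 ≤ a k) ∧ f = ∑ k ∈ K, fk k ∧
      (∀ k, eLpNorm (fk k) 1 μ ≤ ENNReal.ofReal (4 * 2 ^ (k * (1 - 1/p)) * a k)) ∧
      (∀ k, ‖fk k‖ₑ ≤ ENNReal.ofReal (4 * 2 ^ (k * (1/2 - 1/p)) * a k)) ∧
      (∑ k ∈ K, a k ^ 2 ≤ 4) ∧ (∀ k ∉ K, fk k = 0 ∧ a k = 0) := by
  classical
  obtain ⟨ε, hε, M, hM⟩ := hf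
  have hfm : Measurable f := (Lp.stronglyMeasurable f).measurable
  set J : Finset ℤ := (Finset.Icc (Int.log 2 ε) (Int.log 2 M)).filter (fun n => μ (lev f n) ≠ 0) with hJ
  set κ : ℤ → ℤ := fun n => Int.log 2 (μ (lev f n)).toReal with hκ
  have hmpos : ∀ n ∈ J, 0 < (μ (lev f n)).toReal := fun n hn =>
    ENNReal.toReal_pos (Finset.mem_filter.1 hn).2 (lev_finite f n)
  have hκ1 : ∀ n ∈ J, ENNReal.ofReal (2 ^ (κ n)) ≤ μ (lev f n) := by
    intro n hn
    rw [ENNReal.ofReal_le_iff_le_toReal (lev_finite f n)]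
    exact_mod_cast Int.zpow_log_le_self (b := 2) (by norm_num) (hmpos n hn)
  have hκ2 : ∀ n ∈ J, μ (lev f n) ≤ ENNReal.ofReal (2 ^ (κ n + 1)) := by
    intro n hn
    rw [ENNReal.le_ofReal_iff_toReal_le (lev_finite f n) (by positivity)]
    exact_mod_cast (Int.lt_zpow_succ_log_self (b := 2) (by norm_num) ((μ (lev f n)).toReal)).le
  set G : ℤ → Finset ℤ := fun k => J.filter (fun n => κ n = k) with hG
  set g : ℤ → Lp ℂ 2 μ := fun n => cutLp f (lev f n) (lev_meas f n) with hg
  have hp0 : 0 < p := by linarith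
  refine ⟨J.image κ, fun k => ∑ n ∈ G k, g n, fun k => ∑ n ∈ G k, (2:ℝ)^n * 2 ^ ((k:ℝ)/p),
    ?_, ?_, ?_, ?_, ?_, ?_⟩
  · intro k; positivity
  · rw [Finset.sum_fiberwise_of_maps_to (fun n hn => Finset.mem_image_of_mem κ hn)]
    apply Lp.ext
    have h1 : ∀ᵐ x ∂μ, ∀ n ∈ J, g n x = (lev f n).indicator f x := by
      rw [Filter.eventually_all_finset]
      intro n _
      exact MemLp.coeFn_toLp _
    have h2 : ∀ᵐ x ∂μ, (∑ n ∈ J, g n : Lp ℂ 2 μ) x = ∑ n ∈ J, g n x := by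
      have := Lp.coeFn_finsetSum J g
      filter_upwards [this] with x hx
      rw [hx]; simp
    have h3 : ∀ᵐ x ∂μ, ∀ n : ℤ, μ (lev f n) = 0 → x ∉ lev f n := by
      rw [ae_all_iff]
      intro n
      by_cases h : μ (lev f n) = 0
      · have := measure_eq_zero_iff_ae_notMem.1 h
        filter_upwards [this] with x hx _ using hx
      · exact Filter.Eventually.of_forall fun x hx => absurd hx h
    filter_upwards [h1, h2, h3, hM] with x h1 h2 h3 h4
    rw [h2, Finset.sum_congr rfl h1]
    rcases h4 with h4 | ⟨h4, h5⟩
    · rw [h4]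
      symm
      apply Finset.sum_eq_zero
      intro n _
      apply Set.indicator_of_notMem
      rintro ⟨h, _⟩
      rw [h4, norm_zero] at h
      have : (0:ℝ) < 2 ^ n := by positivity
      linarith
    · have hpos : 0 < ‖f x‖ := hε.trans_le h4
      set n := Int.log 2 ‖f x‖ with hn
      have hmem : x ∈ lev f n := by
        refine ⟨?_, ?_⟩
        · exact_mod_cast Int.zpow_log_le_self (b := 2) (by norm_num) hpos
        · exact_mod_cast Int.lt_zpow_succ_log_self (b := 2) (by norm_num) ‖f x‖
      have hnJ : n ∈ J := by
        rw [hJ, Finset.mem_filter, Finset.mem_Icc]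
        refine ⟨⟨Int.log_mono_right hε h4, Int.log_mono_right hpos h5⟩, fun h => h3 n h hmem⟩
      rw [Finset.sum_eq_single_of_mem n hnJ, Set.indicator_of_mem hmem]
      intro m _ hmn
      apply Set.indicator_of_notMem
      exact fun h => Set.disjoint_left.1 (lev_disj f hmn) h hmem
  · intro k
    have h2 : (∑ n ∈ G k, g n : Lp ℂ 2 μ) =ᵐ[μ] ∑ n ∈ G k, (g n : X → ℂ) :=
      Lp.coeFn_finsetSum _ g
    rw [eLpNorm_congr_ae h2]
    refine (eLpNorm_sum_le (fun n _ => Lp.aestronglyMeasurable _) le_rfl).trans ?_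
    rw [Finset.mul_sum, ENNReal.ofReal_sum_of_nonneg (fun _ _ => by positivity)]
    refine Finset.sum_le_sum fun n hn => ?_
    obtain ⟨hn1, hn2⟩ := Finset.mem_filter.1 hn
    refine (lev_e1 f n k (hn2 ▸ hκ2 n hn1)).trans (ENNReal.ofReal_le_ofReal (le_of_eq ?_))
    have : (2:ℝ) ^ k = 2 ^ ((k:ℝ) * (1 - 1/p)) * 2 ^ ((k:ℝ)/p) := by
      rw [← Real.rpow_add (by norm_num), ← Real.rpow_intCast]
      congr 1; field_simp; ring
    rw [zpow_add₀ (by norm_num), zpow_add₀ (by norm_num), this]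
    ring
  · intro k
    refine (enorm_sum_le _ _).trans ?_
    rw [Finset.mul_sum, ENNReal.ofReal_sum_of_nonneg (fun _ _ => by positivity)]
    refine Finset.sum_le_sum fun n hn => ?_
    obtain ⟨hn1, hn2⟩ := Finset.mem_filter.1 hn
    refine (lev_e2 f n k (hn2 ▸ hκ2 n hn1)).trans (ENNReal.ofReal_le_ofReal ?_)
    have h1 : (2:ℝ) ^ (((k+1 : ℤ):ℝ)/2) ≤ 2 ^ ((k:ℝ) * (1/2 - 1/p)) * 2 ^ ((k:ℝ)/p) * 2 := by
      have : (2:ℝ) = 2 ^ (1:ℝ) := by simp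
      conv_rhs => rw [← Real.rpow_add (by norm_num)]
      conv_rhs => rhs; rw [this]
      rw [← Real.rpow_add (by norm_num)]
      apply Real.rpow_le_rpow_of_exponent_le (by norm_num)
      push_cast
      have : (k:ℝ) * (1/2 - 1/p) + k/p = k/2 := by field_simp; ring
      rw [this]; linarith
    rw [zpow_add₀ (by norm_num)]
    calc _ ≤ (2:ℝ)^n * 2^(1:ℤ) * (2 ^ ((k:ℝ) * (1/2 - 1/p)) * 2 ^ ((k:ℝ)/p) * 2) := by gcongr
      _ = _ := by ring
  · -- sum of squares
    have hex : ∀ k ∈ J.image κ, ∃ N ∈ G k, ∀ n ∈ G k, n ≤ N := by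
      intro k hk
      obtain ⟨n, hn, rfl⟩ := Finset.mem_image.1 hk
      exact (G (κ n)).exists_max_image id ⟨n, Finset.mem_filter.2 ⟨hn, rfl⟩⟩
    choose! N hN hN2 using hex
    set b : ℤ → ℝ := fun k => 2 ^ (N k) * 2 ^ ((k:ℝ)/p) with hb
    have hbp : ∀ k, (b k) ^ p = ((2:ℝ) ^ (N k)) ^ p * 2 ^ k := by
      intro k
      rw [hb, Real.mul_rpow (by positivity) (by positivity), ← Real.rpow_mul (by norm_num),
        div_mul_cancel₀ _ hp0.ne', Real.rpow_intCast]
    have hsum : ∑ k ∈ J.image κ, ENNReal.ofReal (b k ^ p) ≤ 1 := by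
      refine le_trans ?_ hfp
      have hdis : Set.PairwiseDisjoint (↑(J.image κ)) (fun k => lev f (N k)) := by
        intro k hk l hl hkl
        apply lev_disj
        intro h
        have h1 := (Finset.mem_filter.1 (hN k hk)).2
        have h2 := (Finset.mem_filter.1 (hN l hl)).2
        rw [h] at h1
        exact hkl (h1.symm.trans h2)
      calc _ ≤ ∑ k ∈ J.image κ, ∫⁻ x in lev f (N k), ‖f x‖ₑ ^ p ∂μ := by
            refine Finset.sum_le_sum fun k hk => ?_
            obtain ⟨h1, h2⟩ := Finset.mem_filter.1 (hN k hk)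
            calc _ = ENNReal.ofReal (2 ^ N k) ^ p * ENNReal.ofReal (2 ^ k) := by
                  rw [hbp, ENNReal.ofReal_mul (by positivity),
                    ENNReal.ofReal_rpow_of_pos (by positivity)]
              _ ≤ ENNReal.ofReal (2 ^ N k) ^ p * μ (lev f (N k)) := by
                  gcongr
                  have := hκ1 _ h1
                  rwa [h2] at this
              _ ≤ _ := by
                  rw [← setLIntegral_const]
                  refine setLIntegral_mono' (lev_meas f _) fun x hx => ?_
                  gcongr
                  rw [← ofReal_norm]
                  exact ENNReal.ofReal_le_ofReal hx.1
        _ = ∫⁻ x in ⋃ k ∈ J.image κ, lev f (N k), ‖f x‖ₑ ^ p ∂μ := by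
            rw [lintegral_biUnion_finset hdis (fun k _ => lev_meas f _)]
        _ ≤ _ := setLIntegral_le_lintegral _ _
    rw [← ENNReal.ofReal_sum_of_nonneg (fun _ _ => by positivity), ENNReal.ofReal_le_one] at hsum
    have hb1 : ∀ k ∈ J.image κ, b k ^ 2 ≤ b k ^ p := by
      intro k hk
      have h1 : b k ^ p ≤ 1 := (Finset.single_le_sum (f := fun k => b k ^ p)
        (fun _ _ => by positivity) hk).trans hsum
      have hbpos : 0 < b k := by positivity
      have h2 : b k ≤ 1 := by
        by_contra h
        exact absurd h1 (not_le.2 (Real.one_lt_rpow (not_le.1 h) hp0))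
      rw [← Real.rpow_natCast]
      exact Real.rpow_le_rpow_of_exponent_ge hbpos h2 (by exact_mod_cast hp2)
    calc _ ≤ ∑ k ∈ J.image κ, 4 * b k ^ p := by
          refine Finset.sum_le_sum fun k hk => ?_
          have h1 : ∑ n ∈ G k, (2:ℝ)^n * 2 ^ ((k:ℝ)/p) ≤ 2 * b k := by
            rw [← Finset.sum_mul, hb, ← mul_assoc]
            gcongr
            exact geo_int _ _ (hN2 k hk)
          calc _ ≤ (2 * b k)^2 := by gcongr
            _ = 4 * b k ^ 2 := by ring
            _ ≤ _ := by gcongr; exact hb1 k hk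
      _ ≤ _ := by rw [← Finset.mul_sum]; linarith
  · intro k hk
    have : G k = ∅ := by
      rw [Finset.filter_eq_empty_iff]
      rintro n hn rfl
      exact hk (Finset.mem_image_of_mem κ hn)
    simp [this]
end atoms

end

section

/-- geometric sum constant -/
def Cgeo (c : ℝ) : ℝ := 2 ^ c * ∑' m : ℤ, ((2:ℝ) ^ (-c)) ^ m.natAbs

lemma summable_natAbs {r : ℝ} (h0 : 0 ≤ r) (h1 : r < 1) : Summable (fun m : ℤ => r ^ m.natAbs) := by
  apply Summable.of_nat_of_neg <;> simpa using summable_geometric_of_lt_one h0 h1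

lemma Cgeo_nonneg (c : ℝ) : 0 ≤ Cgeo c := by
  unfold Cgeo
  have : 0 ≤ ∑' m : ℤ, ((2:ℝ) ^ (-c)) ^ m.natAbs := tsum_nonneg fun _ => by positivity
  positivity

lemma geo_sum {c : ℝ} (hc : 0 < c) (K : Finset ℤ) (x : ℝ) :
    ∑ k ∈ K, (2:ℝ) ^ (-(c * |k - x|)) ≤ Cgeo c := by
  have hr : (2:ℝ) ^ (-c) < 1 := Real.rpow_lt_one_of_one_lt_of_neg (by norm_num) (by linarith)
  set n := ⌊x⌋ with hn
  have h1 : ∀ k ∈ K, (2:ℝ) ^ (-(c * |k - x|)) ≤ 2 ^ c * ((2:ℝ) ^ (-c)) ^ (k - n).natAbs := by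
    intro k _
    rw [← Real.rpow_natCast, ← Real.rpow_mul (by norm_num), ← Real.rpow_add (by norm_num)]
    apply Real.rpow_le_rpow_of_exponent_le (by norm_num)
    have : (((k - n).natAbs : ℕ) : ℝ) = |(k:ℝ) - n| := by
      rw [Nat.cast_natAbs]; push_cast; rfl
    rw [this]
    have h2 : |(k:ℝ) - n| ≤ |k - x| + 1 := by
      have : |x - n| ≤ 1 := by
        rw [abs_of_nonneg (by linarith [Int.floor_le x])]
        linarith [Int.lt_floor_add_one x]
      calc _ = |(k - x) + (x - n)| := by ring_nf
        _ ≤ _ := (abs_add_le _ _).trans (by linarith)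
    nlinarith
  refine (Finset.sum_le_sum h1).trans ?_
  rw [← Finset.mul_sum, Cgeo]
  gcongr
  have hinj : Function.Injective (fun k : ℤ => k - n) := fun a b h => by simpa using h
  rw [← Finset.sum_image (f := fun m : ℤ => ((2:ℝ) ^ (-c)) ^ m.natAbs) (hinj.injOn)]
  exact (summable_natAbs (by positivity) hr).sum_le_tsum _ (fun _ _ => by positivity)

/-- dispersive family of isometries -/
structure Disp {X : Type*} [MeasurableSpace X] (μ : Measure X) (H : Type*)
    [NormedAddCommGroup H] [InnerProductSpace ℂ H] (σ A : ℝ) where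
  V : ℝ → Lp ℂ 2 μ →ₗᵢ[ℂ] H
  cont : ∀ f, Continuous fun t => V t f
  disp : ∀ s t f g, s ≠ t → ‖inner ℂ (V s f) (V t g)‖ₑ ≤
    ENNReal.ofReal (A * |t - s| ^ (-σ)) * eLpNorm f 1 μ * eLpNorm g 1 μ
  hA : 0 < A
  hσ : 0 < σ

section
variable {X : Type*} [MeasurableSpace X] {μ : Measure X} {H : Type*}
    [NormedAddCommGroup H] [InnerProductSpace ℂ H] {σ A : ℝ}

/-- time reversal -/
def Disp.rev (D : Disp μ H σ A) : Disp μ H σ A where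
  V t := D.V (-t)
  cont f := (D.cont f).comp continuous_neg
  disp s t f g h := by
    have := D.disp (-s) (-t) f g (by simpa using h)
    rwa [show -t - -s = -(t - s) by ring, abs_neg] at this
  hA := D.hA
  hσ := D.hσ

lemma norm_le_of_enorm {E : Type*} [SeminormedAddCommGroup E] {x : E} {c : ℝ} (hc : 0 ≤ c)
    (h : ‖x‖ₑ ≤ ENNReal.ofReal c) : ‖x‖ ≤ c := by
  rwa [← ofReal_norm, ENNReal.ofReal_le_ofReal_iff hc] at h

lemma min_pow_bound {δ ρ x m B : ℝ} (hδρ : δ + ρ = 1/2)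
    (hB : B = 2 ^ (-x/2)) :
    min ((2:ℝ) ^ (-(δ * m))) (B * 2 ^ (ρ * m)) ≤ B ^ (2 * δ) * 2 ^ (-(min δ ρ * |m - x|)) := by
  rw [hB, ← Real.rpow_mul (by norm_num), ← Real.rpow_add (by norm_num),
    ← Real.rpow_add (by norm_num)]
  rcases le_total x m with h | h
  · refine (min_le_left _ _).trans (Real.rpow_le_rpow_of_exponent_le (by norm_num) ?_)
    rw [abs_of_nonneg (by linarith)]
    have : min δ ρ * (m - x) ≤ δ * (m - x) := mul_le_mul_of_nonneg_right (min_le_left _ _) (by linarith)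
    nlinarith
  · refine (min_le_right _ _).trans (Real.rpow_le_rpow_of_exponent_le (by norm_num) ?_)
    rw [abs_of_nonpos (by linarith)]
    have : min δ ρ * (x - m) ≤ ρ * (x - m) := mul_le_mul_of_nonneg_right (min_le_right _ _) (by linarith)
    have hρ : ρ = 1/2 - δ := by linarith
    rw [hρ] at this ⊢
    nlinarith

lemma fixed_time (D : Disp μ H σ A) {p : ℝ} (hp : 1 < p) (hp2 : p < 2) {f g : Lp ℂ 2 μ}
    (hf : Nice f) (hg : Nice g) (hfp : ∫⁻ x, ‖f x‖ₑ ^ p ∂μ ≤ 1) (hgp : ∫⁻ x, ‖g x‖ₑ ^ p ∂μ ≤ 1)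
    {s t : ℝ} (hst : s ≠ t) :
    ‖inner ℂ (D.V s f) (D.V t g)‖ ≤ 128 * Cgeo (min (1/p - 1/2) (1 - 1/p)) *
      (A * |t - s| ^ (-σ)) ^ (2 * (1/p - 1/2)) := by
  obtain ⟨K, fk, a, ha, hfK, hf1, hf2, haS, -⟩ := atoms hp.le hp2.le f hf hfp
  obtain ⟨L, gl, b, hb, hgL, hg1, hg2, hbS, -⟩ := atoms hp.le hp2.le g hg hgp
  set δ := 1/p - 1/2 with hδ
  set ρ := 1 - 1/p with hρ
  have hp0 : 0 < p := by linarith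
  have hδ0 : 0 < δ := by
    have : 1/2 < 1/p := by gcongr
    linarith
  have hρ0 : 0 < ρ := by
    have : 1/p < 1 := by rw [div_lt_one hp0]; exact hp
    linarith
  set B := A * |t - s| ^ (-σ) with hB
  have hts : 0 < |t - s| := abs_pos.2 (sub_ne_zero.2 hst.symm)
  have hBpos : 0 < B := mul_pos D.hA (Real.rpow_pos_of_pos hts _)
  set x := -2 * Real.logb 2 B with hx
  have hBx : B = 2 ^ (-x/2) := by
    rw [hx, show -(-2 * Real.logb 2 B)/2 = Real.logb 2 B by ring,
      Real.rpow_logb (by norm_num) (by norm_num) hBpos]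
  set c := min δ ρ with hc
  have hc0 : 0 < c := lt_min hδ0 hρ0
  have key : ∀ k l : ℤ, ‖inner ℂ (D.V s (fk k)) (D.V t (gl l))‖ ≤
      16 * B ^ (2 * δ) * ((a k ^ 2 + b l ^ 2) * 2 ^ (-(c * |(k + l : ℝ) - x|))) := by
    intro k l
    have hak := ha k
    have hbl := hb l
    have e1 : ‖inner ℂ (D.V s (fk k)) (D.V t (gl l))‖ ≤
        16 * (a k * b l) * 2 ^ (-(δ * (k + l : ℝ))) := by
      have h1 := norm_le_of_enorm (by positivity) (hf2 k)
      have h2 := norm_le_of_enorm (by positivity) (hg2 l)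
      calc _ ≤ ‖D.V s (fk k)‖ * ‖D.V t (gl l)‖ := norm_inner_le_norm _ _
        _ = ‖fk k‖ * ‖gl l‖ := by rw [LinearIsometry.norm_map, LinearIsometry.norm_map]
        _ ≤ (4 * 2 ^ (k * (1/2 - 1/p)) * a k) * (4 * 2 ^ (l * (1/2 - 1/p)) * b l) := by gcongr
        _ = 16 * (a k * b l) * (2 ^ (k * (1/2 - 1/p)) * 2 ^ (l * (1/2 - 1/p))) := by ring
        _ = _ := by
          rw [← Real.rpow_add (by norm_num)]
          congr 2
          rw [hδ]; ring
    have e2 : ‖inner ℂ (D.V s (fk k)) (D.V t (gl l))‖ ≤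
        16 * (a k * b l) * (B * 2 ^ (ρ * (k + l : ℝ))) := by
      apply norm_le_of_enorm (by positivity)
      refine (D.disp s t (fk k) (gl l) hst).trans ?_
      calc _ ≤ ENNReal.ofReal B * ENNReal.ofReal (4 * 2 ^ (k * (1 - 1/p)) * a k) *
            ENNReal.ofReal (4 * 2 ^ (l * (1 - 1/p)) * b l) := by
            gcongr
            exacts [hf1 k, hg1 l]
        _ = _ := by
            rw [← ENNReal.ofReal_mul (by positivity), ← ENNReal.ofReal_mul (by positivity)]
            congr 1
            rw [show ρ * (k + l : ℝ) = k * (1 - 1/p) + l * (1 - 1/p) by rw [hρ]; ring,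
              Real.rpow_add (by norm_num)]
            ring
    have h3 := min_pow_bound (m := (k + l : ℝ)) (by rw [hδ, hρ]; ring : δ + ρ = 1/2) hBx
    have hab : 0 ≤ a k * b l := mul_nonneg hak hbl
    calc _ ≤ 16 * (a k * b l) * min (2 ^ (-(δ * (k + l : ℝ)))) (B * 2 ^ (ρ * (k + l : ℝ))) := by
          rcases min_choice ((2:ℝ) ^ (-(δ * (k + l : ℝ)))) (B * 2 ^ (ρ * (k + l : ℝ))) with h | h <;>
          rw [h] <;> assumption
      _ ≤ 16 * (a k ^ 2 + b l ^ 2) * (B ^ (2 * δ) * 2 ^ (-(c * |(k + l : ℝ) - x|))) := by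
          gcongr
          nlinarith [sq_nonneg (a k - b l)]
      _ = _ := by ring
  have hexp : inner ℂ (D.V s f) (D.V t g) =
      ∑ k ∈ K, ∑ l ∈ L, inner ℂ (D.V s (fk k)) (D.V t (gl l)) := by
    rw [hfK, hgL, map_sum, map_sum, sum_inner]
    simp only [inner_sum]
  rw [hexp]
  have hG := Cgeo_nonneg c
  calc _ ≤ ∑ k ∈ K, ∑ l ∈ L, ‖inner ℂ (D.V s (fk k)) (D.V t (gl l))‖ :=
        (norm_sum_le _ _).trans (Finset.sum_le_sum fun k _ => norm_sum_le _ _)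
    _ ≤ ∑ k ∈ K, ∑ l ∈ L,
        16 * B ^ (2 * δ) * ((a k ^ 2 + b l ^ 2) * 2 ^ (-(c * |(k + l : ℝ) - x|))) :=
        Finset.sum_le_sum fun k _ => Finset.sum_le_sum fun l _ => key k l
    _ = 16 * B ^ (2 * δ) * (∑ k ∈ K, a k ^ 2 * (∑ l ∈ L, (2:ℝ) ^ (-(c * |l - (x - k)|))) +
          ∑ l ∈ L, b l ^ 2 * (∑ k ∈ K, (2:ℝ) ^ (-(c * |k - (x - l)|)))) := by
        simp only [← Finset.mul_sum, add_mul, Finset.sum_add_distrib]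
        congr 2
        · refine Finset.sum_congr rfl fun k _ => ?_
          congr 1
          refine Finset.sum_congr rfl fun l _ => ?_
          ring_nf
        · rw [Finset.sum_comm]
          refine Finset.sum_congr rfl fun l _ => ?_
          rw [Finset.mul_sum]
          refine Finset.sum_congr rfl fun k _ => ?_
          ring_nf
    _ ≤ 16 * B ^ (2 * δ) * (∑ k ∈ K, a k ^ 2 * Cgeo c + ∑ l ∈ L, b l ^ 2 * Cgeo c) := by
        gcongr
        · exact geo_sum hc0 _ _
        · exact geo_sum hc0 _ _
    _ ≤ 16 * B ^ (2 * δ) * (4 * Cgeo c + 4 * Cgeo c) := by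
        rw [← Finset.sum_mul, ← Finset.sum_mul]
        gcongr
    _ = _ := by ring
end

end

section

lemma lint_abs (h : ℝ → ℝ≥0∞) : ∫⁻ τ, h |τ| = 2 * ∫⁻ τ in Set.Ioi 0, h τ := by
  rw [← lintegral_add_compl _ (measurableSet_Ioi (a := (0:ℝ))), two_mul]
  congr 1
  · refine setLIntegral_congr_fun measurableSet_Ioi fun x hx => ?_
    rw [abs_of_pos hx]
  · rw [Set.compl_Ioi, setLIntegral_congr (Iio_ae_eq_Iic (a := (0:ℝ))).symm]
    rw [← lintegral_indicator measurableSet_Iio, ← lintegral_indicator measurableSet_Ioi]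
    rw [← lintegral_neg_eq_self (μ := volume)]
    refine lintegral_congr fun x => ?_
    by_cases hx : 0 < x
    · rw [Set.indicator_of_mem (by simpa using hx), Set.indicator_of_mem (by simpa using hx), abs_neg,
        abs_of_pos hx]
    · rw [Set.indicator_of_notMem (by simpa using hx), Set.indicator_of_notMem (by simpa using hx)]

lemma hls_near {γ R : ℝ} (h1 : γ < 1) (hR : 0 < R) :
    ∫⁻ τ, (Set.Iic R).indicator (fun x => ENNReal.ofReal (x ^ (-γ))) |τ| =
      ENNReal.ofReal (2 * (R ^ (1 - γ) / (1 - γ))) := by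
  rw [lint_abs, ENNReal.ofReal_mul (by norm_num), ENNReal.ofReal_ofNat]
  congr 1
  rw [setLIntegral_indicator measurableSet_Iic, Set.inter_comm, Set.Ioi_inter_Iic,
    ← ofReal_integral_eq_lintegral_ofReal]
  · rw [← intervalIntegral.integral_of_le hR.le, integral_rpow (Or.inl (by linarith))]
    rw [show -γ + 1 = 1 - γ by ring, Real.zero_rpow (by linarith), sub_zero]
  · exact (intervalIntegral.intervalIntegrable_rpow' (by linarith)).1
  · filter_upwards [ae_restrict_mem measurableSet_Ioc] with x hx
    have : 0 < x := hx.1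
    positivity

lemma hls_far {R : ℝ} (hR : 0 < R) :
    ∫⁻ τ, (Set.Ioi R).indicator (fun x => ENNReal.ofReal (x ^ (-(2:ℝ)))) |τ| =
      ENNReal.ofReal (2 * R⁻¹) := by
  rw [lint_abs, ENNReal.ofReal_mul (by norm_num), ENNReal.ofReal_ofNat]
  congr 1
  rw [setLIntegral_indicator measurableSet_Ioi, Set.Ioi_inter_Ioi, sup_of_le_left hR.le]
  have := lintegral_Ioi_pow (σ := 2) (R := R) (B := 1) (by norm_num) hR (by norm_num)
  simp only [one_mul] at this
  rw [this]
  congr 1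
  norm_num
  rw [Real.rpow_neg_one]

lemma hls0 {p y : ℝ} (hp : 1 < p) (hp2 : p < 2) (hy : 0 < y) {g : ℝ → ℝ≥0∞} (hg : Measurable g)
    (hgp : ∫⁻ t, g t ^ p ≤ 1) :
    ∫⁻ τ, ENNReal.ofReal (|τ| ^ (-(2 - 2/p))) * min (g τ) (ENNReal.ofReal y) ≤
      ENNReal.ofReal (2 / (2/p - 1) + 2) * ENNReal.ofReal y ^ (p - 1) := by
  have hp0 : 0 < p := by linarith
  set γ := 2 - 2/p with hγ
  have hγ1 : γ < 1 := by
    have : 1 < 2/p := by rw [lt_div_iff₀ hp0]; linarith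
    linarith
  set R := y ^ (-p) with hRd
  have hR : 0 < R := by positivity
  set k1 : ℝ → ℝ≥0∞ := fun τ => (Set.Iic R).indicator (fun x => ENNReal.ofReal (x ^ (-γ))) |τ| with hk1
  set k2 : ℝ → ℝ≥0∞ := fun τ => (Set.Ioi R).indicator (fun x => ENNReal.ofReal (x ^ (-γ))) |τ| with hk2
  have hk1m : Measurable k1 := by
    apply Measurable.comp (g := (Set.Iic R).indicator (fun x => ENNReal.ofReal (x ^ (-γ)))) _ measurable_id.abs
    exact Measurable.indicator (by fun_prop) measurableSet_Iic
  have hk2m : Measurable k2 := by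
    apply Measurable.comp (g := (Set.Ioi R).indicator (fun x => ENNReal.ofReal (x ^ (-γ)))) _ measurable_id.abs
    exact Measurable.indicator (by fun_prop) measurableSet_Ioi
  have hsplit : ∀ τ, ENNReal.ofReal (|τ| ^ (-γ)) = k1 τ + k2 τ := by
    intro τ
    simp only [hk1, hk2]
    by_cases h : |τ| ≤ R
    · rw [Set.indicator_of_mem (by exact h), Set.indicator_of_notMem (by simpa using h), add_zero]
    · rw [Set.indicator_of_notMem (by exact h), Set.indicator_of_mem (by simpa using h), zero_add]
  set q := p / (p - 1) with hq
  have hpq : p.HolderConjugate q := Real.HolderConjugate.conjExponent hp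
  have hq0 : 0 < q := hpq.symm.pos
  have hqi : 1 / q = 1 - 1/p := by rw [hq]; field_simp
  have hgq : γ * q = 2 := by
    have : p - 1 ≠ 0 := by linarith
    rw [hγ, hq]; field_simp; try ring
  calc _ = ∫⁻ τ, (k1 τ * min (g τ) (ENNReal.ofReal y) + k2 τ * min (g τ) (ENNReal.ofReal y)) := by
        refine lintegral_congr fun τ => ?_
        rw [hsplit, add_mul]
    _ ≤ ∫⁻ τ, (k1 τ * ENNReal.ofReal y + k2 τ * g τ) := by
        refine lintegral_mono fun τ => ?_
        gcongr
        · exact min_le_right _ _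
        · exact min_le_left _ _
    _ = (∫⁻ τ, k1 τ) * ENNReal.ofReal y + ∫⁻ τ, k2 τ * g τ := by
        rw [lintegral_add_left (by fun_prop), lintegral_mul_const _ hk1m]
    _ ≤ ENNReal.ofReal (2 / (2/p - 1)) * ENNReal.ofReal y ^ (p - 1) +
        ENNReal.ofReal 2 * ENNReal.ofReal y ^ (p - 1) := by
        refine add_le_add ?_ ?_
        · rw [hls_near hγ1 hR, ← ENNReal.ofReal_mul, ENNReal.ofReal_rpow_of_pos hy,
            ← ENNReal.ofReal_mul]
          · apply le_of_eq
            congr 1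
            rw [hRd, ← Real.rpow_mul hy.le, show 1 - γ = 2/p - 1 by rw [hγ]; ring]
            rw [show p - 1 = -p * (2/p - 1) + 1 by field_simp; ring, Real.rpow_add hy, Real.rpow_one]
            ring
          · have : 0 < 2/p - 1 := by linarith
            positivity
          · have : 0 < 1 - γ := by linarith
            positivity
        · refine (ENNReal.lintegral_mul_le_Lp_mul_Lq volume hpq.symm hk2m.aemeasurable hg.aemeasurable).trans ?_
          have : ∀ τ, k2 τ ^ q = (Set.Ioi R).indicator (fun x => ENNReal.ofReal (x ^ (-(2:ℝ)))) |τ| := by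
            intro τ
            simp only [hk2]
            by_cases h : |τ| ≤ R
            · rw [Set.indicator_of_notMem (by simpa using h), Set.indicator_of_notMem (by simpa using h),
                ENNReal.zero_rpow_of_pos hq0]
            · have h' : 0 < |τ| := hR.trans (not_le.1 h)
              rw [Set.indicator_of_mem (by simpa using h), Set.indicator_of_mem (by simpa using h),
                ENNReal.ofReal_rpow_of_pos (by positivity), ← Real.rpow_mul h'.le]
              congr 2
              rw [← hgq]; ring
          simp only [this]
          rw [hls_far hR]
          calc _ ≤ ENNReal.ofReal (2 * R⁻¹) ^ (1/q) * 1 := by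
                gcongr
                exact ENNReal.rpow_le_one hgp (by positivity)
            _ ≤ _ := by
                rw [mul_one, ENNReal.ofReal_rpow_of_pos (by positivity), ENNReal.ofReal_rpow_of_pos hy,
                  ← ENNReal.ofReal_mul (by norm_num)]
                apply ENNReal.ofReal_le_ofReal
                rw [Real.mul_rpow (by norm_num) (by positivity), hRd, ← Real.rpow_neg hy.le,
                  ← Real.rpow_mul hy.le, neg_neg, hqi]
                rw [show p * (1 - 1/p) = p - 1 by field_simp]
                gcongr
                calc (2:ℝ) ^ (1 - 1/p) ≤ 2 ^ (1:ℝ) := by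
                      apply Real.rpow_le_rpow_of_exponent_le (by norm_num)
                      have : 0 < 1/p := by positivity
                      linarith
                  _ = 2 := by simp
    _ = _ := by
        rw [← add_mul, ← ENNReal.ofReal_add _ (by norm_num)]
        have : 0 < 2/p - 1 := by linarith
        positivity

lemma hls_half {p : ℝ} (hp : 1 < p) (hp2 : p < 2) {f g : ℝ → ℝ≥0∞} (hf : Measurable f)
    (hg : Measurable g) (hfp : ∫⁻ t, f t ^ p ≤ 1) (hgp : ∫⁻ t, g t ^ p ≤ 1) :
    ∫⁻ s, ∫⁻ t, ENNReal.ofReal (|t - s| ^ (-(2 - 2/p))) * (f s * min (g t) (f s)) ≤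
      ENNReal.ofReal (2 / (2/p - 1) + 2) := by
  have hp0 : 0 < p := by linarith
  have hfin : ∀ᵐ s, f s < ∞ := by
    have h1 := ae_lt_top (hf.pow_const p) (lt_of_le_of_lt hfp ENNReal.one_lt_top).ne
    filter_upwards [h1] with s hs
    by_contra h
    rw [not_lt, top_le_iff] at h
    simp [h, hp0] at hs
  calc _ ≤ ∫⁻ s, ENNReal.ofReal (2 / (2/p - 1) + 2) * f s ^ p := by
        refine lintegral_mono_ae ?_
        filter_upwards [hfin] with s hs
        rcases eq_or_ne (f s) 0 with h0 | h0
        · simp [h0]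
        set y := (f s).toReal with hyd
        have hy : 0 < y := ENNReal.toReal_pos h0 hs.ne
        have hfy : f s = ENNReal.ofReal y := (ENNReal.ofReal_toReal hs.ne).symm
        have hgs : Measurable fun τ => g (τ + s) := by fun_prop
        have h1 := hls0 hp hp2 hy hgs
          (by rw [lintegral_add_right_eq_self (fun t => g t ^ p) s]; exact hgp)
        rw [← lintegral_add_right_eq_self _ s]
        calc _ = f s * ∫⁻ τ, ENNReal.ofReal (|τ| ^ (-(2 - 2/p))) * min (g (τ + s)) (ENNReal.ofReal y) := by
              rw [← lintegral_const_mul _ (by fun_prop)]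
              refine lintegral_congr fun τ => ?_
              rw [← hfy, add_sub_cancel_right]
              ring
          _ ≤ f s * (ENNReal.ofReal (2 / (2/p - 1) + 2) * ENNReal.ofReal y ^ (p - 1)) := by gcongr
          _ = _ := by
              rw [← hfy, ← mul_assoc, mul_comm (f s), mul_assoc]
              congr 1
              conv_lhs => rw [← ENNReal.rpow_one (f s), ← ENNReal.rpow_mul, ← ENNReal.rpow_add _ _ h0 hs.ne]
              congr 1; ring
    _ = ENNReal.ofReal (2 / (2/p - 1) + 2) * ∫⁻ s, f s ^ p := lintegral_const_mul _ (by fun_prop)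
    _ ≤ ENNReal.ofReal (2 / (2/p - 1) + 2) * 1 := by gcongr
    _ = _ := mul_one _

lemma hls {p : ℝ} (hp : 1 < p) (hp2 : p < 2) {f g : ℝ → ℝ≥0∞} (hf : Measurable f)
    (hg : Measurable g) (hfp : ∫⁻ t, f t ^ p ≤ 1) (hgp : ∫⁻ t, g t ^ p ≤ 1) :
    ∫⁻ z : ℝ × ℝ, ENNReal.ofReal (|z.2 - z.1| ^ (-(2 - 2/p))) * (f z.1 * g z.2) ≤
      2 * ENNReal.ofReal (2 / (2/p - 1) + 2) := by
  have hm1 : Measurable fun z : ℝ × ℝ => ENNReal.ofReal (|z.2 - z.1| ^ (-(2 - 2/p))) := by fun_prop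
  calc _ ≤ ∫⁻ z : ℝ × ℝ, (ENNReal.ofReal (|z.2 - z.1| ^ (-(2 - 2/p))) * (f z.1 * min (g z.2) (f z.1)) +
        ENNReal.ofReal (|z.2 - z.1| ^ (-(2 - 2/p))) * (g z.2 * min (f z.1) (g z.2))) := by
        refine lintegral_mono fun z => ?_
        simp only
        rw [← mul_add]
        gcongr
        rcases le_total (f z.1) (g z.2) with h | h
        · rw [min_eq_left h, mul_comm]; exact le_add_self
        · rw [min_eq_left h]; exact le_self_add
    _ = (∫⁻ s, ∫⁻ t, ENNReal.ofReal (|t - s| ^ (-(2 - 2/p))) * (f s * min (g t) (f s))) +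
        ∫⁻ t, ∫⁻ s, ENNReal.ofReal (|s - t| ^ (-(2 - 2/p))) * (g t * min (f s) (g t)) := by
        rw [lintegral_add_left (by fun_prop)]
        congr 1
        · rw [Measure.volume_eq_prod, lintegral_prod _ (by fun_prop)]
        · rw [Measure.volume_eq_prod, lintegral_prod_symm _ (by fun_prop)]
          simp only [abs_sub_comm]
    _ ≤ _ := by
        rw [two_mul]
        exact add_le_add (hls_half hp hp2 hf hg hfp hgp) (hls_half hp hp2 hg hf hgp hfp)

end

section

section
variable {H : Type*} [NormedAddCommGroup H] [InnerProductSpace ℂ H] [CompleteSpace H]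

lemma Bil_sum {ι κ : Type*} (K : Finset ι) (L : Finset κ) (f : ι → ℝ → H) (g : κ → ℝ → H)
    (hf : ∀ k, Integrable (f k)) (hg : ∀ l, Integrable (g l)) :
    Bil (fun s => ∑ k ∈ K, f k s) (fun s => ∑ l ∈ L, g l s) = ∑ k ∈ K, ∑ l ∈ L, Bil (f k) (g l) := by
  unfold Bil
  have hI : ∀ k l, IntegrableOn (fun z : ℝ × ℝ => inner ℂ (f k z.1) (g l z.2)) {z : ℝ × ℝ | z.1 < z.2} :=
    fun k l => (integrable_inner_prod (hf k) (hg l)).integrableOn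
  simp only [sum_inner, inner_sum]
  rw [integral_finsetSum _ (fun l _ => integrable_finsetSum _ (fun k _ => hI k l)), Finset.sum_comm]
  refine Finset.sum_congr rfl fun l _ => ?_
  rw [integral_finsetSum _ (fun k _ => hI k l)]

lemma Bil_smul (a b : ℂ) (f g : ℝ → H) :
    Bil (fun s => a • f s) (fun s => b • g s) = (starRingEnd ℂ a * b) * Bil f g := by
  unfold Bil
  rw [← integral_const_mul]
  congr 1
  ext z
  rw [inner_smul_left, inner_smul_right]; ring

lemma meas_sel {Y : Type*} [TopologicalSpace Y] {Z : Type*} [MeasurableSpace Z]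
    {i : Z → ℕ} (hi : Measurable i) (φ : ℕ → Z → Y)
    [TopologicalSpace.PseudoMetrizableSpace Y] (hφ : ∀ n, StronglyMeasurable (φ n)) :
    StronglyMeasurable (fun s => φ (i s) s) := by
  letI := TopologicalSpace.pseudoMetrizableSpacePseudoMetric Y
  borelize Y
  rw [stronglyMeasurable_iff_measurable_separable]
  constructor
  · exact (measurable_from_prod_countable_right (f := fun z : ℕ × Z => φ z.1 z.2)
      (fun n => (hφ n).measurable)).comp (hi.prodMk measurable_id)
  · refine (TopologicalSpace.IsSeparable.iUnion (fun n => (hφ n).isSeparable_range)).mono ?_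
    rintro _ ⟨s, rfl⟩
    exact Set.mem_iUnion.2 ⟨i s, s, rfl⟩

variable {X : Type*} [MeasurableSpace X] {μ : Measure X} {σ A : ℝ}

/-- image of a step function under the family -/
def vstep (D : Disp μ H σ A) (c : ℝ → ℂ) (i : ℝ → ℕ) (φ : ℕ → Lp ℂ 2 μ) : ℝ → H :=
  fun s => c s • D.V s (φ (i s))

lemma vstep_integrable (D : Disp μ H σ A) {c : ℝ → ℂ} (hc : Integrable c) {i : ℝ → ℕ} (hi : Measurable i)
    {N : ℕ} (hN : ∀ s, i s < N) (φ : ℕ → Lp ℂ 2 μ) : Integrable (vstep D c i φ) := by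
  have hm : StronglyMeasurable (fun s => D.V s (φ (i s))) :=
    meas_sel hi (fun n s => D.V s (φ n)) (fun n => (D.cont (φ n)).stronglyMeasurable)
  refine (hc.mul_const ((∑ n ∈ Finset.range N, ‖φ n‖ : ℝ) : ℂ)).mono
    (hc.aestronglyMeasurable.smul hm.aestronglyMeasurable) ?_
  refine Filter.Eventually.of_forall fun s => ?_
  rw [vstep, norm_smul, norm_mul, LinearIsometry.norm_map]
  gcongr
  rw [Complex.norm_real, Real.norm_of_nonneg (by positivity)]
  exact Finset.single_le_sum (f := fun n => ‖φ n‖) (fun _ _ => norm_nonneg _) (Finset.mem_range.2 (hN s))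

lemma vstep_neg (D : Disp μ H σ A) (c : ℝ → ℂ) (i : ℝ → ℕ) (φ : ℕ → Lp ℂ 2 μ) :
    (fun s => vstep D c i φ (-s)) = vstep D.rev (fun s => c (-s)) (fun s => i (-s)) φ := rfl

/-- constant of the pair bound -/
def Cpair (σ A : ℝ) : ℝ := (A / (σ - 1) + 1 + 2 * (2 + 2 * (A / (σ - 1))))
/-- decay rate -/
def cpair (σ : ℝ) : ℝ := min (1 / (8 * σ)) ((σ - 1) / (4 * σ))

lemma vstep_disp (D : Disp μ H σ A) {c c' : ℝ → ℂ} {i i' : ℝ → ℕ} {φ φ' : ℕ → Lp ℂ 2 μ}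
    {a a' : ℕ → ℝ} (ha : ∀ n, 0 ≤ a n) (ha' : ∀ n, 0 ≤ a' n) {X Y : ℝ} (hX : 0 ≤ X) (hY : 0 ≤ Y)
    (h1 : ∀ n, eLpNorm (φ n) 1 μ ≤ ENNReal.ofReal (4 * X * a n))
    (h2 : ∀ n, eLpNorm (φ' n) 1 μ ≤ ENNReal.ofReal (4 * Y * a' n)) (s t : ℝ) (hst : s ≠ t) :
    ‖inner ℂ (vstep D c i φ s) (vstep D c' i' φ' t)‖ₑ ≤ ENNReal.ofReal (A * |t - s| ^ (-σ)) *
      (ENNReal.ofReal X * (‖c s‖ₑ * ENNReal.ofReal (4 * a (i s)))) *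
      (ENNReal.ofReal Y * (‖c' t‖ₑ * ENNReal.ofReal (4 * a' (i' t)))) := by
  rw [vstep, vstep, inner_smul_left, inner_smul_right, enorm_mul, enorm_mul, RCLike.enorm_conj]
  calc _ ≤ ‖c s‖ₑ * (‖c' t‖ₑ * (ENNReal.ofReal (A * |t - s| ^ (-σ)) *
        ENNReal.ofReal (4 * X * a (i s)) * ENNReal.ofReal (4 * Y * a' (i' t)))) := by
        gcongr
        refine (D.disp s t _ _ hst).trans ?_
        gcongr
        exacts [h1 _, h2 _]
    _ = _ := by
        rw [show 4 * X * a (i s) = X * (4 * a (i s)) by ring,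
          show 4 * Y * a' (i' t) = Y * (4 * a' (i' t)) by ring, ENNReal.ofReal_mul hX, ENNReal.ofReal_mul hY]
        ring

lemma vstep_pair0 (D : Disp μ H σ A) (hσ : 1 < σ) {c c' : ℝ → ℂ} (hc : Integrable c)
    (hc' : Integrable c') (hcm : Measurable c) (hcm' : Measurable c')
    {i i' : ℝ → ℕ} (hi : Measurable i) (hi' : Measurable i')
    {N N' : ℕ} (hN : ∀ s, i s < N) (hN' : ∀ s, i' s < N') {φ φ' : ℕ → Lp ℂ 2 μ}
    {a a' : ℕ → ℝ} (ha : ∀ n, 0 ≤ a n) (ha' : ∀ n, 0 ≤ a' n) {x y : ℝ} (hxy : y ≤ x)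
    (h1 : ∀ n, eLpNorm (φ n) 1 μ ≤ ENNReal.ofReal (4 * 2 ^ (x * ((σ - 1) / (2 * σ))) * a n))
    (h2 : ∀ n, ‖φ n‖ₑ ≤ ENNReal.ofReal (4 * 2 ^ (-x / (2 * σ)) * a n))
    (h1' : ∀ n, eLpNorm (φ' n) 1 μ ≤ ENNReal.ofReal (4 * 2 ^ (y * ((σ - 1) / (2 * σ))) * a' n))
    (h2' : ∀ n, ‖φ' n‖ₑ ≤ ENNReal.ofReal (4 * 2 ^ (-y / (2 * σ)) * a' n)) :
    ‖Bil (vstep D c i φ) (vstep D c' i' φ')‖ₑ ≤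
      ENNReal.ofReal (Cpair σ A * 2 ^ (- (cpair σ * (x - y)))) *
      ((∫⁻ s, (‖c s‖ₑ * ENNReal.ofReal (4 * a (i s))) ^ 2) +
        ∫⁻ s, (‖c' s‖ₑ * ENNReal.ofReal (4 * a' (i' s))) ^ 2) := by
  refine pair_bound hσ D.hA.le (vstep_integrable D hc hi hN φ) (vstep_integrable D hc' hi' hN' φ')
    ?_ ?_ hxy ?_ ?_ ?_ ?_
  · exact hcm.enorm.mul ((measurable_from_top (f := fun n => ENNReal.ofReal (4 * a n))).comp hi)
  · exact hcm'.enorm.mul ((measurable_from_top (f := fun n => ENNReal.ofReal (4 * a' n))).comp hi')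
  · intro s
    rw [vstep, enorm_smul, LinearIsometry.enorm_map]
    calc _ ≤ ‖c s‖ₑ * ENNReal.ofReal (4 * 2 ^ (-x / (2 * σ)) * a (i s)) := by gcongr; exact h2 _
      _ = _ := by
        rw [show 4 * 2 ^ (-x / (2 * σ)) * a (i s) = 2 ^ (-x / (2 * σ)) * (4 * a (i s)) by ring,
          ENNReal.ofReal_mul (by positivity)]; ring
  · intro s
    rw [vstep, enorm_smul, LinearIsometry.enorm_map]
    calc _ ≤ ‖c' s‖ₑ * ENNReal.ofReal (4 * 2 ^ (-y / (2 * σ)) * a' (i' s)) := by gcongr; exact h2' _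
      _ = _ := by
        rw [show 4 * 2 ^ (-y / (2 * σ)) * a' (i' s) = 2 ^ (-y / (2 * σ)) * (4 * a' (i' s)) by ring,
          ENNReal.ofReal_mul (by positivity)]; ring
  · exact fun s t hst => vstep_disp D ha ha' (by positivity) (by positivity) h1 h1' s t hst
  · exact fun s t hst => vstep_disp D ha' ha' (by positivity) (by positivity) h1' h1' s t hst

lemma vstep_pair (D : Disp μ H σ A) (hσ : 1 < σ) {c c' : ℝ → ℂ} (hc : Integrable c)
    (hc' : Integrable c') (hcm : Measurable c) (hcm' : Measurable c')
    {i i' : ℝ → ℕ} (hi : Measurable i) (hi' : Measurable i')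
    {N N' : ℕ} (hN : ∀ s, i s < N) (hN' : ∀ s, i' s < N') {φ φ' : ℕ → Lp ℂ 2 μ}
    {a a' : ℕ → ℝ} (ha : ∀ n, 0 ≤ a n) (ha' : ∀ n, 0 ≤ a' n) {x y : ℝ}
    (h1 : ∀ n, eLpNorm (φ n) 1 μ ≤ ENNReal.ofReal (4 * 2 ^ (x * ((σ - 1) / (2 * σ))) * a n))
    (h2 : ∀ n, ‖φ n‖ₑ ≤ ENNReal.ofReal (4 * 2 ^ (-x / (2 * σ)) * a n))
    (h1' : ∀ n, eLpNorm (φ' n) 1 μ ≤ ENNReal.ofReal (4 * 2 ^ (y * ((σ - 1) / (2 * σ))) * a' n))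
    (h2' : ∀ n, ‖φ' n‖ₑ ≤ ENNReal.ofReal (4 * 2 ^ (-y / (2 * σ)) * a' n)) :
    ‖Bil (vstep D c i φ) (vstep D c' i' φ')‖ₑ ≤
      ENNReal.ofReal (Cpair σ A * 2 ^ (- (cpair σ * |x - y|))) *
      ((∫⁻ s, (‖c s‖ₑ * ENNReal.ofReal (4 * a (i s))) ^ 2) +
        ∫⁻ s, (‖c' s‖ₑ * ENNReal.ofReal (4 * a' (i' s))) ^ 2) := by
  rcases le_total y x with h | h
  · rw [abs_of_nonneg (by linarith)]
    exact vstep_pair0 D hσ hc hc' hcm hcm' hi hi' hN hN' ha ha' h h1 h2 h1' h2'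
  · rw [Bil_reverse, RCLike.enorm_conj, vstep_neg, vstep_neg]
    have := vstep_pair0 D.rev hσ hc'.comp_neg hc.comp_neg (hcm'.comp measurable_neg)
      (hcm.comp measurable_neg) (hi'.comp measurable_neg) (hi.comp measurable_neg)
      (fun s => hN' (-s)) (fun s => hN (-s)) ha' ha h h1' h2' h1 h2
    refine this.trans (le_of_eq ?_)
    rw [abs_of_nonpos (by linarith), neg_sub]
    congr 1
    rw [add_comm]
    congr 1
    · exact lintegral_neg_eq_self (fun s => (‖c s‖ₑ * ENNReal.ofReal (4 * a (i s))) ^ 2)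
    · exact lintegral_neg_eq_self (fun s => (‖c' s‖ₑ * ENNReal.ofReal (4 * a' (i' s))) ^ 2)
end

end

section

lemma eLpNorm_ne_top_of_bdd {Y E : Type*} [MeasurableSpace Y] {ν : Measure Y} [NormedAddCommGroup E]
    {f : Y → E} (hf : Integrable f ν)
    {M : ℝ} (hM : ∀ s, ‖f s‖ ≤ M) {α : ℝ≥0∞} (hα : 1 ≤ α) : eLpNorm f α ν ≠ ∞ := by
  rcases eq_or_ne α ∞ with rfl | hα'
  · exact (memLp_top_of_bound hf.aestronglyMeasurable M (Filter.Eventually.of_forall hM)).2.ne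
  have h1 : 1 ≤ α.toReal := by simpa using (ENNReal.toReal_le_toReal (by simp) hα').2 hα
  rw [eLpNorm_eq_lintegral_rpow_enorm_toReal (by positivity) hα']
  refine (ENNReal.rpow_lt_top_of_nonneg (by positivity) (lt_of_le_of_lt (b := ∫⁻ y, ENNReal.ofReal M ^ (α.toReal - 1) * ‖f y‖ₑ ∂ν) ?_ ?_).ne).ne
  · refine lintegral_mono fun y => ?_
    calc _ = ‖f y‖ₑ ^ ((α.toReal - 1) + 1) := by ring_nf
      _ = ‖f y‖ₑ ^ (α.toReal - 1) * ‖f y‖ₑ := by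
          rw [ENNReal.rpow_add_of_nonneg _ _ (by linarith) (by norm_num), ENNReal.rpow_one]
      _ ≤ _ := by
          gcongr
          · rw [← ofReal_norm]; exact ENNReal.ofReal_le_ofReal (hM y)
  · rw [lintegral_const_mul' _ _ (ENNReal.rpow_ne_top_of_nonneg (by linarith) (by simp))]
    exact ENNReal.mul_lt_top (ENNReal.rpow_lt_top_of_nonneg (by linarith) (by simp)) hf.2

/-- Step functions in time with values in nice functions in the unit ball of `L^p`. -/
structure Step {X : Type*} [MeasurableSpace X] (μ : Measure X) (p : ℝ≥0∞) where
  c : ℝ → ℂ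
  cm : Measurable c
  cint : Integrable c
  M : ℝ
  cbdd : ∀ s, ‖c s‖ ≤ M
  i : ℝ → ℕ
  im : Measurable i
  N : ℕ
  iN : ∀ s, i s < N
  ψ : ℕ → Lp ℂ 2 μ
  nice : ∀ n, Nice (ψ n)
  unit : ∀ n, eLpNorm (ψ n) p μ ≤ 1

section
variable {H : Type*} [NormedAddCommGroup H] [InnerProductSpace ℂ H] [CompleteSpace H]
variable {X : Type*} [MeasurableSpace X] {μ : Measure X} {σ A : ℝ}

/-- image in `H` -/
def Step.V {p : ℝ≥0∞} (F : Step μ p) (D : Disp μ H σ A) : ℝ → H := vstep D F.c F.i F.ψ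

lemma Step.int {p : ℝ≥0∞} (F : Step μ p) (D : Disp μ H σ A) : Integrable (F.V D) :=
  vstep_integrable D F.cint F.im F.iN F.ψ

/-- constant multiple -/
def Step.smul {p : ℝ≥0∞} (F : Step μ p) (a : ℂ) : Step μ p :=
  { F with
    c := fun s => a * F.c s
    cm := F.cm.const_mul a
    cint := F.cint.const_mul a
    M := ‖a‖ * F.M
    cbdd := fun s => by rw [norm_mul]; gcongr; exact F.cbdd s }

lemma Step.smul_V {p : ℝ≥0∞} (F : Step μ p) (a : ℂ) (D : Disp μ H σ A) :
    (F.smul a).V D = fun s => a • F.V D s := by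
  ext s; simp [Step.V, vstep, Step.smul, mul_smul]

lemma Step.smul_norm {p : ℝ≥0∞} (F : Step μ p) (a : ℂ) (α : ℝ≥0∞) :
    eLpNorm (F.smul a).c α volume = ‖a‖ₑ * eLpNorm F.c α volume :=
  eLpNorm_const_smul a F.c α volume

/-- time reversal -/
def Step.rev {p : ℝ≥0∞} (F : Step μ p) : Step μ p :=
  { F with
    c := fun s => F.c (-s)
    cm := F.cm.comp measurable_neg
    cint := F.cint.comp_neg
    cbdd := fun s => F.cbdd (-s)
    i := fun s => F.i (-s)
    im := F.im.comp measurable_neg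
    iN := fun s => F.iN (-s) }

lemma Step.rev_norm {p : ℝ≥0∞} (F : Step μ p) (α : ℝ≥0∞) :
    eLpNorm F.rev.c α volume = eLpNorm F.c α volume :=
  eLpNorm_comp_measurePreserving F.cm.aestronglyMeasurable (Measure.measurePreserving_neg volume)

/-- restriction to a measurable set of times -/
def Step.cut {p : ℝ≥0∞} (F : Step μ p) (S : Set ℝ) (hS : MeasurableSet S) : Step μ p :=
  { F with
    c := S.indicator F.c
    cm := F.cm.indicator hS
    cint := F.cint.indicator hS
    cbdd := fun s => (norm_indicator_le_norm_self _ _).trans (F.cbdd s) }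

lemma Step.cut_V {p : ℝ≥0∞} (F : Step μ p) (S : Set ℝ) (hS : MeasurableSet S) (D : Disp μ H σ A) :
    (F.cut S hS).V D = S.indicator (F.V D) := by
  ext s
  by_cases h : s ∈ S <;> simp [Step.V, vstep, Step.cut, h]

lemma Step.cut_norm {p : ℝ≥0∞} (F : Step μ p) (S : Set ℝ) (hS : MeasurableSet S) (α : ℝ≥0∞) :
    eLpNorm (F.cut S hS).c α volume ≤ eLpNorm F.c α volume :=
  eLpNorm_indicator_le _

lemma Step.finite {p : ℝ≥0∞} (F : Step μ p) (α : ℝ≥0∞) (hα : 1 ≤ α) : eLpNorm F.c α volume ≠ ∞ := by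
  exact eLpNorm_ne_top_of_bdd F.cint F.cbdd hα

/-- bilinear bound -/
def BilB (D : Disp μ H σ A) (α β a b : ℝ≥0∞) (C : ℝ) : Prop :=
  ∀ (F : Step μ β) (G : Step μ b), ‖Bil (F.V D) (G.V D)‖ₑ ≤
    ENNReal.ofReal C * (eLpNorm F.c α volume * eLpNorm G.c a volume)

lemma Step.V_zero {p : ℝ≥0∞} (F : Step μ p) (D : Disp μ H σ A) {α : ℝ≥0∞} (hα : 1 ≤ α)
    (h : eLpNorm F.c α volume = 0) : F.V D =ᵐ[volume] 0 := by
  rw [eLpNorm_eq_zero_iff F.cm.aestronglyMeasurable (by positivity)] at h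
  filter_upwards [h] with s hs
  simp only [Pi.zero_apply] at hs
  simp [Step.V, vstep, hs]

lemma Bil_zero_left {f g : ℝ → H} (hf : f =ᵐ[volume] 0) : Bil f g = 0 := by
  unfold Bil
  apply integral_eq_zero_of_ae
  apply ae_restrict_of_ae
  have : ∀ᵐ z : ℝ × ℝ, f z.1 = 0 := Measure.quasiMeasurePreserving_fst.ae hf
  filter_upwards [this] with z hz
  simp [hz]

lemma Bil_zero_right {f g : ℝ → H} (hf : g =ᵐ[volume] 0) : Bil f g = 0 := by
  unfold Bil
  apply integral_eq_zero_of_ae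
  apply ae_restrict_of_ae
  have : ∀ᵐ z : ℝ × ℝ, g z.2 = 0 := Measure.quasiMeasurePreserving_snd.ae hf
  filter_upwards [this] with z hz
  simp [hz]

lemma BilB_of_unit (D : Disp μ H σ A) {α β a b : ℝ≥0∞} (hα : 1 ≤ α) (ha : 1 ≤ a) {C : ℝ}
    (h : ∀ (F : Step μ β) (G : Step μ b), eLpNorm F.c α volume ≤ 1 → eLpNorm G.c a volume ≤ 1 →
      ‖Bil (F.V D) (G.V D)‖ₑ ≤ ENNReal.ofReal C) : BilB D α β a b C := by
  intro F G
  rcases eq_or_ne (eLpNorm F.c α volume) 0 with h0 | h0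
  · rw [Bil_zero_left (F.V_zero D hα h0)]; simp
  rcases eq_or_ne (eLpNorm G.c a volume) 0 with h0' | h0'
  · rw [Bil_zero_right (G.V_zero D ha h0')]; simp
  set x := (eLpNorm F.c α volume).toReal with hx
  set y := (eLpNorm G.c a volume).toReal with hy
  have hx0 : 0 < x := ENNReal.toReal_pos h0 (F.finite α hα)
  have hy0 : 0 < y := ENNReal.toReal_pos h0' (G.finite a ha)
  have ex : eLpNorm F.c α volume = ENNReal.ofReal x := (ENNReal.ofReal_toReal (F.finite α hα)).symm
  have ey : eLpNorm G.c a volume = ENNReal.ofReal y := (ENNReal.ofReal_toReal (G.finite a ha)).symm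
  have e1 : ∀ z : ℝ, 0 < z → ‖((z⁻¹ : ℝ) : ℂ)‖ₑ * ENNReal.ofReal z = 1 := by
    intro z hz
    rw [← ofReal_norm, Complex.norm_real, Real.norm_of_nonneg (by positivity),
      ← ENNReal.ofReal_mul (by positivity), inv_mul_cancel₀ hz.ne', ENNReal.ofReal_one]
  have := h (F.smul (x⁻¹ : ℝ)) (G.smul (y⁻¹ : ℝ))
    (by rw [Step.smul_norm, ex, e1 x hx0]) (by rw [Step.smul_norm, ey, e1 y hy0])
  rw [Step.smul_V, Step.smul_V, Bil_smul, enorm_mul, enorm_mul, RCLike.enorm_conj] at this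
  rw [ex, ey]
  calc _ = (‖((x⁻¹ : ℝ) : ℂ)‖ₑ * ENNReal.ofReal x) * (‖((y⁻¹ : ℝ) : ℂ)‖ₑ * ENNReal.ofReal y) *
        ‖Bil (F.V D) (G.V D)‖ₑ := by rw [e1 x hx0, e1 y hy0]; simp
    _ = (‖((x⁻¹ : ℝ) : ℂ)‖ₑ * ‖((y⁻¹ : ℝ) : ℂ)‖ₑ * ‖Bil (F.V D) (G.V D)‖ₑ) *
        (ENNReal.ofReal x * ENNReal.ofReal y) := by ring
    _ ≤ _ := by gcongr

lemma D1 (D : Disp μ H σ A) : BilB D 1 2 1 2 1 := by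
  intro F G
  have hb : ∀ (F : Step μ 2) s, ‖F.V D s‖ₑ ≤ ‖F.c s‖ₑ := by
    intro F s
    rw [Step.V, vstep, enorm_smul, LinearIsometry.enorm_map]
    have := F.unit (F.i s)
    rw [← Lp.enorm_def] at this
    calc _ ≤ ‖F.c s‖ₑ * 1 := by gcongr
      _ = _ := mul_one _
  rw [ENNReal.ofReal_one, one_mul, eLpNorm_one_eq_lintegral_enorm, eLpNorm_one_eq_lintegral_enorm]
  refine (enorm_integral_le_lintegral_enorm _).trans ?_
  refine (setLIntegral_le_lintegral _ _).trans ?_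
  calc _ ≤ ∫⁻ z : ℝ × ℝ, ‖F.c z.1‖ₑ * ‖G.c z.2‖ₑ := by
        refine lintegral_mono fun z => ?_
        calc _ ≤ ‖F.V D z.1‖ₑ * ‖G.V D z.2‖ₑ := by
              rw [← ofReal_norm, ← ofReal_norm, ← ofReal_norm, ← ENNReal.ofReal_mul (norm_nonneg _)]
              exact ENNReal.ofReal_le_ofReal (norm_inner_le_norm _ _)
          _ ≤ _ := by gcongr <;> apply hb
    _ = _ := by
        rw [Measure.volume_eq_prod]
        exact lintegral_prod_mul F.cm.enorm.aemeasurable G.cm.enorm.aemeasurable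

lemma D2 (D : Disp μ H σ A) {α : ℝ} (hα : 1 < α) (hα2 : α < 2) {p : ℝ≥0∞} {C : ℝ} (hC : 0 ≤ C)
    (hker : ∀ f g : Lp ℂ 2 μ, Nice f → Nice g → eLpNorm f p μ ≤ 1 → eLpNorm g p μ ≤ 1 →
      ∀ s t : ℝ, s ≠ t → ‖inner ℂ (D.V s f) (D.V t g)‖ ≤ C * |t - s| ^ (-(2 - 2/α))) :
    BilB D (ENNReal.ofReal α) p (ENNReal.ofReal α) p (C * (2 * (2 / (2/α - 1) + 2))) := by
  have hα0 : 0 < α := by linarith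
  have h1α : 1 ≤ ENNReal.ofReal α := by rw [← ENNReal.ofReal_one]; exact ENNReal.ofReal_le_ofReal hα.le
  apply BilB_of_unit D h1α h1α
  intro F G hF hG
  have hno : ∀ F : Step μ p, eLpNorm F.c (ENNReal.ofReal α) volume ≤ 1 → ∫⁻ t, ‖F.c t‖ₑ ^ α ≤ 1 := by
    intro F hF
    rw [eLpNorm_eq_lintegral_rpow_enorm_toReal (by positivity) (by simp), ENNReal.toReal_ofReal hα0.le] at hF
    by_contra h
    rw [not_le] at h
    exact absurd hF (not_le.2 (ENNReal.one_lt_rpow h (by positivity)))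
  refine (enorm_integral_le_lintegral_enorm _).trans ?_
  refine (setLIntegral_le_lintegral _ _).trans ?_
  have hdiag : ∀ᵐ z : ℝ × ℝ, z.1 ≠ z.2 := by
    have hms : MeasurableSet {z : ℝ × ℝ | z.1 ≠ z.2} :=
      (measurableSet_eq_fun measurable_fst measurable_snd).compl
    rw [Measure.volume_eq_prod, Measure.ae_prod_iff_ae_ae hms]
    refine Filter.Eventually.of_forall fun x => ?_
    have : ∀ᵐ y : ℝ, y ≠ x := Measure.ae_ne volume x
    filter_upwards [this] with y hy using hy.symm
  calc _ ≤ ∫⁻ z : ℝ × ℝ, ENNReal.ofReal C *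
        (ENNReal.ofReal (|z.2 - z.1| ^ (-(2 - 2/α))) * (‖F.c z.1‖ₑ * ‖G.c z.2‖ₑ)) := by
        refine lintegral_mono_ae ?_
        filter_upwards [hdiag] with z hz
        rw [Step.V, Step.V, vstep, vstep, inner_smul_left, inner_smul_right, enorm_mul, enorm_mul,
          RCLike.enorm_conj]
        have := hker (F.ψ (F.i z.1)) (G.ψ (G.i z.2)) (F.nice _) (G.nice _) (F.unit _) (G.unit _) z.1 z.2 hz
        rw [← ofReal_norm (inner ℂ _ _)]
        calc _ ≤ ‖F.c z.1‖ₑ * (‖G.c z.2‖ₑ * ENNReal.ofReal (C * |z.2 - z.1| ^ (-(2 - 2/α)))) := by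
              gcongr
          _ = _ := by rw [ENNReal.ofReal_mul hC]; ring
    _ = ENNReal.ofReal C * ∫⁻ z : ℝ × ℝ, 
        (ENNReal.ofReal (|z.2 - z.1| ^ (-(2 - 2/α))) * (‖F.c z.1‖ₑ * ‖G.c z.2‖ₑ)) := by
        have h1 : Measurable fun z : ℝ × ℝ => ‖F.c z.1‖ₑ := F.cm.enorm.comp measurable_fst
        have h2 : Measurable fun z : ℝ × ℝ => ‖G.c z.2‖ₑ := G.cm.enorm.comp measurable_snd
        exact lintegral_const_mul _ (Measurable.mul (by fun_prop) (h1.mul h2))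
    _ ≤ ENNReal.ofReal C * (2 * ENNReal.ofReal (2 / (2/α - 1) + 2)) := by
        gcongr
        exact hls hα hα2 F.cm.enorm G.cm.enorm (hno F hF) (hno G hG)
    _ = _ := by
        rw [ENNReal.ofReal_mul hC, ENNReal.ofReal_mul (by norm_num), ENNReal.ofReal_ofNat]

/-- data from the atomic decomposition of a step function -/
lemma Step.atoms {p : ℝ} (hp : 1 ≤ p) (hp2 : p ≤ 2) (F : Step μ (ENNReal.ofReal p))
    (hF : eLpNorm F.c 2 volume ≤ 1) :
    ∃ (K : Finset ℤ) (φ : ℤ → ℕ → Lp ℂ 2 μ) (a : ℤ → ℕ → ℝ), (∀ k n, 0 ≤ a k n) ∧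
      (∀ D : Disp μ H σ A, ∀ L : Finset ℤ, K ⊆ L → F.V D = fun s => ∑ k ∈ L, vstep D F.c F.i (φ k) s) ∧
      (∀ k n, eLpNorm (φ k n) 1 μ ≤ ENNReal.ofReal (4 * 2 ^ (k * (1 - 1/p)) * a k n)) ∧
      (∀ k n, ‖φ k n‖ₑ ≤ ENNReal.ofReal (4 * 2 ^ (k * (1/2 - 1/p)) * a k n)) ∧
      (∀ L : Finset ℤ, ∑ k ∈ L, ∫⁻ s, (‖F.c s‖ₑ * ENNReal.ofReal (4 * a k (F.i s))) ^ 2 ≤ 64) := by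
  classical
  have hp0 : 0 < p := by linarith
  have hψ : ∀ n, ∫⁻ x, ‖F.ψ n x‖ₑ ^ p ∂μ ≤ 1 := by
    intro n
    have hF := F.unit n
    rw [eLpNorm_eq_lintegral_rpow_enorm_toReal (by positivity) (by simp), ENNReal.toReal_ofReal hp0.le] at hF
    by_contra h
    rw [not_le] at h
    exact absurd hF (not_le.2 (ENNReal.one_lt_rpow h (by positivity)))
  have := fun n => _root_.atoms hp hp2 (F.ψ n) (F.nice n) (hψ n)
  choose K φ a ha hsum h1 h2 hS hout using this
  refine ⟨(Finset.range F.N).biUnion K, fun k n => φ n k, fun k n => a n k, fun k n => ha n k, ?_,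
    fun k n => h1 n k, fun k n => h2 n k, ?_⟩
  · intro D L hL
    ext s
    have hn : F.i s ∈ Finset.range F.N := Finset.mem_range.2 (F.iN s)
    have hKL : K (F.i s) ⊆ L := (Finset.subset_biUnion_of_mem K hn).trans hL
    have : F.ψ (F.i s) = ∑ k ∈ L, φ (F.i s) k := by
      rw [hsum (F.i s)]
      exact Finset.sum_subset hKL (fun k _ hk => (hout _ k hk).1)
    simp only [Step.V, vstep]
    rw [this, map_sum, Finset.smul_sum]
  · intro L
    have hm : ∀ k, Measurable fun s => (‖F.c s‖ₑ * ENNReal.ofReal (4 * a (F.i s) k)) ^ 2 := fun k =>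
      (F.cm.enorm.mul ((measurable_from_top (f := fun n => ENNReal.ofReal (4 * a n k))).comp F.im)).pow_const 2
    rw [← lintegral_finsetSum _ (fun k _ => hm k)]
    have h2 : ∀ n, ∑ k ∈ L, ENNReal.ofReal (4 * a n k) ^ 2 ≤ 64 := by
      intro n
      have : ∑ k ∈ L, a n k ^ 2 ≤ 4 := by
        refine le_trans ?_ (hS n)
        rw [← Finset.sum_filter_add_sum_filter_not L (fun k => k ∈ K n)]
        rw [Finset.sum_eq_zero (s := L.filter (fun k => k ∉ K n)), add_zero]
        · refine Finset.sum_le_sum_of_subset_of_nonneg (fun k hk => (Finset.mem_filter.1 hk).2) ?_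
          intros; positivity
        · intro k hk
          rw [(hout n k (Finset.mem_filter.1 hk).2).2]; norm_num
      have e : ∀ k ∈ L, ENNReal.ofReal (4 * a n k) ^ 2 = ENNReal.ofReal (16 * a n k ^ 2) := by
        intro k _
        rw [← ENNReal.ofReal_pow (mul_nonneg (by norm_num) (ha n k))]
        congr 1; ring
      rw [Finset.sum_congr rfl e, ← ENNReal.ofReal_sum_of_nonneg (fun _ _ => by positivity),
        ← Finset.mul_sum]
      calc _ ≤ ENNReal.ofReal 64 := ENNReal.ofReal_le_ofReal (by linarith)
        _ = 64 := by norm_num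
    have h3 : ∫⁻ s, ‖F.c s‖ₑ ^ 2 ≤ 1 := by
      rw [eLpNorm_eq_lintegral_rpow_enorm_toReal (by norm_num) (by simp)] at hF
      by_contra h
      rw [not_le] at h
      refine absurd hF (not_le.2 (ENNReal.one_lt_rpow ?_ (by norm_num)))
      simpa using h
    calc _ ≤ ∫⁻ s, 64 * ‖F.c s‖ₑ ^ 2 := by
          refine lintegral_mono fun s => ?_
          simp only [mul_pow]
          rw [← Finset.mul_sum, mul_comm]
          gcongr
          exact h2 _
      _ = 64 * ∫⁻ s, ‖F.c s‖ₑ ^ 2 := lintegral_const_mul _ (F.cm.enorm.pow_const 2)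
      _ ≤ 64 * 1 := by gcongr
      _ = 64 := by norm_num

lemma D3 (D : Disp μ H σ A) (hσ : 1 < σ) {p : ℝ} (hp : 1 / p = (σ + 1) / (2 * σ)) :
    BilB D 2 (ENNReal.ofReal p) 2 (ENNReal.ofReal p) (Cpair σ A * Cgeo (cpair σ) * 128) := by
  have hσ0 : 0 < σ := by linarith
  have hp' : p = 2 * σ / (σ + 1) := by
    rw [← one_div_one_div p, hp, one_div_div]
  have hp1 : 1 ≤ p := by rw [hp', le_div_iff₀ (by linarith)]; linarith
  have hp2 : p ≤ 2 := by rw [hp', div_le_iff₀ (by linarith)]; linarith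
  have e1 : ∀ k : ℤ, (k:ℝ) * (1 - 1/p) = k * ((σ - 1) / (2 * σ)) := by
    intro k; rw [hp]; field_simp; ring
  have e2 : ∀ k : ℤ, (k:ℝ) * (1/2 - 1/p) = -k / (2 * σ) := by
    intro k; rw [hp]; field_simp; ring
  have hc0 : 0 < cpair σ := by
    have : 0 < σ - 1 := by linarith
    unfold cpair; positivity
  have hCp : 0 ≤ Cpair σ A := by
    have : 0 < σ - 1 := by linarith
    have := D.hA
    unfold Cpair; positivity
  apply BilB_of_unit D (by norm_num) (by norm_num)
  intro F G hF hG
  classical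
  obtain ⟨K, φ, a, ha, hsum, h1, h2, hS⟩ := Step.atoms (H := H) (σ := σ) (A := A) hp1 hp2 F hF
  obtain ⟨K', φ', a', ha', hsum', h1', h2', hS'⟩ := Step.atoms (H := H) (σ := σ) (A := A) hp1 hp2 G hG
  simp only [e1, e2] at h1 h2 h1' h2'
  rw [hsum D (K ∪ K') Finset.subset_union_left, hsum' D (K ∪ K') Finset.subset_union_right]
  set L := K ∪ K'
  rw [Bil_sum _ _ _ _ (fun k => vstep_integrable D F.cint F.im F.iN _)
    (fun k => vstep_integrable D G.cint G.im G.iN _)]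
  set P : ℤ → ℝ≥0∞ := fun k => ∫⁻ s, (‖F.c s‖ₑ * ENNReal.ofReal (4 * a k (F.i s))) ^ 2
  set Q : ℤ → ℝ≥0∞ := fun k => ∫⁻ s, (‖G.c s‖ₑ * ENNReal.ofReal (4 * a' k (G.i s))) ^ 2
  have hgeo : ∀ x : ℤ, ∑ k ∈ L, ENNReal.ofReal (Cpair σ A * 2 ^ (-(cpair σ * |(k:ℝ) - x|))) ≤
      ENNReal.ofReal (Cpair σ A * Cgeo (cpair σ)) := by
    intro x
    rw [← ENNReal.ofReal_sum_of_nonneg (fun _ _ => by positivity), ← Finset.mul_sum]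
    apply ENNReal.ofReal_le_ofReal
    gcongr
    exact geo_sum hc0 L x
  calc _ ≤ ∑ k ∈ L, ∑ l ∈ L, ‖Bil (vstep D F.c F.i (φ k)) (vstep D G.c G.i (φ' l))‖ₑ :=
        (enorm_sum_le _ _).trans (Finset.sum_le_sum fun k _ => enorm_sum_le _ _)
    _ ≤ ∑ k ∈ L, ∑ l ∈ L, ENNReal.ofReal (Cpair σ A * 2 ^ (-(cpair σ * |(k:ℝ) - l|))) * (P k + Q l) :=
        Finset.sum_le_sum fun k _ => Finset.sum_le_sum fun l _ =>
          vstep_pair D hσ F.cint G.cint F.cm G.cm F.im G.im F.iN G.iN (ha k) (ha' l) (h1 k) (h2 k)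
            (h1' l) (h2' l)
    _ = ∑ k ∈ L, (∑ l ∈ L, ENNReal.ofReal (Cpair σ A * 2 ^ (-(cpair σ * |(l:ℝ) - k|)))) * P k +
        ∑ l ∈ L, (∑ k ∈ L, ENNReal.ofReal (Cpair σ A * 2 ^ (-(cpair σ * |(k:ℝ) - l|)))) * Q l := by
        simp only [mul_add, Finset.sum_add_distrib, Finset.sum_mul]
        congr 1
        · simp only [abs_sub_comm]
        · rw [Finset.sum_comm]
    _ ≤ ∑ k ∈ L, ENNReal.ofReal (Cpair σ A * Cgeo (cpair σ)) * P k +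
        ∑ l ∈ L, ENNReal.ofReal (Cpair σ A * Cgeo (cpair σ)) * Q l := by
        gcongr
        · exact hgeo _
        · exact hgeo _
    _ ≤ ENNReal.ofReal (Cpair σ A * Cgeo (cpair σ)) * 64 + ENNReal.ofReal (Cpair σ A * Cgeo (cpair σ)) * 64 := by
        rw [← Finset.mul_sum, ← Finset.mul_sum]
        gcongr
        · exact hS L
        · exact hS' L
    _ = _ := by
        have := Cgeo_nonneg (cpair σ)
        rw [ENNReal.ofReal_mul (by positivity : 0 ≤ Cpair σ A * Cgeo (cpair σ)), ← mul_add]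
        norm_num
end

end

section

section
variable {X : Type*} [MeasurableSpace X] {μ : Measure X}

lemma norming_real_aux {r p : ℝ} (hr : 2 ≤ r) (hp : p = r / (r - 1)) (f : Lp ℂ 2 μ) {C : ℝ}
    (hC : 0 ≤ C)
    (h : ∀ ψ : Lp ℂ 2 μ, Nice ψ → eLpNorm ψ (ENNReal.ofReal p) μ ≤ 1 → ‖inner ℂ f ψ‖ ≤ C)
    {ε M : ℝ} (hε : 0 < ε) (hM : 0 ≤ M) {E : Set X} (hE : MeasurableSet E)
    (hEf : ∀ x ∈ E, ε ≤ ‖f x‖ ∧ ‖f x‖ ≤ M) :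
    ∫⁻ x, E.indicator (fun x => ‖f x‖ₑ ^ r) x ∂μ ≤ ENNReal.ofReal C ^ r := by
  have hr1 : 0 < r - 1 := by linarith
  have hr0 : 0 < r := by linarith
  have hp0 : 0 < p := by rw [hp]; positivity
  have hpr : (r - 1) * p = r := by rw [hp]; field_simp
  have hpi : 1 / p = 1 - 1/r := by rw [hp]; field_simp
  have hfm : Measurable f := (Lp.stronglyMeasurable f).measurable
  set I := ∫⁻ x, E.indicator (fun x => ‖f x‖ₑ ^ r) x ∂μ with hI
  have hIfin : I ≠ ∞ := by
    have h2 : ∫⁻ x, ‖f x‖ₑ ^ (2:ℝ) ∂μ < ∞ := by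
      have := lintegral_rpow_enorm_lt_top_of_eLpNorm_lt_top (by norm_num) (by norm_num) (Lp.memLp f).2
      simpa using this
    refine (lt_of_le_of_lt (b := ENNReal.ofReal M ^ (r - 2) * ∫⁻ x, ‖f x‖ₑ ^ (2:ℝ) ∂μ) ?_ ?_).ne
    · rw [← lintegral_const_mul _ (by fun_prop)]
      refine lintegral_mono fun x => ?_
      by_cases hx : x ∈ E
      · rw [Set.indicator_of_mem hx]
        calc _ = ‖f x‖ₑ ^ ((r - 2) + 2) := by ring_nf
          _ = ‖f x‖ₑ ^ (r - 2) * ‖f x‖ₑ ^ (2:ℝ) := by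
            rw [ENNReal.rpow_add_of_nonneg _ _ (by linarith) (by norm_num)]
          _ ≤ _ := by
            gcongr
            rw [← ofReal_norm]; exact ENNReal.ofReal_le_ofReal (hEf x hx).2
      · rw [Set.indicator_of_notMem hx]; exact zero_le
    · exact ENNReal.mul_lt_top (ENNReal.rpow_lt_top_of_nonneg (by linarith) (by simp)) h2
  rcases eq_or_ne I 0 with h0 | h0
  · rw [h0]; exact zero_le
  set J := I.toReal with hJ
  have hJ0 : 0 < J := ENNReal.toReal_pos h0 hIfin
  have hIJ : I = ENNReal.ofReal J := (ENNReal.ofReal_toReal hIfin).symm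
  set κ := J ^ (-(1/p)) with hκ
  have hκ0 : 0 < κ := by positivity
  set ψ₀ : X → ℂ := E.indicator (fun x => ((κ * ‖f x‖ ^ (r - 2) : ℝ) : ℂ) * f x) with hψ₀
  have hψm : Measurable ψ₀ := by
    refine Measurable.indicator ?_ hE
    have : Measurable fun x => ‖f x‖ := hfm.norm
    fun_prop
  have hnorm : ∀ x ∈ E, ‖ψ₀ x‖ = κ * ‖f x‖ ^ (r - 1) := by
    intro x hx
    have : 0 < ‖f x‖ := hε.trans_le (hEf x hx).1
    rw [hψ₀, Set.indicator_of_mem hx, norm_mul, Complex.norm_real, Real.norm_of_nonneg (by positivity),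
      mul_assoc]
    congr 1
    nth_rewrite 2 [← Real.rpow_one ‖f x‖]
    rw [← Real.rpow_add this]
    congr 1; ring
  have hψL : MemLp ψ₀ 2 μ := by
    refine (Lp.memLp f).of_le_mul (c := κ * M ^ (r - 2)) hψm.aestronglyMeasurable ?_
    refine Filter.Eventually.of_forall fun x => ?_
    by_cases hx : x ∈ E
    · rw [hψ₀, Set.indicator_of_mem hx, norm_mul, Complex.norm_real, Real.norm_of_nonneg (by positivity)]
      gcongr
      exact (hEf x hx).2
    · rw [hψ₀, Set.indicator_of_notMem hx]; simp; positivity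
  have hψae := hψL.coeFn_toLp
  have key := h (hψL.toLp ψ₀) ?_ ?_
  · have e : inner ℂ f (hψL.toLp ψ₀) = ((κ * J : ℝ) : ℂ) := by
      rw [L2.inner_def]
      have : ∀ᵐ x ∂μ, inner ℂ (f x) ((hψL.toLp ψ₀) x) =
          ((κ * E.indicator (fun x => ‖f x‖ ^ r) x : ℝ) : ℂ) := by
        filter_upwards [hψae] with x hx
        rw [hx]
        by_cases hxE : x ∈ E
        · have h0 : 0 < ‖f x‖ := hε.trans_le (hEf x hxE).1
          rw [hψ₀, Set.indicator_of_mem hxE, Set.indicator_of_mem hxE]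
          rw [RCLike.inner_apply, mul_assoc, Complex.mul_conj, Complex.normSq_eq_norm_sq]
          rw [← Complex.ofReal_mul]
          congr 1
          rw [mul_assoc, ← Real.rpow_natCast ‖f x‖ 2, ← Real.rpow_add h0]
          congr 2; push_cast; ring
        · rw [hψ₀, Set.indicator_of_notMem hxE, Set.indicator_of_notMem hxE]; simp
      rw [integral_congr_ae this, integral_complex_ofReal, integral_const_mul]
      congr 2
      rw [integral_eq_lintegral_of_nonneg_ae, hJ, hI]
      · congr 1
        refine lintegral_congr fun x => ?_
        by_cases hxE : x ∈ E
        · rw [Set.indicator_of_mem hxE, Set.indicator_of_mem hxE, ← ofReal_norm,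
            ENNReal.ofReal_rpow_of_nonneg (norm_nonneg _) hr0.le]
        · rw [Set.indicator_of_notMem hxE, Set.indicator_of_notMem hxE]; simp
      · refine Filter.Eventually.of_forall fun x => ?_
        exact Set.indicator_nonneg (fun x _ => by positivity) x
      · refine (Measurable.indicator ?_ hE).aestronglyMeasurable
        exact hfm.norm.pow_const r
    rw [e, Complex.norm_real, Real.norm_of_nonneg (by positivity)] at key
    have h3 : κ * J = J ^ (1/r) := by
      rw [hκ, hpi]
      nth_rewrite 2 [← Real.rpow_one J]
      rw [← Real.rpow_add hJ0]; congr 1; ring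
    rw [h3] at key
    rw [hIJ, ENNReal.ofReal_rpow_of_nonneg hC hr0.le]
    apply ENNReal.ofReal_le_ofReal
    calc J = (J ^ (1/r)) ^ r := by rw [← Real.rpow_mul hJ0.le, one_div_mul_cancel hr0.ne', Real.rpow_one]
      _ ≤ _ := by gcongr
  · refine ⟨κ * ε ^ (r - 1), by positivity, κ * M ^ (r - 1), ?_⟩
    filter_upwards [hψae] with x hx
    rw [hx]
    by_cases hxE : x ∈ E
    · right
      obtain ⟨h1, h2⟩ := hEf x hxE
      rw [hnorm x hxE]
      exact ⟨by gcongr, by gcongr⟩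
    · left; rw [hψ₀, Set.indicator_of_notMem hxE]
  · rw [eLpNorm_congr_ae hψae, eLpNorm_eq_lintegral_rpow_enorm_toReal (by positivity) (by simp),
      ENNReal.toReal_ofReal hp0.le]
    refine ENNReal.rpow_le_one (le_of_eq ?_) (by positivity)
    calc _ = ∫⁻ x, ENNReal.ofReal κ ^ p * E.indicator (fun x => ‖f x‖ₑ ^ r) x ∂μ := by
          refine lintegral_congr fun x => ?_
          by_cases hxE : x ∈ E
          · rw [← ofReal_norm, hnorm x hxE, Set.indicator_of_mem hxE, ENNReal.ofReal_mul hκ0.le,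
              ENNReal.mul_rpow_of_nonneg _ _ hp0.le, ← ofReal_norm]
            congr 1
            rw [← ENNReal.ofReal_rpow_of_nonneg (norm_nonneg _) hr1.le, ← ENNReal.rpow_mul, hpr]
          · rw [hψ₀, Set.indicator_of_notMem hxE, Set.indicator_of_notMem hxE]; simp [hp0]
      _ = ENNReal.ofReal κ ^ p * I := lintegral_const_mul _ (Measurable.indicator (by fun_prop) hE)
      _ = 1 := by
          rw [hIJ, ENNReal.ofReal_rpow_of_pos hκ0, ← ENNReal.ofReal_mul (by positivity), hκ,
            ← Real.rpow_mul hJ0.le, show -(1/p) * p = -1 by field_simp, Real.rpow_neg_one,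
            inv_mul_cancel₀ hJ0.ne', ENNReal.ofReal_one]

lemma norming_real {r p : ℝ} (hr : 2 ≤ r) (hp : p = r / (r - 1)) (f : Lp ℂ 2 μ) {C : ℝ}
    (hC : 0 ≤ C)
    (h : ∀ ψ : Lp ℂ 2 μ, Nice ψ → eLpNorm ψ (ENNReal.ofReal p) μ ≤ 1 → ‖inner ℂ f ψ‖ ≤ C) :
    eLpNorm f (ENNReal.ofReal r) μ ≤ ENNReal.ofReal C := by
  have hr0 : 0 < r := by linarith
  have hfm : Measurable f := (Lp.stronglyMeasurable f).measurable
  set E : ℕ → Set X := fun n => {x | 1 / ((n:ℝ) + 1) ≤ ‖f x‖ ∧ ‖f x‖ ≤ n + 1} with hE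
  have hEm : ∀ n, MeasurableSet (E n) := fun n =>
    (measurableSet_le measurable_const hfm.norm).inter (measurableSet_le hfm.norm measurable_const)
  have hmono : Monotone E := by
    intro n m hnm x hx
    have : (n:ℝ) ≤ m := by exact_mod_cast hnm
    refine ⟨le_trans ?_ hx.1, hx.2.trans (by linarith)⟩
    gcongr
  have h1 : ∀ n, ∫⁻ x, (E n).indicator (fun x => ‖f x‖ₑ ^ r) x ∂μ ≤ ENNReal.ofReal C ^ r := fun n =>
    norming_real_aux hr hp f hC h (ε := 1 / ((n:ℝ) + 1)) (M := n + 1) (by positivity) (by positivity)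
      (hEm n) (fun x hx => hx)
  rw [eLpNorm_eq_lintegral_rpow_enorm_toReal (by positivity) (by simp), ENNReal.toReal_ofReal hr0.le]
  rw [one_div, ENNReal.rpow_inv_le_iff hr0]

  calc _ ≤ ∫⁻ x, ⨆ n, (E n).indicator (fun x => ‖f x‖ₑ ^ r) x ∂μ := by
        refine lintegral_mono fun x => ?_
        rcases eq_or_ne (f x) 0 with h0 | h0
        · simp [h0, hr0]
        · have hpos : 0 < ‖f x‖ := norm_pos_iff.2 h0
          obtain ⟨n, hn⟩ := exists_nat_gt (max ‖f x‖ (1/‖f x‖))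
          have hx : x ∈ E n := by
            have a1 := (le_max_left _ _).trans_lt hn
            have a2 := (le_max_right _ _).trans_lt hn
            refine ⟨?_, by linarith⟩
            rw [div_le_iff₀ (by positivity)]
            rw [div_lt_iff₀ hpos] at a2
            nlinarith
          refine le_iSup_of_le n ?_
          rw [Set.indicator_of_mem hx]
    _ = ⨆ n, ∫⁻ x, (E n).indicator (fun x => ‖f x‖ₑ ^ r) x ∂μ := by
        refine lintegral_iSup (fun n => Measurable.indicator (by fun_prop) (hEm n)) ?_
        intro n m hnm x
        exact Set.indicator_le_indicator_of_subset (hmono hnm) (fun _ => zero_le) x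
    _ ≤ _ := iSup_le h1

lemma norming_top (f : Lp ℂ 2 μ) {C : ℝ} (hC : 0 ≤ C)
    (h : ∀ ψ : Lp ℂ 2 μ, Nice ψ → eLpNorm ψ 1 μ ≤ 1 → ‖inner ℂ f ψ‖ ≤ C) :
    eLpNorm f ∞ μ ≤ ENNReal.ofReal C := by
  have hfm : Measurable f := (Lp.stronglyMeasurable f).measurable
  set E : ℕ → Set X := fun n => {x | C + 1/((n:ℝ)+1) ≤ ‖f x‖ ∧ ‖f x‖ ≤ C + n + 1} with hE
  have hEm : ∀ n, MeasurableSet (E n) := fun n =>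
    (measurableSet_le measurable_const hfm.norm).inter (measurableSet_le hfm.norm measurable_const)
  have hE0 : ∀ n, μ (E n) = 0 := by
    intro n
    by_contra h0
    set ε := C + 1/((n:ℝ)+1) with hε
    have hε0 : 0 < ε := by positivity
    have hfin : μ (E n) ≠ ∞ := by
      have := (Lp.memLp f).meas_ge_lt_top (by norm_num) (by norm_num) (ε := (⟨ε, hε0.le⟩ : ℝ≥0))
        (by intro h; exact hε0.ne' (congrArg NNReal.toReal h))
      refine (lt_of_le_of_lt (measure_mono ?_) this).ne
      rintro x ⟨h1, _⟩
      exact h1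
    set m := (μ (E n)).toReal with hm
    have hm0 : 0 < m := ENNReal.toReal_pos h0 hfin
    have hμ : μ (E n) = ENNReal.ofReal m := (ENNReal.ofReal_toReal hfin).symm
    set ψ₀ : X → ℂ := (E n).indicator (fun x => ((m⁻¹ * ‖f x‖⁻¹ : ℝ) : ℂ) * f x) with hψ₀
    have hψm : Measurable ψ₀ := by
      refine Measurable.indicator ?_ (hEm n)
      have : Measurable fun x => ‖f x‖ := hfm.norm
      fun_prop
    have hnorm : ∀ x ∈ E n, ‖ψ₀ x‖ = m⁻¹ := by
      intro x hx
      have : 0 < ‖f x‖ := hε0.trans_le hx.1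
      rw [hψ₀, Set.indicator_of_mem hx, norm_mul, Complex.norm_real, Real.norm_of_nonneg (by positivity),
        mul_assoc, inv_mul_cancel₀ this.ne', mul_one]
    have hψL : MemLp ψ₀ 2 μ := by
      refine (memLp_indicator_const 2 (hEm n) (m⁻¹ : ℝ) (Or.inr hfin)).mono hψm.aestronglyMeasurable ?_
      refine Filter.Eventually.of_forall fun x => ?_
      by_cases hx : x ∈ E n
      · rw [hnorm x hx, Set.indicator_of_mem hx, Real.norm_of_nonneg (by positivity)]
      · rw [hψ₀, Set.indicator_of_notMem hx]; simp
    have hψae := hψL.coeFn_toLp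
    have key := h (hψL.toLp ψ₀) ?_ ?_
    · have e : inner ℂ f (hψL.toLp ψ₀) = ((∫ x, (E n).indicator (fun x => m⁻¹ * ‖f x‖) x ∂μ : ℝ) : ℂ) := by
        rw [L2.inner_def, ← integral_complex_ofReal]
        refine integral_congr_ae ?_
        filter_upwards [hψae] with x hx
        rw [hx]
        by_cases hxE : x ∈ E n
        · have h0 : 0 < ‖f x‖ := hε0.trans_le hxE.1
          rw [hψ₀, Set.indicator_of_mem hxE, Set.indicator_of_mem hxE]
          rw [RCLike.inner_apply, mul_assoc, Complex.mul_conj, Complex.normSq_eq_norm_sq]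
          rw [← Complex.ofReal_mul]
          norm_cast
          field_simp
        · rw [hψ₀, Set.indicator_of_notMem hxE, Set.indicator_of_notMem hxE]; simp
      have hge : ε ≤ ∫ x, (E n).indicator (fun x => m⁻¹ * ‖f x‖) x ∂μ := by
        calc ε = ∫ x, (E n).indicator (fun _ => m⁻¹ * ε) x ∂μ := by
              rw [integral_indicator_const _ (hEm n), Measure.real, ← hm, smul_eq_mul, ← mul_assoc,
                mul_inv_cancel₀ hm0.ne', one_mul]
          _ ≤ _ := by
              refine integral_mono ?_ ?_ ?_
              · exact (integrable_indicator_iff (hEm n)).2 (integrableOn_const hfin)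
              · refine (integrable_indicator_iff (hEm n)).2 ?_
                refine Measure.integrableOn_of_bounded (M := m⁻¹ * (C + n + 1)) hfin ?_ ?_
                · exact (hfm.norm.const_mul _).aestronglyMeasurable
                · filter_upwards [ae_restrict_mem (hEm n)] with x hx
                  rw [Real.norm_of_nonneg (by positivity)]
                  gcongr
                  exact hx.2
              · intro x
                refine Set.indicator_le_indicator' fun hx => ?_
                gcongr
                exact hx.1
      rw [e, Complex.norm_real] at key
      have := (le_abs_self _).trans key
      have h5 : 0 < 1/((n:ℝ)+1) := by positivity
      linarith
    · refine ⟨m⁻¹, by positivity, m⁻¹, ?_⟩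
      filter_upwards [hψae] with x hx
      rw [hx]
      by_cases hxE : x ∈ E n
      · right
        rw [hnorm x hxE]; simp
      · left; rw [hψ₀, Set.indicator_of_notMem hxE]
    · rw [eLpNorm_congr_ae hψae, eLpNorm_one_eq_lintegral_enorm]
      calc _ = ∫⁻ x, (E n).indicator (fun _ => ENNReal.ofReal m⁻¹) x ∂μ := by
            refine lintegral_congr fun x => ?_
            by_cases hxE : x ∈ E n
            · rw [← ofReal_norm, hnorm x hxE, Set.indicator_of_mem hxE]
            · rw [hψ₀, Set.indicator_of_notMem hxE, Set.indicator_of_notMem hxE]; simp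
        _ = ENNReal.ofReal m⁻¹ * μ (E n) := lintegral_indicator_const (hEm n) _
        _ ≤ 1 := by
            rw [hμ, ← ENNReal.ofReal_mul (by positivity), inv_mul_cancel₀ hm0.ne', ENNReal.ofReal_one]
  rw [eLpNorm_exponent_top]
  refine eLpNormEssSup_le_of_ae_bound ?_
  have hall : ∀ᵐ x ∂μ, ∀ n, x ∉ E n := by
    rw [ae_all_iff]
    exact fun n => measure_eq_zero_iff_ae_notMem.1 (hE0 n)
  filter_upwards [hall] with x hx
  by_contra hlt
  rw [not_le] at hlt
  obtain ⟨n, hn⟩ := exists_nat_gt (max ‖f x‖ (1/(‖f x‖ - C)))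
  have a1 := (le_max_left _ _).trans_lt hn
  have a2 := (le_max_right _ _).trans_lt hn
  refine hx n ⟨?_, by linarith⟩
  have hpos : 0 < ‖f x‖ - C := by linarith
  have : 1/((n:ℝ)+1) ≤ ‖f x‖ - C := by
    rw [div_le_iff₀ (by positivity)]
    rw [div_lt_iff₀ hpos] at a2
    nlinarith
  linarith

lemma norming {r r' : ℝ≥0∞} (hr : 2 ≤ r) (hrr : 1 / r' + 1 / r = 1) (f : Lp ℂ 2 μ) {C : ℝ} (hC : 0 ≤ C)
    (h : ∀ ψ : Lp ℂ 2 μ, Nice ψ → eLpNorm ψ r' μ ≤ 1 → ‖inner ℂ f ψ‖ ≤ C) :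
    eLpNorm f r μ ≤ ENNReal.ofReal C := by
  rcases eq_or_ne r ∞ with rfl | hr'
  · have : r' = 1 := by simpa using hrr
    subst this
    exact norming_top f hC h
  · have h2 : 2 ≤ r.toReal := by simpa using (ENNReal.toReal_le_toReal (by simp) hr').2 hr
    have e1 : r' = ENNReal.ofReal (r.toReal / (r.toReal - 1)) := by
      have hr0 : 0 < r.toReal := by linarith
      have : r = ENNReal.ofReal r.toReal := (ENNReal.ofReal_toReal hr').symm
      have h3 : r'⁻¹ = ENNReal.ofReal (1 - r.toReal⁻¹) := by
        rw [one_div, one_div] at hrr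
        rw [ENNReal.ofReal_sub _ (by positivity), ENNReal.ofReal_inv_of_pos hr0, ← this, ENNReal.ofReal_one, ← hrr]
        exact (ENNReal.add_sub_cancel_right (by simpa using (by rintro rfl; simp at hr : r ≠ 0))).symm
      have h4 : 0 < 1 - r.toReal⁻¹ := by
        have : r.toReal⁻¹ ≤ 2⁻¹ := by gcongr
        linarith
      rw [← inv_inv r', h3, ← ENNReal.ofReal_inv_of_pos h4]
      congr 1
      have : r.toReal - 1 ≠ 0 := by linarith
      field_simp
    rw [← ENNReal.ofReal_toReal hr']
    refine norming_real h2 rfl f hC ?_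
    rw [← e1]; exact h
end

end

section

lemma eLpNorm_le_of_iSup {h : ℕ → ℝ → ℝ≥0∞} (hm : ∀ n, Measurable (h n)) (hmono : Monotone h)
    {g : ℝ → ℝ≥0∞} (hg : ∀ t, g t ≤ ⨆ n, h n t) {q : ℝ≥0∞} (hq : q ≠ 0) {B : ℝ≥0∞}
    (hB : ∀ n, eLpNorm (h n) q volume ≤ B) : eLpNorm g q volume ≤ B := by
  rcases eq_or_ne q ∞ with rfl | hq'
  · rw [eLpNorm_exponent_top, eLpNormEssSup]
    refine essSup_le_of_ae_le _ ?_
    have : ∀ᵐ t, ∀ n, h n t ≤ B := by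
      rw [ae_all_iff]
      intro n
      have := hB n
      rw [eLpNorm_exponent_top, eLpNormEssSup] at this
      filter_upwards [ENNReal.ae_le_essSup (h n)] with t ht
      refine ht.trans (le_trans (le_of_eq ?_) this)
      simp
    filter_upwards [this] with t ht
    simpa using (hg t).trans (iSup_le ht)
  · have hq0 : 0 < q.toReal := ENNReal.toReal_pos hq hq'
    simp only [eLpNorm_eq_lintegral_rpow_enorm_toReal hq hq', enorm_eq_self, one_div,
      ENNReal.rpow_inv_le_iff hq0] at hB ⊢
    calc _ ≤ ∫⁻ t, ⨆ n, h n t ^ q.toReal := by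
          refine lintegral_mono fun t => ?_
          calc _ ≤ (⨆ n, h n t) ^ q.toReal := by gcongr; exact hg t
            _ = _ := (ENNReal.orderIsoRpow q.toReal hq0).map_iSup _
      _ = ⨆ n, ∫⁻ t, h n t ^ q.toReal := by
          refine lintegral_iSup (fun n => (hm n).pow_const _) ?_
          intro n m hnm t
          have := hmono hnm t
          dsimp only; gcongr
      _ ≤ _ := iSup_le hB

lemma exists_argmax (a : ℕ → ℝ → ℂ) (ha : ∀ n, Measurable (a n)) (n : ℕ) :
    ∃ i : ℝ → ℕ, Measurable i ∧ (∀ t, i t < n + 1) ∧ ∀ t, ∀ m ≤ n, ‖a m t‖ ≤ ‖a (i t) t‖ := by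
  induction n with
  | zero =>
    refine ⟨fun _ => 0, measurable_const, fun t => by simp, fun t m hm => ?_⟩
    rw [Nat.le_zero.1 hm]
  | succ n ih =>
    obtain ⟨i, hi, hin, hmax⟩ := ih
    have hsel : Measurable fun t => a (i t) t := (meas_sel hi a (fun n => (ha n).stronglyMeasurable)).measurable
    refine ⟨fun t => if ‖a (i t) t‖ < ‖a (n+1) t‖ then n + 1 else i t,
      Measurable.ite (measurableSet_lt hsel.norm (ha _).norm) measurable_const hi, ?_, ?_⟩
    · intro t
      have := hin t
      dsimp only
      split_ifs <;> omega
    · intro t m hm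
      dsimp only
      rcases Nat.le_succ_iff.1 hm with h | h
      · have := hmax t m h
        split_ifs with hh
        · exact this.trans hh.le
        · exact this
      · subst h
        split_ifs with hh
        · exact le_rfl
        · exact not_lt.1 hh

section
variable {X : Type*} [MeasurableSpace X] {μ : Measure X}

lemma nice_zero : Nice (0 : Lp ℂ 2 μ) := by
  refine ⟨1, one_pos, 1, ?_⟩
  filter_upwards [Lp.coeFn_zero ℂ 2 μ] with x hx
  left; rw [hx]; rfl

lemma duality [SecondCountableTopology (Lp ℂ 2 μ)] {u : ℝ → Lp ℂ 2 μ}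
    (hu : ∀ φ, Measurable fun t => inner ℂ (u t) φ) {M : ℝ} (hM : ∀ t, ‖u t‖ ≤ M)
    {q r q' r' : ℝ≥0∞} (hq : 2 ≤ q) (hr : 2 ≤ r) (hqq : 1/q' + 1/q = 1) (hrr : 1/r' + 1/r = 1)
    {C : ℝ} (hC : 0 ≤ C)
    (h : ∀ G : Step μ r', ‖∫ t, inner ℂ (u t) (G.c t • G.ψ (G.i t))‖ₑ ≤
      ENNReal.ofReal C * eLpNorm G.c q' volume) :
    eLpNorm (fun t => eLpNorm (u t) r μ) q volume ≤ ENNReal.ofReal C := by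
  set S : Set (Lp ℂ 2 μ) := {ψ | Nice ψ ∧ eLpNorm ψ r' μ ≤ 1} with hS
  have hS0 : (0 : Lp ℂ 2 μ) ∈ S := ⟨nice_zero, by rw [eLpNorm_congr_ae (Lp.coeFn_zero ℂ 2 μ)]; simp⟩
  haveI : Nonempty S := ⟨⟨0, hS0⟩⟩
  set ψ : ℕ → Lp ℂ 2 μ := fun n => (TopologicalSpace.denseSeq S n : Lp ℂ 2 μ) with hψ
  have hψS : ∀ n, ψ n ∈ S := fun n => (TopologicalSpace.denseSeq S n).2
  have hdense : ∀ φ ∈ S, φ ∈ closure (Set.range ψ) := by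
    intro φ hφ
    have := TopologicalSpace.denseRange_denseSeq S ⟨φ, hφ⟩
    rw [hψ]
    have h2 := image_closure_subset_closure_image (continuous_subtype_val (p := fun x => x ∈ S)) ⟨_, this, rfl⟩
    rwa [← Set.range_comp] at h2
  set a : ℕ → ℝ → ℂ := fun n t => inner ℂ (u t) (ψ n) with ha
  have ham : ∀ n, Measurable (a n) := fun n => hu (ψ n)
  have hM0 : 0 ≤ M := (norm_nonneg _).trans (hM 0)
  have hnorm : ∀ t, eLpNorm (u t) r μ ≤ ⨆ n, ‖a n t‖ₑ := by
    intro t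
    rcases eq_or_ne (⨆ n, ‖a n t‖ₑ) ∞ with h0 | h0
    · rw [h0]; exact le_top
    rw [← ENNReal.ofReal_toReal h0]
    refine norming hr hrr (u t) ENNReal.toReal_nonneg ?_
    intro φ hφ1 hφ2
    have hcl : IsClosed {φ : Lp ℂ 2 μ | ‖inner ℂ (u t) φ‖ ≤ (⨆ n, ‖a n t‖ₑ).toReal} :=
      isClosed_le (by fun_prop) continuous_const
    refine hcl.closure_subset_iff.2 ?_ (hdense φ ⟨hφ1, hφ2⟩)
    rintro _ ⟨n, rfl⟩
    have := le_iSup (fun n => ‖a n t‖ₑ) n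
    have := (ENNReal.toReal_le_toReal (by simp) h0).2 this
    simpa using this
  choose i him hin hmax using exists_argmax a ham
  set b : ℕ → ℝ → ℂ := fun n t => a (i n t) t with hb
  have hbm : ∀ n, Measurable (b n) := fun n => (meas_sel (him n) a (fun n => (ham n).stronglyMeasurable)).measurable
  set E : ℕ → Set ℝ := fun n => Set.Icc (-(n:ℝ)) n with hE
  have hEm : ∀ n, MeasurableSet (E n) := fun n => measurableSet_Icc
  have hEfin : ∀ n, volume (E n) ≠ ∞ := fun n => by simp [hE]
  set hh : ℕ → ℝ → ℂ := fun n => (E n).indicator (fun t => ((‖b n t‖ : ℝ) : ℂ)) with hhh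
  have hhm : ∀ n, Measurable (hh n) := fun n => by
    refine Measurable.indicator ?_ (hEm n)
    have := (hbm n).norm
    fun_prop
  have hhbd : ∀ n, ∃ K : ℝ, 0 ≤ K ∧ ∀ t, ‖b n t‖ ≤ K := by
    intro n
    refine ⟨M * ∑ m ∈ Finset.range (n+1), ‖ψ m‖, by positivity, fun t => ?_⟩
    refine (norm_inner_le_norm _ _).trans ?_
    gcongr
    · exact hM t
    · exact Finset.single_le_sum (f := fun m => ‖ψ m‖) (fun _ _ => norm_nonneg _) (Finset.mem_range.2 (hin n t))
  have hbound : ∀ n, eLpNorm (hh n) q volume ≤ ENNReal.ofReal C := by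
    intro n
    obtain ⟨K, hK0, hK⟩ := hhbd n
    have hL : MemLp (hh n) 2 volume := by
      refine (memLp_indicator_const 2 (hEm n) K (Or.inr (hEfin n))).mono (hhm n).aestronglyMeasurable ?_
      refine Filter.Eventually.of_forall fun t => ?_
      by_cases ht : t ∈ E n
      · rw [hhh]
        simp only [Set.indicator_of_mem ht, Complex.norm_real, norm_norm]
        exact (hK t).trans (le_abs_self _)
      · simp [hhh, ht]
    rw [← eLpNorm_congr_ae hL.coeFn_toLp]
    refine norming hq hqq _ hC ?_
    intro η ⟨ε, hε, Mη, hη⟩ hη1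
    have hηm : Measurable η := (Lp.stronglyMeasurable η).measurable
    set P : Set ℝ := E n ∩ {t | ‖η t‖ ≤ max Mη 0} with hP
    have hPm : MeasurableSet P := (hEm n).inter (measurableSet_le hηm.norm measurable_const)
    set ph : ℝ → ℂ := fun t => starRingEnd ℂ (b n t) / ((‖b n t‖ : ℝ) : ℂ) with hph
    have hphm : Measurable ph := by
      have := (hbm n).norm
      have h2 : Measurable fun t => starRingEnd ℂ (b n t) := Complex.continuous_conj.measurable.comp (hbm n)
      exact h2.div (by fun_prop)
    have hph1 : ∀ t, ‖ph t‖ ≤ 1 := by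
      intro t
      rw [hph]
      simp only [norm_div, RCLike.norm_conj, Complex.norm_real, norm_norm]
      exact div_self_le_one _
    have hphb : ∀ t, ph t * b n t = ((‖b n t‖ : ℝ) : ℂ) := by
      intro t
      rcases eq_or_ne (b n t) 0 with h0 | h0
      · simp [h0]
      · have : ((‖b n t‖ : ℝ) : ℂ) ≠ 0 := by simpa using h0
        rw [hph]
        simp only
        rw [div_mul_eq_mul_div, div_eq_iff this, mul_comm, Complex.mul_conj, Complex.normSq_eq_norm_sq]
        push_cast; ring
    set c : ℝ → ℂ := P.indicator (fun t => η t * ph t) with hc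
    have hcm : Measurable c := (hηm.mul hphm).indicator hPm
    have hcle : ∀ t, ‖c t‖ ≤ ‖η t‖ := by
      intro t
      by_cases ht : t ∈ P
      · simp only [hc, Set.indicator_of_mem ht, norm_mul]
        exact mul_le_of_le_one_right (norm_nonneg _) (hph1 t)
      · simp [hc, ht]
    have hcb : ∀ t, ‖c t‖ ≤ max Mη 0 := by
      intro t
      by_cases ht : t ∈ P
      · exact (hcle t).trans ht.2
      · simp [hc, ht]
    have hcint : Integrable c := by
      have : IntegrableOn c (E n) := Measure.integrableOn_of_bounded (M := max Mη 0) (hEfin n)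
        hcm.aestronglyMeasurable (Filter.Eventually.of_forall hcb)
      refine (integrableOn_iff_integrable_of_support_subset ?_).1 this
      intro t ht
      by_contra hn
      exact ht (by simp [hc, hP, hn])
    let G : Step μ r' := ⟨c, hcm, hcint, max Mη 0, hcb, i n, him n, n + 1, hin n, ψ, fun m => (hψS m).1,
      fun m => (hψS m).2⟩
    have hG := h G
    have e : inner ℂ (hL.toLp (hh n)) η = ∫ t, inner ℂ (u t) (G.c t • G.ψ (G.i t)) := by
      rw [L2.inner_def]
      refine integral_congr_ae ?_
      filter_upwards [hL.coeFn_toLp, hη] with t ht hηt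
      rw [ht, inner_smul_right]
      change _ = c t * b n t
      have hηM : ‖η t‖ ≤ max Mη 0 := by
        rcases hηt with h0 | h0
        · simp [h0]
        · exact h0.2.trans (le_max_left _ _)
      by_cases htE : t ∈ E n
      · have htP : t ∈ P := ⟨htE, hηM⟩
        simp only [hc, hhh, Set.indicator_of_mem htE, Set.indicator_of_mem htP, RCLike.inner_apply,
          Complex.conj_ofReal]
        rw [mul_assoc, hphb]
      · have htP : t ∉ P := fun h => htE h.1
        simp [hc, hhh, htE, htP]
    rw [e]
    refine norm_le_of_enorm hC (hG.trans ?_)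
    calc _ ≤ ENNReal.ofReal C * 1 := by
          gcongr
          exact (eLpNorm_mono hcle).trans hη1
      _ = _ := mul_one _
  refine eLpNorm_le_of_iSup (h := fun n t => ‖hh n t‖ₑ) (fun n => (hhm n).enorm) ?_ ?_ (by positivity) (B := ENNReal.ofReal C) ?_
  · intro n m hnm t
    simp only [hhh]
    by_cases ht : t ∈ E n
    · have hnm' : (n:ℝ) ≤ m := by exact_mod_cast hnm
      have ht' : t ∈ E m := ⟨by linarith [ht.1], by linarith [ht.2]⟩
      simp only [Set.indicator_of_mem ht, Set.indicator_of_mem ht']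
      rw [← ofReal_norm, ← ofReal_norm]
      apply ENNReal.ofReal_le_ofReal
      simp only [Complex.norm_real, norm_norm]
      exact hmax m t _ (by have := hin n t; omega)
    · simp [ht]
  · intro t
    refine (hnorm t).trans (iSup_le fun n => ?_)
    obtain ⟨k, hk⟩ := exists_nat_ge |t|
    have hk' : |t| ≤ ((max k n : ℕ) : ℝ) := hk.trans (by exact_mod_cast le_max_left _ _)
    have ht : t ∈ E (max k n) := abs_le.1 hk'
    refine le_iSup_of_le (max k n) ?_
    simp only [hhh, Set.indicator_of_mem ht]
    rw [← ofReal_norm, ← ofReal_norm]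
    apply ENNReal.ofReal_le_ofReal
    simp only [Complex.norm_real, norm_norm]
    exact hmax _ t _ (le_max_right _ _)
  · intro n
    refine le_trans (le_of_eq ?_) (hbound n)
    exact eLpNorm_enorm _
end

end

section

section
variable {H : Type*} [NormedAddCommGroup H] [InnerProductSpace ℂ H] [CompleteSpace H]

/-- primitive -/
def Wp (f : ℝ → H) (t : ℝ) : H := ∫ s in Set.Iio t, f s

lemma Wp_norm {f : ℝ → H} (hf : Integrable f) (t : ℝ) : ‖Wp f t‖ ≤ ∫ s, ‖f s‖ :=
  (norm_integral_le_integral_norm _).trans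
    (setIntegral_le_integral hf.norm (Filter.Eventually.of_forall fun _ => norm_nonneg _))

lemma Wp_cont {f : ℝ → H} (hf : Integrable f) : Continuous (Wp f) := by
  have : Wp f = fun t => (∫ s in Set.Iic (0:ℝ), f s) + ∫ s in (0:ℝ)..t, f s := by
    ext t
    rw [← intervalIntegral.integral_Iic_sub_Iic hf.integrableOn hf.integrableOn, Wp,
      integral_Iic_eq_integral_Iio (x := t)]
    abel
  rw [this]
  exact continuous_const.add (intervalIntegral.continuous_primitive (fun a b => hf.intervalIntegrable) 0)

lemma Bil_eq_Wp {f g : ℝ → H} (hf : Integrable f) (hg : Integrable g) :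
    Bil f g = ∫ t, inner ℂ (Wp f t) (g t) := by
  unfold Bil
  rw [← integral_indicator measurableSet_ltset, Measure.volume_eq_prod, integral_prod_symm]
  · refine integral_congr_ae (Filter.Eventually.of_forall fun t => ?_)
    dsimp only
    have : ∀ s, Set.indicator {z : ℝ × ℝ | z.1 < z.2} (fun z => inner ℂ (f z.1) (g z.2)) (s, t) =
        (Set.Iio t).indicator (fun s => inner ℂ (f s) (g t)) s := by
      intro s
      by_cases h : s < t <;> simp [Set.indicator, h]
    simp only [this]
    rw [integral_indicator measurableSet_Iio, Wp, ← inner_conj_symm, ← integral_inner hf.integrableOn,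
      ← integral_conj]
    simp only [inner_conj_symm]
  · exact (integrable_inner_prod hf hg).indicator measurableSet_ltset

lemma ae_offdiag : ∀ᵐ z : ℝ × ℝ, z.1 ≠ z.2 := by
  have hms : MeasurableSet {z : ℝ × ℝ | z.1 ≠ z.2} :=
    (measurableSet_eq_fun measurable_fst measurable_snd).compl
  rw [Measure.volume_eq_prod, Measure.ae_prod_iff_ae_ae hms]
  refine Filter.Eventually.of_forall fun x => ?_
  have : ∀ᵐ y : ℝ, y ≠ x := Measure.ae_ne volume x
  filter_upwards [this] with y hy using hy.symm

lemma inner_int_self {h : ℝ → H} (hh : Integrable h) :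
    inner ℂ (∫ s, h s) (∫ s, h s) = Bil h h + starRingEnd ℂ (Bil h h) := by
  have hI := integrable_inner_prod hh hh
  have e : inner ℂ (∫ t, h t) (∫ t, h t) = ∫ z : ℝ × ℝ, inner ℂ (h z.1) (h z.2) := by
    rw [Measure.volume_eq_prod, integral_prod _ hI]
    simp only [integral_inner hh]
    rw [← inner_conj_symm, ← integral_inner hh, ← integral_conj]
    simp only [inner_conj_symm]
  rw [e, ← integral_add_compl measurableSet_ltset hI]
  congr 1
  unfold Bil
  rw [← integral_indicator measurableSet_ltset, ← integral_indicator measurableSet_ltset.compl,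
    ← integral_conj, Measure.volume_eq_prod, ← integral_prod_swap]
  refine integral_congr_ae ?_
  rw [← Measure.volume_eq_prod]
  filter_upwards [ae_offdiag] with z hz
  rcases lt_or_gt_of_ne hz with h1 | h1
  · simp [Set.indicator, h1, h1.le]
  · simp [Set.indicator, h1, not_lt.2 h1.le]

lemma int_sq_le_Bil {h : ℝ → H} (hh : Integrable h) : ‖∫ s, h s‖ₑ ^ 2 ≤ 2 * ‖Bil h h‖ₑ := by
  have : ‖∫ t, h t‖ₑ ^ 2 = ‖inner ℂ (∫ t, h t) (∫ t, h t)‖ₑ := by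
    rw [inner_self_eq_norm_sq_to_K]
    rw [← ofReal_norm, ← ofReal_norm, ← ENNReal.ofReal_pow (norm_nonneg _)]
    simp
  rw [this, inner_int_self hh]
  refine (enorm_add_le _ _).trans ?_
  rw [RCLike.enorm_conj, two_mul]

variable {X : Type*} [MeasurableSpace X] {μ : Measure X} {σ A : ℝ}

/-- retarded solution -/
def Us (D : Disp μ H σ A) (f : ℝ → H) (t : ℝ) : Lp ℂ 2 μ :=
  ContinuousLinearMap.adjoint (D.V t).toContinuousLinearMap (Wp f t)

lemma Us_inner (D : Disp μ H σ A) (f : ℝ → H) (t : ℝ) (φ : Lp ℂ 2 μ) :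
    inner ℂ (Us D f t) φ = inner ℂ (Wp f t) (D.V t φ) := by
  rw [Us, ContinuousLinearMap.adjoint_inner_left]; rfl

lemma Us_norm_le_Wp (D : Disp μ H σ A) (f : ℝ → H) (t : ℝ) : ‖Us D f t‖ ≤ ‖Wp f t‖ := by
  have h1 : ‖Us D f t‖ ^ 2 ≤ ‖Wp f t‖ * ‖Us D f t‖ := by
    have : ‖inner ℂ (Us D f t) (Us D f t)‖ = ‖Us D f t‖ ^ 2 := by
      rw [inner_self_eq_norm_sq_to_K]; simp
    rw [← this, Us_inner]
    refine (norm_inner_le_norm _ _).trans ?_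
    rw [LinearIsometry.norm_map]
  rcases (norm_nonneg (Us D f t)).eq_or_lt with h | h
  · rw [← h]; positivity
  · nlinarith

lemma Us_meas (D : Disp μ H σ A) {f : ℝ → H} (hf : Integrable f) (φ : Lp ℂ 2 μ) :
    Measurable fun t => inner ℂ (Us D f t) φ := by
  simp only [Us_inner]
  exact ((Wp_cont hf).inner (D.cont φ)).measurable

lemma Bil_eq_Us (D : Disp μ H σ A) {f : ℝ → H} (hf : Integrable f) {p : ℝ≥0∞} (G : Step μ p) :
    Bil f (G.V D) = ∫ t, inner ℂ (Us D f t) (G.c t • G.ψ (G.i t)) := by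
  rw [Bil_eq_Wp hf (G.int D)]
  refine integral_congr_ae (Filter.Eventually.of_forall fun t => ?_)
  dsimp only
  rw [Us_inner, Step.V, vstep, map_smul]

/-- duality for retarded solution -/
lemma Us_bound [SecondCountableTopology (Lp ℂ 2 μ)] (D : Disp μ H σ A) {f : ℝ → H} (hf : Integrable f)
    {q r q' r' : ℝ≥0∞} (hq : 2 ≤ q) (hr : 2 ≤ r) (hqq : 1/q' + 1/q = 1) (hrr : 1/r' + 1/r = 1)
    {C : ℝ≥0∞} (hC : C ≠ ∞)
    (h : ∀ G : Step μ r', ‖Bil f (G.V D)‖ₑ ≤ C * eLpNorm G.c q' volume) :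
    eLpNorm (fun t => eLpNorm (Us D f t) r μ) q volume ≤ C := by
  rw [← ENNReal.ofReal_toReal hC] at h ⊢
  refine duality (Us_meas D hf) (M := ∫ s, ‖f s‖) (fun t => (Us_norm_le_Wp D f t).trans (Wp_norm hf t))
    hq hr hqq hrr ENNReal.toReal_nonneg ?_
  intro G
  rw [← Bil_eq_Us D hf]
  exact h G

lemma holder_inner {r r' : ℝ≥0∞} (hrr : 1/r' + 1/r = 1) (u ψ : Lp ℂ 2 μ) :
    ‖inner ℂ u ψ‖ₑ ≤ eLpNorm u r μ * eLpNorm ψ r' μ := by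
  haveI : ENNReal.HolderTriple r r' 1 := ⟨by rw [inv_one, ← hrr, one_div, one_div, add_comm]⟩
  rw [L2.inner_def]
  refine (enorm_integral_le_lintegral_enorm _).trans ?_
  rw [← eLpNorm_one_eq_lintegral_enorm]
  have := eLpNorm_le_eLpNorm_mul_eLpNorm_of_nnnorm (p := r) (q := r') (r := 1)
    (Lp.aestronglyMeasurable u) (Lp.aestronglyMeasurable ψ)
    (fun a b : ℂ => inner ℂ a b) 1 (Filter.Eventually.of_forall fun x => by
      rw [one_mul]; exact nnnorm_inner_le_nnnorm _ _)
  simpa using this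

/-- converse of duality -/
lemma pairing (D : Disp μ H σ A) {f : ℝ → H} (hf : Integrable f)
    {q r q' r' : ℝ≥0∞} (hqq : 1/q' + 1/q = 1) (hrr : 1/r' + 1/r = 1) (G : Step μ r') :
    ‖Bil f (G.V D)‖ₑ ≤ eLpNorm (fun t => eLpNorm (Us D f t) r μ) q volume * eLpNorm G.c q' volume := by
  rw [Bil_eq_Us D hf]
  haveI : ENNReal.HolderTriple q' q 1 := ⟨by rw [inv_one, ← hqq, one_div, one_div]⟩
  set k : ℝ → ℂ := fun t => inner ℂ (Us D f t) (G.ψ (G.i t)) with hk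
  have hkm : Measurable k := (meas_sel G.im (fun n t => inner ℂ (Us D f t) (G.ψ n))
    (fun n => (Us_meas D hf _).stronglyMeasurable)).measurable
  have hkle : ∀ t, ‖k t‖ₑ ≤ eLpNorm (Us D f t) r μ := by
    intro t
    refine (holder_inner hrr _ _).trans ?_
    calc _ ≤ eLpNorm (Us D f t) r μ * 1 := by gcongr; exact G.unit _
      _ = _ := mul_one _
  refine (enorm_integral_le_lintegral_enorm _).trans ?_
  rw [← eLpNorm_one_eq_lintegral_enorm]
  have h1 := eLpNorm_smul_le_mul_eLpNorm (p := q') (q := q) (r := 1) (μ := volume) hkm.aestronglyMeasurable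
    G.cm.aestronglyMeasurable
  have h2 : eLpNorm k q volume ≤ eLpNorm (fun t => eLpNorm (Us D f t) r μ) q volume :=
    eLpNorm_mono_enorm (fun t => by simpa using hkle t)
  calc _ = eLpNorm (G.c • k) 1 volume := by
        congr 1; ext t; simp only [inner_smul_right]; rfl
    _ ≤ _ := h1
    _ ≤ _ := by rw [mul_comm]; gcongr

lemma energy (D : Disp μ H σ A) {α β : ℝ≥0∞} {C : ℝ} (hB : BilB D α β α β C) (F : Step μ β) (t : ℝ) :
    ‖Wp (F.V D) t‖ₑ ^ 2 ≤ 2 * (ENNReal.ofReal C * (eLpNorm F.c α volume * eLpNorm F.c α volume)) := by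
  have e : Wp (F.V D) t = ∫ s, (F.cut (Set.Iio t) measurableSet_Iio).V D s := by
    rw [Step.cut_V, integral_indicator measurableSet_Iio, Wp]
  rw [e]
  refine (int_sq_le_Bil (Step.int _ D)).trans ?_
  gcongr
  refine (hB _ _).trans ?_
  gcongr <;> apply Step.cut_norm

lemma eLpNorm_interp (f : X → ℂ) (hf : AEStronglyMeasurable f μ) {p₀ p₁ p : ℝ≥0∞} {θ : ℝ}
    (h0 : 0 < θ) (h1 : θ < 1)
    (hp : p⁻¹ = ENNReal.ofReal (1 - θ) * p₀⁻¹ + ENNReal.ofReal θ * p₁⁻¹) :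
    eLpNorm f p μ ≤ eLpNorm f p₀ μ ^ (1 - θ) * eLpNorm f p₁ μ ^ θ := by
  have h1' : 0 < 1 - θ := by linarith
  have inv : ∀ (a : ℝ≥0∞) (x : ℝ), 0 < x → (a / ENNReal.ofReal x)⁻¹ = ENNReal.ofReal x * a⁻¹ := by
    intro a x hx
    rw [ENNReal.inv_div (by simp) (by simp [hx]), ENNReal.div_eq_inv_mul, mul_comm]
  haveI : ENNReal.HolderTriple (p₀ / ENNReal.ofReal (1 - θ)) (p₁ / ENNReal.ofReal θ) p :=
    ⟨by rw [inv _ _ h1', inv _ _ h0, hp]⟩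
  have canc : ∀ (a : ℝ≥0∞) (x : ℝ), 0 < x → a / ENNReal.ofReal x * ENNReal.ofReal x = a := by
    intro a x hx
    exact ENNReal.div_mul_cancel (by simp [hx]) (by simp)
  have key := eLpNorm_smul_le_mul_eLpNorm (p := p₀ / ENNReal.ofReal (1 - θ)) (q := p₁ / ENNReal.ofReal θ)
    (r := p) (μ := μ) (f := fun x => ‖f x‖ ^ θ) (φ := fun x => ‖f x‖ ^ (1 - θ))
    (hf.norm.aemeasurable.pow_const _).aestronglyMeasurable
    (hf.norm.aemeasurable.pow_const _).aestronglyMeasurable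
  rw [eLpNorm_norm_rpow _ h1', eLpNorm_norm_rpow _ h0, canc _ _ h1', canc _ _ h0] at key
  refine le_trans (le_of_eq ?_) key
  rw [← eLpNorm_norm]
  congr 1
  ext x
  simp only [Pi.smul_apply', smul_eq_mul]
  rw [← Real.rpow_add_of_nonneg (norm_nonneg _) h1'.le h0.le]
  simp

lemma time_interp {g k : ℝ → ℝ≥0∞} {K : ℝ≥0∞} (hK : K ≠ ∞) {q p : ℝ≥0∞} {θ : ℝ} (h0 : 0 < θ)
    (hp0 : p ≠ 0) (hp : p ≠ ∞) (hq : q = p / ENNReal.ofReal θ) (hg : ∀ t, g t ≤ K * k t ^ θ) :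
    eLpNorm g q volume ≤ K * eLpNorm k p volume ^ θ := by
  have hq0 : q ≠ 0 := by rw [hq]; simp [hp0]
  have hq1 : q ≠ ∞ := by rw [hq]; exact ENNReal.div_ne_top hp (by simp [h0])
  have hqr : q.toReal = p.toReal / θ := by rw [hq, ENNReal.toReal_div, ENNReal.toReal_ofReal h0.le]
  have hpp : 0 < p.toReal := ENNReal.toReal_pos hp0 hp
  have hqp : 0 < q.toReal := ENNReal.toReal_pos hq0 hq1
  have hqθ : θ * q.toReal = p.toReal := by rw [hqr]; field_simp
  rw [eLpNorm_eq_lintegral_rpow_enorm_toReal hq0 hq1, eLpNorm_eq_lintegral_rpow_enorm_toReal hp0 hp]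
  simp only [enorm_eq_self]
  calc _ ≤ (∫⁻ t, K ^ q.toReal * k t ^ p.toReal) ^ (1 / q.toReal) := by
        gcongr with t
        calc _ ≤ (K * k t ^ θ) ^ q.toReal := by gcongr; exact hg t
          _ = _ := by rw [ENNReal.mul_rpow_of_nonneg _ _ hqp.le, ← ENNReal.rpow_mul, hqθ]
    _ = _ := by
        rw [lintegral_const_mul' _ _ (ENNReal.rpow_ne_top_of_nonneg hqp.le hK),
          ENNReal.mul_rpow_of_nonneg _ _ (by positivity), ← ENNReal.rpow_mul, ← ENNReal.rpow_mul,
          mul_one_div_cancel hqp.ne', ENNReal.rpow_one, hqr]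
        congr 2
        field_simp
end

end

section

/-- exponent with given reciprocal -/
def ex (x : ℝ) : ℝ≥0∞ := (ENNReal.ofReal x)⁻¹

lemma ex_one : ex 1 = 1 := by simp [ex]
lemma ex_half : ex (1/2) = 2 := by
  rw [ex, one_div, ENNReal.ofReal_inv_of_pos (by norm_num)]; simp
lemma ex_half' : ex (1 - 1/2) = 2 := by
  rw [← ex_half]; norm_num
lemma ex_of_pos {x : ℝ} (hx : 0 < x) : ex x = ENNReal.ofReal (1/x) := by
  rw [ex, one_div, ENNReal.ofReal_inv_of_pos hx]
lemma two_le_ex {x : ℝ} (hx : x ≤ 1/2) : 2 ≤ ex x := by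
  rw [← ex_half, ex, ex]
  exact ENNReal.inv_le_inv.2 (ENNReal.ofReal_le_ofReal hx)
lemma one_le_ex {x : ℝ} (hx : x ≤ 1) : 1 ≤ ex x := by
  rw [← ex_one, ex, ex]
  exact ENNReal.inv_le_inv.2 (ENNReal.ofReal_le_ofReal hx)
lemma ex_conj {x : ℝ} (h0 : 0 ≤ x) (h1 : x ≤ 1) : 1 / ex (1 - x) + 1 / ex x = 1 := by
  rw [one_div, one_div, ex, ex, inv_inv, inv_inv, ← ENNReal.ofReal_add (by linarith) h0]
  simp

section
variable {H : Type*} [NormedAddCommGroup H] [InnerProductSpace ℂ H] [CompleteSpace H]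
variable {X : Type*} [MeasurableSpace X] {μ : Measure X} {σ A : ℝ}

/-- admissible points -/
structure Adm (σ x y : ℝ) : Prop where
  x0 : 0 ≤ x
  x1 : x ≤ 1/2
  y0 : 0 ≤ y
  y1 : y ≤ 1/2
  eq : x = σ * (1/2 - y)
  ne : ¬ (σ = 1 ∧ x = 1/2)

lemma lint_le_one {p : ℝ} (hp : 0 < p) {f : X → ℂ} (h : eLpNorm f (ENNReal.ofReal p) μ ≤ 1) :
    ∫⁻ x, ‖f x‖ₑ ^ p ∂μ ≤ 1 := by
  rw [eLpNorm_eq_lintegral_rpow_enorm_toReal (by positivity) (by simp), ENNReal.toReal_ofReal hp.le] at h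
  by_contra h'
  rw [not_le] at h'
  exact absurd h (not_le.2 (ENNReal.one_lt_rpow h' (by positivity)))

lemma diag (D : Disp μ H σ A) {x y : ℝ} (h : Adm σ x y) :
    ∃ C : ℝ, 0 ≤ C ∧ BilB D (ex (1 - x)) (ex (1 - y)) (ex (1 - x)) (ex (1 - y)) C := by
  have hσ := D.hσ
  have hA := D.hA
  have hxy := h.eq
  rcases h.x0.eq_or_lt with hx0 | hx0
  · have hy : y = 1/2 := by
      rw [← hx0] at hxy
      rcases mul_eq_zero.1 hxy.symm with h1 | h1 <;> linarith
    subst hy; subst hx0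
    refine ⟨1, zero_le_one, ?_⟩
    rw [ex_half', sub_zero, ex_one]
    exact D1 D
  have hy2 : y < 1/2 := by
    by_contra hh
    have : y = 1/2 := le_antisymm h.y1 (not_lt.1 hh)
    rw [this] at hxy; simp at hxy; linarith
  rcases h.x1.eq_or_lt with hx1 | hx1
  · have hσ1 : 1 ≤ σ := by
      have := h.y0
      nlinarith
    have hσ2 : 1 < σ := lt_of_le_of_ne hσ1 (fun e => h.ne ⟨e.symm, hx1⟩)
    have hy1 : 0 < 1 - y := by linarith
    subst hx1
    refine ⟨Cpair σ A * Cgeo (cpair σ) * 128, ?_, ?_⟩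
    rotate_left
    · rw [ex_half', ex_of_pos hy1]
      refine D3 D hσ2 ?_
      rw [one_div_one_div]
      field_simp
      linarith
    · have := Cgeo_nonneg (cpair σ)
      have h2 : 0 < σ - 1 := by linarith
      unfold Cpair; positivity
  · have hx1' : 0 < 1 - x := by linarith
    have hy1 : 0 < 1 - y := by linarith
    have hα1 : 1 < 1 / (1 - x) := by rw [lt_div_iff₀ hx1']; linarith
    have hα2 : 1 / (1 - x) < 2 := by rw [div_lt_iff₀ hx1']; linarith
    have e1 : 2 - 2 / (1 / (1 - x)) = 2 * x := by field_simp; ring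
    have e2 : 2 / (1 / (1 - x)) - 1 = 1 - 2 * x := by field_simp; ring
    have hpos : 0 < 1 - 2 * x := by linarith
    rw [ex_of_pos hx1', ex_of_pos hy1]
    rcases h.y0.eq_or_lt with hy0 | hy0
    · refine ⟨_, ?_, D2 D hα1 hα2 (C := A) hA.le ?_⟩
      · rw [e2]; positivity
      · intro f g hf hg hf1 hg1 s t hst
        rw [← hy0] at hf1 hg1
        simp only [sub_zero, div_one, ENNReal.ofReal_one] at hf1 hg1
        rw [e1]
        have e3 : 2 * x = σ := by rw [hxy, ← hy0]; ring
        rw [e3]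
        refine norm_le_of_enorm (by positivity) ((D.disp s t f g hst).trans ?_)
        calc _ ≤ ENNReal.ofReal (A * |t - s| ^ (-σ)) * 1 * 1 := by gcongr
          _ = _ := by simp
    · have hp1 : 1 < 1 / (1 - y) := by rw [lt_div_iff₀ hy1]; linarith
      have hp2 : 1 / (1 - y) < 2 := by rw [div_lt_iff₀ hy1]; linarith
      refine ⟨_, ?_, D2 D hα1 hα2
        (C := 128 * Cgeo (min (1/(1 / (1 - y)) - 1/2) (1 - 1/(1 / (1 - y)))) * A ^ (2 * (1 / (1 / (1 - y)) - 1/2))) ?_ ?_⟩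
      · have := Cgeo_nonneg (min (1/(1 / (1 - y)) - 1/2) (1 - 1/(1 / (1 - y))))
        rw [e2]; positivity
      · have := Cgeo_nonneg (min (1/(1 / (1 - y)) - 1/2) (1 - 1/(1 / (1 - y))))
        positivity
      · intro f g hf hg hf1 hg1 s t hst
        refine (fixed_time D hp1 hp2 hf hg (lint_le_one (by positivity) hf1) (lint_le_one (by positivity) hg1) hst).trans (le_of_eq ?_)
        rw [e1, mul_assoc, mul_assoc (128 * _)]
        rw [Real.mul_rpow hA.le (by positivity), ← Real.rpow_mul (abs_nonneg _)]
        rw [mul_assoc]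
        congr 4
        rw [one_div_one_div, hxy]; ring

lemma caseA [SecondCountableTopology (Lp ℂ 2 μ)] (D : Disp μ H σ A) {x₁ y₁ x y : ℝ} (h₁ : Adm σ x₁ y₁)
    (h : Adm σ x y) (hx : x ≤ x₁) :
    ∃ C : ℝ, 0 ≤ C ∧ BilB D (ex (1 - x₁)) (ex (1 - y₁)) (ex (1 - x)) (ex (1 - y)) C := by
  have hσ := D.hσ
  obtain ⟨C, hC, hB⟩ := diag D h₁
  rcases hx.eq_or_lt with he | hlt
  · have : y = y₁ := by
      have h1 := h.eq; have h2 := h₁.eq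
      rw [he, h2] at h1
      have := mul_left_cancel₀ hσ.ne' h1
      linarith
    subst he; subst this
    exact ⟨C, hC, hB⟩
  have hx₁ : 0 < x₁ := h.x0.trans_lt hlt
  set K : ℝ≥0∞ := (2 * ENNReal.ofReal C) ^ (1/2 : ℝ) with hK
  have hKt : K ≠ ∞ := ENNReal.rpow_ne_top_of_nonneg (by norm_num) (ENNReal.mul_ne_top (by simp) (by simp))
  have hen : ∀ (F : Step μ (ex (1 - y₁))) t, ‖Us D (F.V D) t‖ₑ ≤ K * eLpNorm F.c (ex (1 - x₁)) volume := by
    intro F t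
    have h1 := energy D hB F t
    have h2 : ‖Us D (F.V D) t‖ₑ ≤ ‖Wp (F.V D) t‖ₑ := by
      rw [← ofReal_norm, ← ofReal_norm]; exact ENNReal.ofReal_le_ofReal (Us_norm_le_Wp _ _ _)
    refine h2.trans ?_
    have h3 : ‖Wp (F.V D) t‖ₑ = (‖Wp (F.V D) t‖ₑ ^ 2) ^ (1/2 : ℝ) := by
      rw [← ENNReal.rpow_natCast, ← ENNReal.rpow_mul]; norm_num
    have h4 : eLpNorm F.c (ex (1 - x₁)) volume = ((eLpNorm F.c (ex (1 - x₁)) volume) ^ 2) ^ (1/2 : ℝ) := by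
      rw [← ENNReal.rpow_natCast, ← ENNReal.rpow_mul]; norm_num
    rw [h3, h4, hK, ← ENNReal.mul_rpow_of_nonneg _ _ (by norm_num)]
    gcongr
    refine h1.trans (le_of_eq ?_)
    ring
  have hno : ∀ (F : Step μ (ex (1 - y₁))), eLpNorm F.c (ex (1 - x₁)) volume ≠ ∞ :=
    fun F => F.finite _ (one_le_ex (by linarith))
  rcases h.x0.eq_or_lt with hx0 | hx0
  · have hy : y = 1/2 := by
      have hxy := h.eq
      rw [← hx0] at hxy
      rcases mul_eq_zero.1 hxy.symm with h1 | h1 <;> linarith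
    subst hy; subst hx0
    refine ⟨K.toReal, ENNReal.toReal_nonneg, ?_⟩
    intro F G
    rw [ENNReal.ofReal_toReal hKt]
    refine (pairing D (F.int D) (q := ∞) (r := 2) (q' := ex (1 - 0)) (by rw [sub_zero, ex_one]; simp)
      (by rw [ex_half']; simp [ENNReal.inv_two_add_inv_two]) G).trans ?_
    rw [← mul_assoc]
    gcongr
    rw [eLpNorm_exponent_top, eLpNormEssSup]
    refine essSup_le_of_ae_le _ (Filter.Eventually.of_forall fun t => ?_)
    simpa [Lp.enorm_def] using hen F t
  · set θ := x / x₁ with hθ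
    have hθ0 : 0 < θ := by positivity
    have hθ1 : θ < 1 := by rw [hθ, div_lt_one hx₁]; exact hlt
    have hθx : θ * x₁ = x := by rw [hθ]; field_simp
    have hy : y = (1 - θ) * (1/2) + θ * y₁ := by
      have h1 := h.eq; have h2 := h₁.eq
      rw [← hθx, h2] at h1
      have : θ * (1/2 - y₁) = 1/2 - y := mul_left_cancel₀ hσ.ne' (by linarith)
      linarith
    set B : ℝ≥0∞ := K ^ (1 - θ) * ENNReal.ofReal C ^ θ with hBdef
    have hBt : B ≠ ∞ := ENNReal.mul_ne_top (ENNReal.rpow_ne_top_of_nonneg (by linarith) hKt)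
      (ENNReal.rpow_ne_top_of_nonneg hθ0.le (by simp))
    refine ⟨B.toReal, ENNReal.toReal_nonneg, ?_⟩
    intro F G
    rw [ENNReal.ofReal_toReal hBt]
    refine (pairing D (F.int D) (q := ex x) (r := ex y) (ex_conj h.x0 (by linarith [h.x1]))
      (ex_conj h.y0 (by linarith [h.y1])) G).trans ?_
    rw [← mul_assoc]
    gcongr
    set N := eLpNorm F.c (ex (1 - x₁)) volume with hN
    have hNt : N ≠ ∞ := hno F
    have hu1 : eLpNorm (fun t => eLpNorm (Us D (F.V D) t) (ex y₁) μ) (ex x₁) volume ≤ ENNReal.ofReal C * N := by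
      refine Us_bound D (F.int D) (two_le_ex h₁.x1) (two_le_ex h₁.y1) (ex_conj h₁.x0 (by linarith [h₁.x1]))
        (ex_conj h₁.y0 (by linarith [h₁.y1])) (ENNReal.mul_ne_top (by simp) hNt) ?_
      intro G
      rw [mul_assoc]
      exact hB F G
    have hpt : ∀ t, eLpNorm (Us D (F.V D) t) (ex y) μ ≤ (K * N) ^ (1 - θ) * eLpNorm (Us D (F.V D) t) (ex y₁) μ ^ θ := by
      intro t
      refine (eLpNorm_interp _ (Lp.aestronglyMeasurable _) (p₀ := 2) (p₁ := ex y₁) hθ0 hθ1 ?_).trans ?_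
      · rw [ex, ex, inv_inv, inv_inv, ← ENNReal.ofReal_mul hθ0.le, ← ex_half, ex, inv_inv,
          ← ENNReal.ofReal_mul (by linarith), ← ENNReal.ofReal_add, ← hy]
        · have : 0 < 1 - θ := by linarith
          positivity
        · exact mul_nonneg hθ0.le h₁.y0
      · gcongr
        · rw [← Lp.enorm_def]; exact hen F t
    have hx₁' : ex x₁ ≠ 0 := by simp [ex]
    refine (time_interp (ENNReal.rpow_ne_top_of_nonneg (by linarith) (ENNReal.mul_ne_top hKt hNt)) hθ0
      hx₁' (by simp [ex, hx₁]) ?_ hpt).trans ?_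
    · rw [ex, ex, hθ, ENNReal.ofReal_div_of_pos hx₁]
      have h1 : ENNReal.ofReal x₁ ≠ 0 := by simp [hx₁]
      rw [ENNReal.div_eq_inv_mul, ENNReal.inv_div (by simp) (by simp [hx₁]), mul_comm,
        ENNReal.div_eq_inv_mul, mul_left_comm, ENNReal.inv_mul_cancel h1 (by simp), mul_one]
    · calc _ ≤ (K * N) ^ (1 - θ) * (ENNReal.ofReal C * N) ^ θ := by gcongr
        _ = B * (N ^ (1 - θ) * N ^ θ) := by
          rw [ENNReal.mul_rpow_of_nonneg _ _ (by linarith), ENNReal.mul_rpow_of_nonneg _ _ hθ0.le, hBdef]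
          ring
        _ = B * N := by
          rw [← ENNReal.rpow_add_of_nonneg _ _ (by linarith) hθ0.le]; simp

lemma Step.rev_V {p : ℝ≥0∞} (F : Step μ p) (D : Disp μ H σ A) :
    (fun t => F.V D (-t)) = F.rev.V D.rev := by
  ext t; rfl

lemma general [SecondCountableTopology (Lp ℂ 2 μ)] (D : Disp μ H σ A) {x₁ y₁ x y : ℝ} (h₁ : Adm σ x₁ y₁)
    (h : Adm σ x y) :
    ∃ C : ℝ, 0 ≤ C ∧ BilB D (ex (1 - x₁)) (ex (1 - y₁)) (ex (1 - x)) (ex (1 - y)) C := by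
  rcases le_total x x₁ with hx | hx
  · exact caseA D h₁ h hx
  · obtain ⟨C, hC, hB⟩ := caseA D.rev h h₁ hx
    refine ⟨C, hC, fun F G => ?_⟩
    rw [Bil_reverse, RCLike.enorm_conj, Step.rev_V, Step.rev_V]
    refine (hB _ _).trans ?_
    rw [Step.rev_norm, Step.rev_norm, mul_comm (eLpNorm G.c _ _)]
end

end

section

section
variable {E : Type*} [NormedAddCommGroup E] [InnerProductSpace ℝ E] [FiniteDimensional ℝ E]
  [MeasurableSpace E] [BorelSpace E]

lemma fourier_bdd (f : E → ℂ) (ξ : E) : ‖𝓕 f ξ‖ ≤ ∫ x, ‖f x‖ := by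
  rw [Real.fourier_eq]
  refine (norm_integral_le_integral_norm _).trans (le_of_eq ?_)
  simp

lemma fourier_continuous {f : E → ℂ} (hf : Integrable f) : Continuous (𝓕 f) :=
  VectorFourier.fourierIntegral_continuous Real.continuous_fourierChar
    (L := innerₗ E) continuous_inner hf

lemma fourier_flip {f g : E → ℂ} (hf : Integrable f) (hg : Integrable g) :
    ∫ ξ, 𝓕 f ξ * g ξ = ∫ x, f x * 𝓕 g x := by
  simpa using! (VectorFourier.integral_fourierIntegral_smul_eq_flip (L := innerₗ E)
      Real.continuous_fourierChar continuous_inner hf hg)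

lemma fourier_ae (f : Lp ℂ 2 (volume : Measure E)) (hf : Integrable f) :
    ((𝓕 f : Lp ℂ 2 (volume : Measure E)) : E → ℂ) =ᵐ[volume] 𝓕 (f : E → ℂ) := by
  apply ae_eq_of_integral_contDiff_smul_eq
  · exact (Lp.memLp _).locallyIntegrable (by norm_num)
  · exact (fourier_continuous hf).locallyIntegrable
  intro g g_smooth g_cpt
  have hg₁ : HasCompactSupport (Complex.ofRealCLM ∘ g) := g_cpt.comp_left rfl
  have hg₂ : ContDiff ℝ (⊤ : ℕ∞) (Complex.ofRealCLM ∘ g) := by fun_prop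
  let G : SchwartzMap E ℂ := hg₁.toSchwartzMap hg₂
  have hG : ∀ x, G x = (g x : ℂ) := fun x => by simp [G]
  have h1 : ∫ x, g x • (𝓕 f : Lp ℂ 2 (volume : Measure E)) x =
      ((𝓕 f : Lp ℂ 2 (volume : Measure E)) : TemperedDistribution E ℂ) G := by
    rw [Lp.toTemperedDistribution_apply]
    simp [hG]
  rw [h1, ← Lp.fourier_toTemperedDistribution_eq, TemperedDistribution.fourier_apply,
    Lp.toTemperedDistribution_apply]
  have h2 := fourier_flip hf (G.integrable (μ := volume))
  have hG' : (G : E → ℂ) = fun x => (g x : ℂ) := funext hG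
  have h3 : ∀ x, (𝓕 G : SchwartzMap E ℂ) x = 𝓕 (G : E → ℂ) x := fun x => by
    rw [SchwartzMap.fourier_coe]
  simp only [h3, smul_eq_mul, Complex.real_smul]
  rw [hG'] at h2 ⊢
  rw [integral_congr_ae (g := fun x => f x * 𝓕 (fun x => (g x : ℂ)) x)
    (.of_forall fun x => mul_comm _ _), ← h2]
  exact integral_congr_ae (.of_forall fun x => mul_comm _ _)

/-- Gaussian regularized kernel operator -/
def gk (z : ℂ) (φ : E → ℂ) (x : E) : ℂ :=
  ∫ y, φ y * ((Real.pi / z) ^ (Module.finrank ℝ E / 2 : ℂ) *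
    cexp (-Real.pi ^ 2 * ‖x - y‖ ^ 2 / z))

lemma gauss_int {z : ℂ} (hz : 0 < z.re) : Integrable fun ξ : E => cexp (-z * ‖ξ‖ ^ 2) := by
  simpa using GaussianFourier.integrable_cexp_neg_mul_sq_norm_add hz 0 (0 : E)

lemma core_eps {g φ : E → ℂ} (hg : Integrable g) (hφ : Integrable φ) {z : ℂ} (hz : 0 < z.re) :
    ∫ ξ, starRingEnd ℂ (𝓕 g ξ) * (𝓕 φ ξ * cexp (-z * ‖ξ‖ ^ 2)) =
      ∫ x, starRingEnd ℂ (g x) * gk z φ x := by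
  have hh : Integrable fun ξ : E => 𝓕 φ ξ * cexp (-z * ‖ξ‖ ^ 2) :=
    (gauss_int hz).bdd_mul (fourier_continuous hφ).aestronglyMeasurable
      (.of_forall (fourier_bdd φ))
  have hh' : Integrable fun ξ : E => starRingEnd ℂ (𝓕 φ ξ * cexp (-z * ‖ξ‖ ^ 2)) :=
    hh.congr' (Complex.continuous_conj.comp_aestronglyMeasurable hh.1) (by simp)
  have h1 := congrArg (starRingEnd ℂ) (fourier_flip hg hh')
  rw [← integral_conj, ← integral_conj] at h1
  simp only [map_mul, Complex.conj_conj] at h1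
  rw [h1]
  refine integral_congr_ae (.of_forall fun x => ?_)
  simp only
  congr 1
  rw [Real.fourier_eq', ← integral_conj]
  have h2 : ∀ v : E, starRingEnd ℂ (cexp (↑(-2 * Real.pi * inner ℝ v x) * I) •
      (starRingEnd ℂ (𝓕 φ v) * starRingEnd ℂ (cexp (-z * ‖v‖ ^ 2)))) =
      𝓕 φ v * cexp (-z * ‖v‖ ^ 2 + 2 * Real.pi * I * (inner ℝ x v : ℝ)) := by
    intro v
    rw [smul_eq_mul, map_mul, map_mul, Complex.conj_conj, Complex.conj_conj, ← Complex.exp_conj,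
      Complex.exp_add, real_inner_comm]
    simp only [map_mul, Complex.conj_ofReal, Complex.conj_I]
    rw [mul_left_comm, mul_comm (cexp _) (cexp _)]
    congr 3
    push_cast
    ring
  simp only [h2]
  rw [fourier_flip hφ (GaussianFourier.integrable_cexp_neg_mul_sq_norm_add hz _ _)]
  simp only [fourier_gaussian_innerProductSpace' hz, gk]
end

end

section

section
variable {E : Type*} [NormedAddCommGroup E] [InnerProductSpace ℝ E] [FiniteDimensional ℝ E]
  [MeasurableSpace E] [BorelSpace E]

/-- the Gaussian kernel -/
def gker (z : ℂ) (x y : E) : ℂ := (Real.pi / z) ^ (Module.finrank ℝ E / 2 : ℂ) *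
    cexp (-Real.pi ^ 2 * ‖x - y‖ ^ 2 / z)

lemma gk_eq (z : ℂ) (φ : E → ℂ) (x : E) : gk z φ x = ∫ y, φ y * gker z x y := rfl

lemma gker_norm {z : ℂ} (hz : 0 ≤ z.re) (hz0 : z ≠ 0) (x y : E) :
    ‖gker z x y‖ ≤ (Real.pi / ‖z‖) ^ (Module.finrank ℝ E / 2 : ℝ) := by
  have h1 : ‖(Real.pi / z : ℂ) ^ (Module.finrank ℝ E / 2 : ℂ)‖ =
      (Real.pi / ‖z‖) ^ (Module.finrank ℝ E / 2 : ℝ) := by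
    have : (Module.finrank ℝ E / 2 : ℂ) = ((Module.finrank ℝ E / 2 : ℝ) : ℂ) := by push_cast; rfl
    rw [this, Complex.norm_cpow_real, norm_div, Complex.norm_real, Real.norm_of_nonneg Real.pi_pos.le]
  have h2 : ‖cexp (-Real.pi ^ 2 * ‖x - y‖ ^ 2 / z)‖ ≤ 1 := by
    rw [Complex.norm_exp, Real.exp_le_one_iff]
    have : (-Real.pi ^ 2 * ‖x - y‖ ^ 2 / z : ℂ) = ((-(Real.pi ^ 2 * ‖x - y‖ ^ 2) : ℝ) : ℂ) * z⁻¹ := by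
      push_cast; ring
    rw [this, Complex.re_ofReal_mul, Complex.inv_re]
    have : 0 ≤ z.re / normSq z := div_nonneg hz (normSq_nonneg _)
    have : 0 ≤ Real.pi ^ 2 * ‖x - y‖ ^ 2 := by positivity
    nlinarith
  rw [gker, norm_mul, h1]
  exact mul_le_of_le_one_right (by positivity) h2

lemma gker_cont (z : ℂ) : Continuous fun p : E × E => gker z p.1 p.2 := by
  unfold gker
  fun_prop

lemma gker_cont_z {z : ℂ} (hz : z.im ≠ 0) (x y : E) :
    ContinuousAt (fun z => gker z x y) z := by
  unfold gker
  have hz0 : z ≠ 0 := by rintro rfl; simp at hz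
  refine ContinuousAt.mul ?_ ?_
  · refine ContinuousAt.cpow (continuousAt_const.div continuousAt_id hz0) continuousAt_const ?_
    right
    rw [div_eq_mul_inv, Complex.im_ofReal_mul, Complex.inv_im]
    have := Real.pi_pos
    have := (normSq_pos.2 hz0)
    simp only [ne_eq, mul_eq_zero, div_eq_zero_iff, not_or, neg_eq_zero]
    exact ⟨by positivity, hz, this.ne'⟩
  · exact (continuousAt_const.div continuousAt_id hz0).cexp

lemma gk_norm {z : ℂ} (hz : 0 ≤ z.re) (hz0 : z ≠ 0) {φ : E → ℂ} (hφ : Integrable φ) (x : E) :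
    ‖gk z φ x‖ ≤ (Real.pi / ‖z‖) ^ (Module.finrank ℝ E / 2 : ℝ) * ∫ y, ‖φ y‖ := by
  rw [gk_eq, ← integral_const_mul]
  refine norm_integral_le_of_norm_le (hφ.norm.const_mul _) (.of_forall fun y => ?_)
  rw [norm_mul, mul_comm]
  gcongr
  exact gker_norm hz hz0 x y

lemma gk_meas {φ : E → ℂ} (hφ : AEStronglyMeasurable φ) (z : ℂ) : AEStronglyMeasurable (gk z φ) := by
  have : AEStronglyMeasurable (fun p : E × E => φ p.2 * gker z p.1 p.2) (volume.prod volume) :=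
    (hφ.comp_snd).mul (gker_cont z).aestronglyMeasurable
  exact this.integral_prod_right'

lemma core_lim {g φ : E → ℂ} (hg : Integrable g) (hφ : Integrable φ)
    (hI : Integrable fun ξ => starRingEnd ℂ (𝓕 g ξ) * 𝓕 φ ξ) {τ : ℝ} (hτ : τ ≠ 0) :
    ∫ ξ, starRingEnd ℂ (𝓕 g ξ) * (𝓕 φ ξ * cexp (-(τ * I) * ‖ξ‖ ^ 2)) =
      ∫ x, starRingEnd ℂ (g x) * gk (τ * I) φ x := by
  let z : ℕ → ℂ := fun n => ((1 / ((n : ℝ) + 1) : ℝ) : ℂ) + τ * I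
  have hzl : Filter.Tendsto z Filter.atTop (nhds (τ * I)) := by
    have : Filter.Tendsto (fun n : ℕ => ((1 / ((n : ℝ) + 1) : ℝ) : ℂ)) Filter.atTop (nhds ((0:ℝ):ℂ)) :=
      (Complex.continuous_ofReal.tendsto 0).comp tendsto_one_div_add_atTop_nhds_zero_nat
    simpa [z] using this.add_const (τ * I : ℂ)
  have hzre : ∀ n, 0 < (z n).re := fun n => by
    simp only [z]
    rw [add_re, ofReal_re]
    simp only [mul_re, ofReal_re, I_re, mul_zero, ofReal_im, I_im, zero_mul, sub_self, add_zero]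
    positivity
  have hzim : ∀ n, (z n).im = τ := fun n => by
    simp only [z]; rw [add_im, ofReal_im]; simp
  have hz0 : ∀ n, z n ≠ 0 := fun n h => by
    have := hzim n; rw [h] at this; exact hτ (by simpa using this.symm)
  have hzn : ∀ n, |τ| ≤ ‖z n‖ := fun n => by
    rw [← hzim n]; exact Complex.abs_im_le_norm _
  have hτ' : 0 < |τ| := abs_pos.2 hτ
  have hpi := Real.pi_pos
  have h0im : ((τ : ℂ) * I).im ≠ 0 := by simpa
  have hφm := (fourier_continuous hφ)
  have hgm := (fourier_continuous hg)
  refine tendsto_nhds_unique (f := fun n => ∫ ξ, starRingEnd ℂ (𝓕 g ξ) * (𝓕 φ ξ * cexp (-z n * ‖ξ‖ ^ 2)))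
    (l := Filter.atTop) ?_ ?_
  · refine tendsto_integral_of_dominated_convergence _ (fun n => ?_) hI.norm
      (fun n => .of_forall fun ξ => ?_) (.of_forall fun ξ => ?_)
    · refine Continuous.aestronglyMeasurable ?_
      have := Complex.continuous_conj
      fun_prop
    · rw [← mul_assoc, norm_mul]
      refine mul_le_of_le_one_right (norm_nonneg _) ?_
      rw [Complex.norm_exp, Real.exp_le_one_iff]
      have : (-z n * ‖ξ‖ ^ 2 : ℂ) = ((-(‖ξ‖ ^ 2) : ℝ) : ℂ) * z n := by push_cast; ring
      rw [this, Complex.re_ofReal_mul]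
      have := hzre n
      nlinarith [sq_nonneg ‖ξ‖]
    · exact (((hzl.neg.mul_const _).cexp).const_mul _).const_mul _
  · simp only [core_eps hg hφ (hzre _)]
    refine tendsto_integral_of_dominated_convergence
      (fun x => ‖g x‖ * ((Real.pi / |τ|) ^ (Module.finrank ℝ E / 2 : ℝ) * ∫ y, ‖φ y‖)) (fun n => ?_)
      (hg.norm.mul_const _) (fun n => .of_forall fun x => ?_) (.of_forall fun x => ?_)
    · exact (Complex.continuous_conj.comp_aestronglyMeasurable hg.1).mul (gk_meas hφ.1 _)
    · rw [norm_mul, RCLike.norm_conj]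
      gcongr
      refine (gk_norm (hzre n).le (hz0 n) hφ x).trans ?_
      gcongr
      exact hzn n
    · refine Filter.Tendsto.const_mul _ ?_
      simp only [gk_eq]
      refine tendsto_integral_of_dominated_convergence
        (fun y => ‖φ y‖ * ((Real.pi / |τ|) ^ (Module.finrank ℝ E / 2 : ℝ))) (fun n => ?_)
        (hφ.norm.mul_const _) (fun n => .of_forall fun y => ?_) (.of_forall fun y => ?_)
      · exact hφ.1.mul ((gker_cont _).comp (by fun_prop : Continuous fun y => (x, y))).aestronglyMeasurable
      · rw [norm_mul]
        gcongr
        refine (gker_norm (hzre n).le (hz0 n) x y).trans ?_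
        gcongr
        exact hzn n
      · exact ((gker_cont_z h0im x y).tendsto.comp hzl).const_mul _
end

lemma schrod_eq_gk (d : ℕ) {τ : ℝ} (hτ : τ ≠ 0) (φ : EuclideanSpace ℝ (Fin d) → ℂ) (x) :
    schrod d τ φ x = gk (((4 * Real.pi ^ 2 * τ : ℝ) : ℂ) * I) φ x := by
  rw [schrod, gk, ← integral_const_mul]
  refine integral_congr_ae (.of_forall fun y => ?_)
  have hpi : (Real.pi : ℂ) ≠ 0 := by exact_mod_cast Real.pi_ne_zero
  have hτ' : (τ : ℂ) ≠ 0 := by exact_mod_cast hτ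
  have h1 : (Real.pi / (((4 * Real.pi ^ 2 * τ : ℝ) : ℂ) * I) : ℂ) =
      (((4 * Real.pi * τ : ℝ) : ℂ) * I)⁻¹ := by
    push_cast
    field_simp
  have h2 : (((4 * Real.pi * τ : ℝ) : ℂ) * I).arg ≠ Real.pi := by
    intro h
    have := Complex.arg_eq_pi_iff.1 h
    simp at this
  have h3 : (I * ((‖x - y‖ : ℝ) : ℂ) ^ 2 / ((4 * τ : ℝ) : ℂ)) =
      -Real.pi ^ 2 * ‖x - y‖ ^ 2 / (((4 * Real.pi ^ 2 * τ : ℝ) : ℂ) * I) := by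
    push_cast
    field_simp
    rw [I_sq]; ring
  simp only
  rw [h1, Complex.inv_cpow _ _ h2, ← Complex.cpow_neg, h3]
  simp only [finrank_euclideanSpace, Fintype.card_fin, neg_div]
  ring

end

section

section
variable {E : Type*} [NormedAddCommGroup E] [InnerProductSpace ℝ E] [FiniteDimensional ℝ E]
  [MeasurableSpace E] [BorelSpace E]

/-- the Schrödinger phase -/
def ph (t : ℝ) (ξ : E) : ℂ := cexp (((4 * Real.pi ^ 2 * t * ‖ξ‖ ^ 2 : ℝ) : ℂ) * I)

lemma ph_norm (t : ℝ) (ξ : E) : ‖ph t ξ‖ = 1 := Complex.norm_exp_ofReal_mul_I _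

lemma ph_cont (t : ℝ) : Continuous (ph t : E → ℂ) := by unfold ph; fun_prop

lemma ph_cont_t (ξ : E) : Continuous fun t => ph t ξ := by unfold ph; fun_prop

lemma ph_conj (s t : ℝ) (ξ : E) : starRingEnd ℂ (ph t ξ) * ph s ξ = ph (s - t) ξ := by
  unfold ph
  rw [← Complex.exp_conj, ← Complex.exp_add]
  simp only [map_mul, conj_ofReal, conj_I]
  congr 1
  push_cast
  ring

lemma ph_memLp (t : ℝ) (f : Lp ℂ 2 (volume : Measure E)) :
    MemLp (fun ξ => ph t ξ * f ξ) 2 volume :=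
  (Lp.memLp f).congr_norm ((ph_cont t).aestronglyMeasurable.mul (Lp.aestronglyMeasurable f))
    (.of_forall fun ξ => by simp [ph_norm])

/-- multiplication by the phase -/
def phU (t : ℝ) : Lp ℂ 2 (volume : Measure E) →ₗᵢ[ℂ] Lp ℂ 2 (volume : Measure E) where
  toFun f := (ph_memLp t f).toLp _
  map_add' f g := by
    refine Lp.ext ?_
    filter_upwards [(ph_memLp t f).coeFn_toLp, (ph_memLp t g).coeFn_toLp,
      (ph_memLp t (f + g)).coeFn_toLp, Lp.coeFn_add f g,
      Lp.coeFn_add ((ph_memLp t f).toLp _) ((ph_memLp t g).toLp _)] with ξ h1 h2 h3 h4 h5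
    rw [h3, h5, Pi.add_apply, h1, h2, h4, Pi.add_apply, mul_add]
  map_smul' c f := by
    refine Lp.ext ?_
    filter_upwards [(ph_memLp t f).coeFn_toLp,
      (ph_memLp t (c • f)).coeFn_toLp, Lp.coeFn_smul c f,
      Lp.coeFn_smul c ((ph_memLp t f).toLp _)] with ξ h1 h3 h4 h5
    rw [h3, RingHom.id_apply, h5, Pi.smul_apply, h1, h4, Pi.smul_apply, smul_eq_mul, smul_eq_mul]
    ring
  norm_map' f := by
    simp only [LinearMap.coe_mk, AddHom.coe_mk]
    rw [Lp.norm_toLp, Lp.norm_def]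
    congr 1
    exact eLpNorm_congr_norm_ae (.of_forall fun ξ => by simp [ph_norm])

lemma phU_ae (t : ℝ) (f : Lp ℂ 2 (volume : Measure E)) :
    phU t f =ᵐ[volume] fun ξ => ph t ξ * f ξ := (ph_memLp t f).coeFn_toLp

lemma phU_inner (s t : ℝ) (f g : Lp ℂ 2 (volume : Measure E)) :
    inner ℂ (phU t f) (phU s g) = ∫ ξ, starRingEnd ℂ (f ξ) * (g ξ * ph (s - t) ξ) := by
  rw [L2.inner_def]
  refine integral_congr_ae ?_
  filter_upwards [phU_ae t f, phU_ae s g] with ξ h1 h2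
  rw [h1, h2, RCLike.inner_apply, map_mul, ← ph_conj]
  ring

lemma conj_mul_int (f g : Lp ℂ 2 (volume : Measure E)) :
    Integrable fun ξ => starRingEnd ℂ (f ξ) * g ξ := by
  refine (L2.integrable_inner (𝕜 := ℂ) f g).congr (.of_forall fun ξ => ?_)
  simp only [RCLike.inner_apply]
  ring

lemma phU_cont (f : Lp ℂ 2 (volume : Measure E)) : Continuous fun t => phU t f := by
  rw [continuous_iff_continuousAt]
  intro s
  rw [ContinuousAt, tendsto_iff_norm_sub_tendsto_zero]
  have hc : Continuous fun t => inner ℂ (phU t f) (phU s f) := by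
    simp only [phU_inner]
    refine continuous_of_dominated (bound := fun ξ => ‖starRingEnd ℂ (f ξ) * f ξ‖) (fun t => ?_)
      (fun t => .of_forall fun ξ => ?_) (conj_mul_int f f).norm (.of_forall fun ξ => ?_)
    · exact (Complex.continuous_conj.comp_aestronglyMeasurable (Lp.aestronglyMeasurable f)).mul
        ((Lp.aestronglyMeasurable f).mul (ph_cont _).aestronglyMeasurable)
    · simp [ph_norm]
    · have := ph_cont_t ξ
      fun_prop
  have h2 : ∀ t, ‖phU t f - phU s f‖ = Real.sqrt (‖f‖ ^ 2 - 2 * (inner ℂ (phU t f) (phU s f)).re + ‖f‖ ^ 2) := by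
    intro t
    rw [eq_comm, Real.sqrt_eq_iff_eq_sq, norm_sub_sq (𝕜 := ℂ)]
    · simp
    · have := norm_sub_sq (𝕜 := ℂ) (phU t f) (phU s f)
      simp only [LinearIsometry.norm_map] at this
      rw [← RCLike.re_eq_complex_re, ← this]
      positivity
    · positivity
  have h3 : Continuous fun t => ‖phU t f - phU s f‖ := by
    simp only [h2]
    have := Complex.continuous_re.comp hc
    simp only [Function.comp_def] at this
    fun_prop
  simpa using h3.tendsto s

/-- the evolution -/
def schV (t : ℝ) : Lp ℂ 2 (volume : Measure E) →ₗᵢ[ℂ] Lp ℂ 2 (volume : Measure E) :=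
  (phU t).comp (Lp.fourierTransformₗᵢ E ℂ).toLinearIsometry

lemma schV_apply (t : ℝ) (f : Lp ℂ 2 (volume : Measure E)) : schV t f = phU t (𝓕 f) := rfl

lemma schV_inner {s t : ℝ} (hst : s ≠ t) (f g : Lp ℂ 2 (volume : Measure E)) (hf : Integrable f)
    (hg : Integrable g) : inner ℂ (schV t f) (schV s g) =
      ∫ x, starRingEnd ℂ (f x) * gk (((4 * Real.pi ^ 2 * (t - s) : ℝ) : ℂ) * I) g x := by
  rw [schV_apply, schV_apply, phU_inner]
  have h1 := fourier_ae f hf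
  have h2 := fourier_ae g hg
  rw [← core_lim hf hg]
  · refine integral_congr_ae ?_
    filter_upwards [h1, h2] with ξ h1 h2
    rw [h1, h2, ph]
    congr 3
    push_cast
    ring
  · refine (conj_mul_int (𝓕 f) (𝓕 g)).congr ?_
    filter_upwards [h1, h2] with ξ h1 h2
    rw [h1, h2]
  · have := Real.pi_pos
    have : t - s ≠ 0 := sub_ne_zero.2 hst.symm
    positivity

lemma schV_disp (s t : ℝ) (f g : Lp ℂ 2 (volume : Measure E)) (hst : s ≠ t) :
    ‖inner ℂ (schV s f) (schV t g)‖ₑ ≤ ENNReal.ofReal ((4 * Real.pi) ^ (-(Module.finrank ℝ E / 2 : ℝ)) *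
      |t - s| ^ (-(Module.finrank ℝ E / 2 : ℝ))) * eLpNorm f 1 volume * eLpNorm g 1 volume := by
  have hpi := Real.pi_pos
  have hts : 0 < |t - s| := abs_pos.2 (sub_ne_zero.2 hst.symm)
  have hK : 0 < (4 * Real.pi) ^ (-(Module.finrank ℝ E / 2 : ℝ)) *
      |t - s| ^ (-(Module.finrank ℝ E / 2 : ℝ)) := by positivity
  have hzero : ∀ f : Lp ℂ 2 (volume : Measure E), eLpNorm f 1 volume = 0 → f = 0 := by
    intro f h
    rw [eLpNorm_eq_zero_iff (Lp.aestronglyMeasurable f) one_ne_zero] at h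
    exact Lp.eq_zero_iff_ae_eq_zero.2 h
  by_cases hf0 : eLpNorm f 1 volume = 0
  · simp [hzero f hf0]
  by_cases hg0 : eLpNorm g 1 volume = 0
  · simp [hzero g hg0]
  have hK' := ENNReal.ofReal_pos.2 hK
  by_cases hf : eLpNorm f 1 volume = ∞
  · rw [hf, ENNReal.mul_top hK'.ne', ENNReal.top_mul hg0]; exact le_top
  by_cases hg : eLpNorm g 1 volume = ∞
  · rw [hg, ENNReal.mul_top (mul_ne_zero hK'.ne' hf0)]; exact le_top
  have hfi : Integrable f := memLp_one_iff_integrable.1 ⟨Lp.aestronglyMeasurable f, lt_top_iff_ne_top.2 hf⟩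
  have hgi : Integrable g := memLp_one_iff_integrable.1 ⟨Lp.aestronglyMeasurable g, lt_top_iff_ne_top.2 hg⟩
  rw [schV_inner hst.symm f g hfi hgi, eLpNorm_one_eq_lintegral_enorm,
    eLpNorm_one_eq_lintegral_enorm, ← ofReal_integral_norm_eq_lintegral_enorm hfi,
    ← ofReal_integral_norm_eq_lintegral_enorm hgi]
  rw [← ENNReal.ofReal_mul (by positivity), ← ENNReal.ofReal_mul (by positivity), ← ofReal_norm]
  apply ENNReal.ofReal_le_ofReal
  have : s - t ≠ 0 := sub_ne_zero.2 hst
  have hz0 : (((4 * Real.pi ^ 2 * (s - t) : ℝ) : ℂ) * I) ≠ 0 := by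
    refine mul_ne_zero ?_ I_ne_zero
    have : 4 * Real.pi ^ 2 * (s - t) ≠ 0 := by positivity
    exact_mod_cast this
  refine (norm_integral_le_of_norm_le (hfi.norm.mul_const
    ((Real.pi / ‖(((4 * Real.pi ^ 2 * (s - t) : ℝ) : ℂ) * I)‖) ^ (Module.finrank ℝ E / 2 : ℝ) * ∫ y, ‖g y‖))
    (.of_forall fun x => ?_)).trans_eq ?_
  · rw [norm_mul, RCLike.norm_conj]
    gcongr
    exact gk_norm (by rw [Complex.re_ofReal_mul]; simp) hz0 hgi x
  · rw [integral_mul_const, ← Real.mul_rpow (by positivity) (by positivity),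
      Real.rpow_neg (by positivity), ← Real.inv_rpow (by positivity)]
    have : Real.pi / ‖(((4 * Real.pi ^ 2 * (s - t) : ℝ) : ℂ) * I)‖ = (4 * Real.pi * |t - s|)⁻¹ := by
      rw [norm_mul, norm_I, norm_real, Real.norm_eq_abs, abs_mul, abs_of_pos (by positivity), abs_sub_comm]
      field_simp
    rw [this]
    ring
end

instance (d : ℕ) : SecondCountableTopology (Lp ℂ 2 (volume : Measure (EuclideanSpace ℝ (Fin d)))) := by
  haveI : Fact ((2:ℝ≥0∞) ≠ ⊤) := ⟨by simp⟩
  infer_instance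

/-- The Schrödinger evolution as a dispersive system -/
def schD (d : ℕ) (hd : 1 ≤ d) : Disp (volume : Measure (EuclideanSpace ℝ (Fin d)))
    (Lp ℂ 2 (volume : Measure (EuclideanSpace ℝ (Fin d)))) (d / 2) ((4 * Real.pi) ^ (-(d / 2 : ℝ))) where
  V := schV
  cont f := phU_cont _
  disp s t f g h := by
    have := schV_disp s t f g h
    simpa only [finrank_euclideanSpace, Fintype.card_fin] using this
  hA := by have := Real.pi_pos; positivity
  hσ := by
    have : (0:ℝ) < d := by exact_mod_cast hd
    positivity

end

section

section
variable {X : Type*} [MeasurableSpace X] {μ : Measure X}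

lemma elp_tendsto {p : ℝ≥0∞} (hp0 : p ≠ 0) (hp : p ≠ ∞) {f : ℕ → X → ℂ} {g : X → ℂ} {b : X → ℝ}
    (hf : ∀ n, Measurable (f n)) (hb : MemLp b p μ) (hfb : ∀ n x, ‖f n x‖ ≤ b x)
    (hl : ∀ x, Filter.Tendsto (fun n => f n x) Filter.atTop (nhds (g x))) :
    Filter.Tendsto (fun n => eLpNorm (f n) p μ) Filter.atTop (nhds (eLpNorm g p μ)) := by
  have hpp := ENNReal.toReal_pos hp0 hp
  simp only [eLpNorm_eq_lintegral_rpow_enorm_toReal hp0 hp]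
  refine ((ENNReal.continuous_rpow_const).tendsto _).comp ?_
  refine tendsto_lintegral_of_dominated_convergence (fun x => ‖b x‖ₑ ^ p.toReal)
    (fun n => ((hf n).enorm.pow_const _)) (fun n => .of_forall fun x => ?_) ?_ (.of_forall fun x => ?_)
  · refine ENNReal.rpow_le_rpow ?_ hpp.le
    rw [← ofReal_norm, ← ofReal_norm]
    exact ENNReal.ofReal_le_ofReal ((hfb n x).trans (le_abs_self _))
  · exact (lintegral_rpow_enorm_lt_top_of_eLpNorm_lt_top hp0 hp hb.2).ne
  · exact ((ENNReal.continuous_rpow_const).tendsto _).comp ((continuous_enorm.tendsto _).comp (hl x))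

lemma memLp_le_one {p : ℝ≥0∞} (hp1 : 1 ≤ p) (hp : p ≠ ∞) {b : X → ℝ} (hb : Integrable b μ)
    (h0 : ∀ x, 0 ≤ b x) (h1 : ∀ x, b x ≤ 1) : MemLp b p μ := by
  have hp0 : p ≠ 0 := (zero_lt_one.trans_le hp1).ne'
  refine ⟨hb.1, ?_⟩
  rw [eLpNorm_lt_top_iff_lintegral_rpow_enorm_lt_top hp0 hp]
  refine lt_of_le_of_lt (lintegral_mono fun x => ?_) hb.2
  have : ‖b x‖ₑ ≤ 1 := by
    rw [← ofReal_norm, Real.norm_of_nonneg (h0 x)]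
    exact ENNReal.ofReal_le_one.2 (h1 x)
  have hp2 : 1 ≤ p.toReal := by
    rw [← ENNReal.toReal_one]; exact (ENNReal.toReal_le_toReal (by simp) hp).2 hp1
  calc ‖b x‖ₑ ^ p.toReal ≤ ‖b x‖ₑ ^ (1:ℝ) := ENNReal.rpow_le_rpow_of_exponent_ge this hp2
    _ = _ := by simp
end

section
variable {E : Type*} [NormedAddCommGroup E] [InnerProductSpace ℝ E] [FiniteDimensional ℝ E]
  [MeasurableSpace E] [BorelSpace E]

/-- time weight -/
def wa (s : ℝ) : ℝ := (1 + ‖s‖) ^ (-(2:ℝ))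
/-- space weight -/
def ww (y : E) : ℝ := (1 + ‖y‖) ^ (-(Module.finrank ℝ E + 1 : ℝ))

lemma wa_int : Integrable wa := by
  have := integrable_one_add_norm (E := ℝ) (μ := volume) (r := 2) (by simp)
  exact this
lemma ww_int : Integrable (ww : E → ℝ) := integrable_one_add_norm (by simp)
lemma wa_nonneg (s) : 0 ≤ wa s := by unfold wa; positivity
lemma ww_nonneg (s : E) : 0 ≤ ww s := by unfold ww; positivity
lemma wa_le (s) : wa s ≤ 1 := by
  unfold wa
  exact Real.rpow_le_one_of_one_le_of_nonpos (by simp) (by norm_num)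
lemma ww_le (s : E) : ww s ≤ 1 := by
  unfold ww
  exact Real.rpow_le_one_of_one_le_of_nonpos (by simp)
    (by have : (0:ℝ) ≤ Module.finrank ℝ E := Nat.cast_nonneg _
        linarith)
lemma wa_memLp {p : ℝ≥0∞} (hp1 : 1 ≤ p) (hp : p ≠ ∞) : MemLp wa p :=
  memLp_le_one hp1 hp wa_int wa_nonneg wa_le
lemma ww_memLp {p : ℝ≥0∞} (hp1 : 1 ≤ p) (hp : p ≠ ∞) : MemLp (ww : E → ℝ) p :=
  memLp_le_one hp1 hp ww_int ww_nonneg ww_le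

lemma wa_shift {s t : ℝ} (h : |s - t| ≤ 1) : wa s ≤ 4 * wa t := by
  unfold wa
  rw [Real.rpow_neg (by positivity), Real.rpow_neg (by positivity), ← div_eq_mul_inv,
    inv_le_comm₀ (by positivity) (by positivity), inv_div]
  rw [Real.rpow_ofNat, Real.rpow_ofNat, Real.norm_eq_abs, Real.norm_eq_abs]
  have h1 : |t| ≤ |s| + 1 := by
    have := abs_sub_abs_le_abs_sub t s
    rw [abs_sub_comm] at this
    linarith
  have := abs_nonneg t
  have := abs_nonneg s
  rw [div_le_iff₀ (by norm_num)]
  nlinarith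

lemma schw_bound (F : SchwartzMap (ℝ × E) ℂ) : ∃ C : ℝ, 0 ≤ C ∧ ∀ s y, ‖F (s, y)‖ ≤ C * wa s * ww y := by
  set k := Module.finrank ℝ E + 3
  refine ⟨2 ^ k * ((Finset.Iic ((k, 0) : ℕ × ℕ)).sup fun m => SchwartzMap.seminorm ℝ m.1 m.2) F,
    by positivity, fun s y => ?_⟩
  have h := SchwartzMap.one_add_le_sup_seminorm_apply (𝕜 := ℝ) (m := (k, 0)) le_rfl le_rfl F (s, y)
  rw [norm_iteratedFDeriv_zero] at h
  simp only at h
  set B := 2 ^ k * ((Finset.Iic ((k, 0) : ℕ × ℕ)).sup fun m => SchwartzMap.seminorm ℝ m.1 m.2) F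
  have h1 : ‖s‖ ≤ ‖(s, y)‖ := norm_fst_le (s, y)
  have h2 : ‖y‖ ≤ ‖(s, y)‖ := norm_snd_le (s, y)
  have h3 : (1 + ‖s‖) ^ 2 * (1 + ‖y‖) ^ (Module.finrank ℝ E + 1) ≤ (1 + ‖(s, y)‖) ^ k := by
    calc _ ≤ (1 + ‖(s, y)‖) ^ 2 * (1 + ‖(s, y)‖) ^ (Module.finrank ℝ E + 1) := by gcongr
      _ = _ := by rw [← pow_add]; congr 1; simp only [k]; ring
  unfold wa ww
  rw [Real.rpow_neg (by positivity), Real.rpow_neg (by positivity), mul_assoc, ← mul_inv,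
    ← div_eq_mul_inv, le_div_iff₀ (by positivity)]
  rw [Real.rpow_ofNat]
  have h4 : (1 + ‖y‖) ^ (Module.finrank ℝ E + 1 : ℝ) = (1 + ‖y‖) ^ (Module.finrank ℝ E + 1) := by
    exact_mod_cast Real.rpow_natCast (1 + ‖y‖) (Module.finrank ℝ E + 1)
  rw [h4]
  calc _ ≤ ‖F (s, y)‖ * (1 + ‖(s, y)‖) ^ k := by gcongr
    _ ≤ B := by rw [mul_comm]; exact h

lemma slice_cont (F : SchwartzMap (ℝ × E) ℂ) (s : ℝ) : Continuous fun y => F (s, y) :=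
  F.continuous.comp (by fun_prop)

lemma slice_memLp (F : SchwartzMap (ℝ × E) ℂ) (s : ℝ) {p : ℝ≥0∞} (hp1 : 1 ≤ p) (hp : p ≠ ∞) :
    MemLp (fun y => F (s, y)) p := by
  obtain ⟨C, hC, h⟩ := schw_bound F
  refine ((ww_memLp hp1 hp).const_mul (C * wa s)).of_le (slice_cont F s).aestronglyMeasurable
    (.of_forall fun y => (h s y).trans (le_abs_self _))

/-- slice of a Schwartz function -/
def sl (F : SchwartzMap (ℝ × E) ℂ) (s : ℝ) : Lp ℂ 2 (volume : Measure E) :=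
  (slice_memLp F s (p := 2) (by norm_num) (by simp)).toLp _

lemma sl_ae (F : SchwartzMap (ℝ × E) ℂ) (s : ℝ) : sl F s =ᵐ[volume] fun y => F (s, y) :=
  MemLp.coeFn_toLp _

lemma sl_int (F : SchwartzMap (ℝ × E) ℂ) (s : ℝ) : Integrable (sl F s) :=
  (memLp_one_iff_integrable.1 (slice_memLp F s (p := 1) le_rfl (by simp))).congr (sl_ae F s).symm

lemma slice_norm (F : SchwartzMap (ℝ × E) ℂ) {p : ℝ≥0∞} (hp1 : 1 ≤ p) (hp : p ≠ ∞) :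
    ∃ C : ℝ, 0 ≤ C ∧ ∀ s, (eLpNorm (fun y => F (s, y)) p).toReal ≤ C * wa s := by
  obtain ⟨C, hC, h⟩ := schw_bound F
  refine ⟨C * (eLpNorm (ww : E → ℝ) p).toReal, by positivity, fun s => ?_⟩
  have : eLpNorm (fun y => F (s, y)) p ≤ ENNReal.ofReal (C * wa s) * eLpNorm (ww : E → ℝ) p := by
    have h1 : eLpNorm (fun y => F (s, y)) p ≤ eLpNorm (fun y : E => (C * wa s) • ww y) p := by
      refine eLpNorm_mono_real fun y => (h s y)
    refine h1.trans_eq ?_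
    rw [← Pi.smul_def, eLpNorm_const_smul, ← ofReal_norm, Real.norm_of_nonneg (mul_nonneg hC (wa_nonneg s))]
  refine (ENNReal.toReal_mono (ENNReal.mul_ne_top (by simp) (ww_memLp hp1 hp).2.ne) this).trans_eq ?_
  rw [ENNReal.toReal_mul, ENNReal.toReal_ofReal (mul_nonneg hC (wa_nonneg s))]
  ring

lemma sl_norm (F : SchwartzMap (ℝ × E) ℂ) : ∃ C : ℝ, 0 ≤ C ∧ ∀ s, ‖sl F s‖ ≤ C * wa s := by
  obtain ⟨C, hC, h⟩ := slice_norm F (p := 2) (by norm_num) (by simp)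
  refine ⟨C, hC, fun s => ?_⟩
  rw [sl, Lp.norm_toLp]
  exact h s

/-- Convergence of perturbed slices. -/
lemma slice_tendsto (F : SchwartzMap (ℝ × E) ℂ) {p : ℝ≥0∞} (hp1 : 1 ≤ p) (hp : p ≠ ∞) {τ : ℕ → ℝ} {s : ℝ}
    (hτ : Filter.Tendsto τ Filter.atTop (nhds s)) {T : ℕ → ℂ → ℂ} (hT : ∀ n, Measurable (T n))
    (hT1 : ∀ n z, ‖T n z‖ ≤ ‖z‖) (hT2 : ∀ n z, ‖T n z - z‖ ≤ 1 / ((n:ℝ) + 1)) :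
    Filter.Tendsto (fun n => eLpNorm (fun y => T n (F (τ n, y)) - F (s, y)) p) Filter.atTop (nhds 0) := by
  obtain ⟨C, hC, h⟩ := schw_bound F
  have : (0 : ℝ≥0∞) = eLpNorm (fun _ : E => (0:ℂ)) p := by simp
  rw [this]
  refine elp_tendsto (zero_lt_one.trans_le hp1).ne' hp (b := fun y => (2 * C) * ww y) (fun n => ?_)
    ((ww_memLp hp1 hp).const_mul _) (fun n y => ?_) (fun y => ?_)
  · exact ((hT n).comp (slice_cont F (τ n)).measurable).sub (slice_cont F s).measurable
  · have h0 : ∀ s, ‖F (s, y)‖ ≤ C * ww y := fun s => by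
      refine (h s y).trans ?_
      have := mul_le_mul_of_nonneg_left (wa_le s) hC
      have := mul_le_mul_of_nonneg_right this (ww_nonneg y)
      linarith
    refine (norm_sub_le _ _).trans ?_
    have := (hT1 n (F (τ n, y))).trans (h0 _)
    have := h0 s
    linarith
  · rw [tendsto_zero_iff_norm_tendsto_zero]
    have hF : Filter.Tendsto (fun n => ‖F (τ n, y) - F (s, y)‖) Filter.atTop (nhds 0) := by
      rw [← tendsto_iff_norm_sub_tendsto_zero]
      exact (F.continuous.tendsto (s, y)).comp (hτ.prodMk_nhds tendsto_const_nhds)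
    refine squeeze_zero (fun n => norm_nonneg _) (fun n => ?_)
      (by simpa using (tendsto_one_div_add_atTop_nhds_zero_nat (𝕜 := ℝ)).add hF)
    calc _ ≤ ‖T n (F (τ n, y)) - F (τ n, y)‖ + ‖F (τ n, y) - F (s, y)‖ := norm_sub_le_norm_sub_add_norm_sub _ _ _
      _ ≤ _ := by gcongr; simpa using hT2 n (F (τ n, y))

lemma sl_continuous (F : SchwartzMap (ℝ × E) ℂ) : Continuous (sl F) := by
  rw [continuous_iff_seqContinuous]
  intro τ s hτ
  simp only [sl, Function.comp_def]
  rw [Lp.tendsto_Lp_iff_tendsto_eLpNorm'' (fun n y => F (τ n, y))]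
  exact slice_tendsto F (by norm_num) (by simp) hτ (T := fun _ z => z) (fun _ => measurable_id)
    (fun _ _ => le_rfl) (fun n z => by simp; positivity)

lemma slice_norm_tendsto (F : SchwartzMap (ℝ × E) ℂ) {p : ℝ≥0∞} (hp1 : 1 ≤ p) (hp : p ≠ ∞) {τ : ℕ → ℝ} {s : ℝ}
    (hτ : Filter.Tendsto τ Filter.atTop (nhds s)) :
    Filter.Tendsto (fun n => (eLpNorm (fun y => F (τ n, y)) p).toReal) Filter.atTop
      (nhds (eLpNorm (fun y => F (s, y)) p).toReal) := by
  obtain ⟨C, hC, h⟩ := schw_bound F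
  refine (ENNReal.tendsto_toReal (slice_memLp F s hp1 hp).2.ne).comp ?_
  refine elp_tendsto (zero_lt_one.trans_le hp1).ne' hp (b := fun y => C * ww y)
    (fun n => (slice_cont F (τ n)).measurable)
    ((ww_memLp hp1 hp).const_mul _) (fun n y => ?_) (fun y => ?_)
  · refine (h _ y).trans ?_
    have := mul_le_mul_of_nonneg_left (wa_le (τ n)) hC
    have := mul_le_mul_of_nonneg_right this (ww_nonneg y)
    linarith
  · exact (F.continuous.tendsto (s, y)).comp (hτ.prodMk_nhds tendsto_const_nhds)

lemma slice_norm_cont (F : SchwartzMap (ℝ × E) ℂ) {p : ℝ≥0∞} (hp1 : 1 ≤ p) (hp : p ≠ ∞) :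
    Continuous fun s => (eLpNorm (fun y => F (s, y)) p).toReal := by
  rw [continuous_iff_seqContinuous]
  intro τ s hτ
  exact slice_norm_tendsto F hp1 hp hτ

lemma schV_sl_cont (F : SchwartzMap (ℝ × E) ℂ) : Continuous fun s => schV s (sl F s) := by
  rw [continuous_iff_continuousAt]
  intro s
  rw [ContinuousAt, tendsto_iff_norm_sub_tendsto_zero]
  have h1 : Continuous fun t => ‖sl F t - sl F s‖ + ‖schV t (sl F s) - schV s (sl F s)‖ := by
    have := sl_continuous F
    have := phU_cont (𝓕 (sl F s))
    simp only [schV_apply]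
    fun_prop
  have h2 := h1.tendsto s
  simp only [sub_self, norm_zero, add_zero] at h2
  refine squeeze_zero (fun _ => norm_nonneg _) (fun t => ?_) h2
  calc _ ≤ ‖schV t (sl F t) - schV t (sl F s)‖ + ‖schV t (sl F s) - schV s (sl F s)‖ :=
        norm_sub_le_norm_sub_add_norm_sub _ _ _
    _ = _ := by rw [← map_sub, LinearIsometry.norm_map]

lemma schV_sl_int (F : SchwartzMap (ℝ × E) ℂ) : Integrable fun s => schV s (sl F s) := by
  obtain ⟨C, hC, h⟩ := sl_norm F
  refine (wa_int.const_mul C).mono' (schV_sl_cont F).aestronglyMeasurable (.of_forall fun s => ?_)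
  rw [LinearIsometry.norm_map]
  exact h s
end

end

section

section
variable {E : Type*} [NormedAddCommGroup E] [InnerProductSpace ℝ E] [FiniteDimensional ℝ E]
  [MeasurableSpace E] [BorelSpace E]

lemma test_ae {u v : E → ℂ} (hu : LocallyIntegrable u) (hv : LocallyIntegrable v)
    (h : ∀ G : Lp ℂ 2 (volume : Measure E), Integrable G →
      ∫ x, starRingEnd ℂ (G x) * u x = ∫ x, starRingEnd ℂ (G x) * v x) : u =ᵐ[volume] v := by
  refine ae_eq_of_integral_contDiff_smul_eq hu hv fun g hg hc => ?_
  have hc' : HasCompactSupport fun x => (g x : ℂ) := hc.comp_left (g := fun z : ℝ => (z : ℂ)) rfl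
  have hgc : Continuous fun x => (g x : ℂ) := by
    have := hg.continuous
    fun_prop
  have hm : MemLp (fun x => (g x : ℂ)) 2 (volume : Measure E) := hgc.memLp_of_hasCompactSupport hc'
  have hi : Integrable (fun x => (g x : ℂ)) (volume : Measure E) := hgc.integrable_of_hasCompactSupport hc'
  have key := h (hm.toLp _) (hi.congr hm.coeFn_toLp.symm)
  have h2 : ∀ w : E → ℂ, ∫ x, starRingEnd ℂ (hm.toLp _ x) * w x = ∫ x, g x • w x := by
    intro w
    refine integral_congr_ae ?_
    filter_upwards [hm.coeFn_toLp] with x hx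
    rw [hx, conj_ofReal, real_smul]
  rwa [h2, h2] at key

lemma inner_conj (f g : Lp ℂ 2 (volume : Measure E)) :
    inner ℂ f g = ∫ x, starRingEnd ℂ (f x) * g x := by
  rw [L2.inner_def]
  refine integral_congr_ae (.of_forall fun x => ?_)
  simp only [RCLike.inner_apply]
  ring

lemma gk_locInt {z : ℂ} (hz : 0 ≤ z.re) (hz0 : z ≠ 0) {φ : E → ℂ} (hφ : Integrable φ) :
    LocallyIntegrable (gk z φ) := by
  rw [locallyIntegrable_iff]
  intro K hK
  exact Measure.integrableOn_of_bounded hK.measure_lt_top.ne (gk_meas hφ.1 z)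
    (.of_forall fun x => gk_norm hz hz0 hφ x)

lemma gk_ae {s t : ℝ} (hst : s ≠ t) (φ : Lp ℂ 2 (volume : Measure E)) (hφ : Integrable φ) :
    gk (((4 * Real.pi ^ 2 * (t - s) : ℝ) : ℂ) * I) φ =ᵐ[volume]
      ContinuousLinearMap.adjoint (schV t).toContinuousLinearMap (schV s φ) := by
  have hpi := Real.pi_pos
  have hts : t - s ≠ 0 := sub_ne_zero.2 hst.symm
  have hz0 : (((4 * Real.pi ^ 2 * (t - s) : ℝ) : ℂ) * I) ≠ 0 := by
    refine mul_ne_zero ?_ I_ne_zero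
    have : 4 * Real.pi ^ 2 * (t - s) ≠ 0 := by positivity
    exact_mod_cast this
  refine test_ae (gk_locInt (by rw [Complex.re_ofReal_mul]; simp) hz0 hφ)
    ((Lp.memLp _).locallyIntegrable (by norm_num)) fun G hG => ?_
  rw [← schV_inner hst G φ hG hφ, ← inner_conj, ContinuousLinearMap.adjoint_inner_right]
  rfl
end

variable {d : ℕ}

lemma schrod_meas (F : SchwartzMap (ℝ × EuclideanSpace ℝ (Fin d)) ℂ) (t : ℝ) :
    StronglyMeasurable fun p : EuclideanSpace ℝ (Fin d) × ℝ =>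
      schrod d (t - p.2) (fun y => F (p.2, y)) p.1 := by
  unfold schrod
  refine StronglyMeasurable.mul ?_ ?_
  · refine Measurable.stronglyMeasurable ?_
    exact ((by fun_prop : Measurable fun p : EuclideanSpace ℝ (Fin d) × ℝ =>
      ((4 * Real.pi * (t - p.2) : ℝ) : ℂ) * I)).pow_const _
  · have : StronglyMeasurable fun w : (EuclideanSpace ℝ (Fin d) × ℝ) × EuclideanSpace ℝ (Fin d) =>
      cexp (I * ((‖w.1.1 - w.2‖ : ℝ) : ℂ) ^ 2 / ((4 * (t - w.1.2) : ℝ) : ℂ)) * F (w.1.2, w.2) := by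
      refine Measurable.stronglyMeasurable ?_
      have h1 : Measurable fun w : (EuclideanSpace ℝ (Fin d) × ℝ) × EuclideanSpace ℝ (Fin d) => F (w.1.2, w.2) :=
        (F.continuous.comp (by fun_prop)).measurable
      refine Measurable.mul ?_ h1
      refine Complex.measurable_exp.comp (Measurable.div ?_ ?_)
      · exact (by fun_prop : Continuous fun w : (EuclideanSpace ℝ (Fin d) × ℝ) × EuclideanSpace ℝ (Fin d) =>
          I * ((‖w.1.1 - w.2‖ : ℝ) : ℂ) ^ 2).measurable
      · exact (by fun_prop : Continuous fun w : (EuclideanSpace ℝ (Fin d) × ℝ) × EuclideanSpace ℝ (Fin d) =>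
          ((4 * (t - w.1.2) : ℝ) : ℂ)).measurable
    exact this.integral_prod_right

lemma schrod_ae (F : SchwartzMap (ℝ × EuclideanSpace ℝ (Fin d)) ℂ) {s t : ℝ} (hst : s < t) :
    (fun x => schrod d (t - s) (fun y => F (s, y)) x) =ᵐ[volume]
      ContinuousLinearMap.adjoint (schV t).toContinuousLinearMap (schV s (sl F s)) := by
  refine Filter.EventuallyEq.trans ?_ (gk_ae hst.ne (sl F s) (sl_int F s))
  refine .of_forall fun x => ?_
  simp only [schrod_eq_gk d (sub_ne_zero.2 hst.ne')]
  refine integral_congr_ae ?_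
  filter_upwards [sl_ae F s] with y hy
  rw [hy]

lemma schrod_prod_int (F : SchwartzMap (ℝ × EuclideanSpace ℝ (Fin d)) ℂ) (t : ℝ)
    (G : Lp ℂ 2 (volume : Measure (EuclideanSpace ℝ (Fin d)))) :
    Integrable (fun p : EuclideanSpace ℝ (Fin d) × ℝ => starRingEnd ℂ (G p.1) *
      schrod d (t - p.2) (fun y => F (p.2, y)) p.1) (volume.prod (volume.restrict (Set.Iio t))) := by
  have hm : AEStronglyMeasurable (fun p : EuclideanSpace ℝ (Fin d) × ℝ => starRingEnd ℂ (G p.1) *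
      schrod d (t - p.2) (fun y => F (p.2, y)) p.1) (volume.prod (volume.restrict (Set.Iio t))) :=
    (Complex.continuous_conj.comp_aestronglyMeasurable (Lp.aestronglyMeasurable G).comp_fst).mul
      (schrod_meas F t).aestronglyMeasurable
  rw [integrable_prod_iff' hm]
  have h1 : ∀ s < t, (fun x => starRingEnd ℂ (G x) * schrod d (t - s) (fun y => F (s, y)) x) =ᵐ[volume]
      fun x => starRingEnd ℂ (G x) *
        (ContinuousLinearMap.adjoint (schV t).toContinuousLinearMap (schV s (sl F s))) x := by
    intro s hs
    filter_upwards [schrod_ae F hs] with x hx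
    rw [hx]
  obtain ⟨C, hC, hb⟩ := sl_norm F
  constructor
  · filter_upwards [ae_restrict_mem measurableSet_Iio] with s hs
    exact (conj_mul_int G _).congr (h1 s hs).symm
  · refine (wa_int.restrict.const_mul (‖G‖ * C)).mono' (hm.norm.prod_swap.integral_prod_right') ?_
    filter_upwards [ae_restrict_mem measurableSet_Iio] with s hs
    rw [Real.norm_of_nonneg (integral_nonneg fun _ => norm_nonneg _)]
    refine (integral_congr_ae ((h1 s hs).fun_comp norm)).trans_le ?_
    set h := ContinuousLinearMap.adjoint (schV t).toContinuousLinearMap (schV s (sl F s))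
    have hn : ‖h‖ ≤ ‖sl F s‖ := by
      refine (ContinuousLinearMap.le_opNorm _ _).trans ?_
      rw [LinearIsometryEquiv.norm_map, LinearIsometry.norm_map]
      exact mul_le_of_le_one_left (norm_nonneg _) (LinearIsometry.norm_toContinuousLinearMap_le _)
    have h3 : ∫ x, ‖starRingEnd ℂ (G x) * h x‖ ≤ ‖G‖ * ‖h‖ := by
      rw [integral_norm_eq_lintegral_enorm (conj_mul_int G h).1]
      refine ENNReal.toReal_le_of_le_ofReal (by positivity) ?_
      rw [ENNReal.ofReal_mul (norm_nonneg _), ofReal_norm, ofReal_norm, Lp.enorm_def, Lp.enorm_def]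
      rw [← eLpNorm_one_eq_lintegral_enorm]
      have := eLpNorm_smul_le_mul_eLpNorm (p := 2) (q := 2) (r := 1) (Lp.aestronglyMeasurable h)
        (Complex.continuous_conj.comp_aestronglyMeasurable (Lp.aestronglyMeasurable G))
      refine this.trans_eq ?_
      congr 1
      exact eLpNorm_congr_norm_ae (.of_forall fun x => by simp)
    refine h3.trans ?_
    rw [mul_assoc]
    gcongr
    exact hn.trans (hb s)

lemma duhamel_ae (hd : 1 ≤ d) (F : SchwartzMap (ℝ × EuclideanSpace ℝ (Fin d)) ℂ) (t : ℝ) :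
    (fun x => ∫ s in Set.Iio t, schrod d (t - s) (fun y => F (s, y)) x) =ᵐ[volume]
      Us (schD d hd) (fun s => schV s (sl F s)) t := by
  refine test_ae ?_ ((Lp.memLp _).locallyIntegrable (by norm_num)) fun G hG => ?_
  · rw [locallyIntegrable_iff]
    intro K hK
    have hKm := hK.measurableSet
    have h := (schrod_prod_int F t (indicatorConstLp 2 hKm hK.measure_lt_top.ne 1)).integral_prod_left
    have h' := h.integrableOn (s := K)
    refine h'.congr ?_
    have h2 := (indicatorConstLp_coeFn (p := 2) (μ := volume) (hs := hKm) (hμs := hK.measure_lt_top.ne) (c := (1:ℂ)))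
    filter_upwards [ae_restrict_mem hKm, ae_restrict_of_ae h2] with x hx h2
    simp only [h2, Set.indicator_of_mem hx, map_one, one_mul]
  · have h := schrod_prod_int F t G
    calc _ = ∫ x, ∫ s in Set.Iio t, starRingEnd ℂ (G x) * schrod d (t - s) (fun y => F (s, y)) x := by
          simp only [integral_const_mul]
      _ = ∫ s in Set.Iio t, ∫ x, starRingEnd ℂ (G x) * schrod d (t - s) (fun y => F (s, y)) x := by
          exact integral_integral_swap h
      _ = ∫ s in Set.Iio t, inner ℂ (schV t G) (schV s (sl F s)) := by
          refine setIntegral_congr_fun measurableSet_Iio fun s hs => ?_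
          have : inner ℂ (schV t G) (schV s (sl F s)) =
              inner ℂ G (ContinuousLinearMap.adjoint (schV t).toContinuousLinearMap (schV s (sl F s))) := by
            rw [ContinuousLinearMap.adjoint_inner_right]; rfl
          rw [this, inner_conj]
          refine integral_congr_ae ?_
          filter_upwards [schrod_ae F hs] with x hx
          rw [hx]
      _ = inner ℂ (schV t G) (Wp (fun s => schV s (sl F s)) t) := by
          rw [integral_inner (schV_sl_int F).integrableOn, Wp]
          rfl
      _ = inner ℂ G (Us (schD d hd) (fun s => schV s (sl F s)) t) := by
          rw [← inner_conj_symm, ← inner_conj_symm G, Us_inner]; rfl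
      _ = _ := inner_conj _ _

end

section

/-- truncation -/
def tr (n : ℕ) (z : ℂ) : ℂ := if 1 / ((n : ℝ) + 1) ≤ ‖z‖ then z else 0

lemma tr_meas (n : ℕ) : Measurable (tr n) :=
  Measurable.ite (measurableSet_le measurable_const measurable_norm) measurable_id measurable_const

lemma tr_le (n : ℕ) (z : ℂ) : ‖tr n z‖ ≤ ‖z‖ := by
  unfold tr; split_ifs <;> simp

lemma tr_sub (n : ℕ) (z : ℂ) : ‖tr n z - z‖ ≤ 1 / ((n : ℝ) + 1) := by
  unfold tr; split_ifs with h
  · simp; positivity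
  · simpa using (not_le.1 h).le

section
variable {E : Type*} [NormedAddCommGroup E] [InnerProductSpace ℝ E] [FiniteDimensional ℝ E]
  [MeasurableSpace E] [BorelSpace E]

lemma tsl_memLp (F : SchwartzMap (ℝ × E) ℂ) (n : ℕ) (s : ℝ) : MemLp (fun y => tr n (F (s, y))) 2 :=
  (slice_memLp F s (by norm_num) (by simp)).of_le
    ((tr_meas n).comp (slice_cont F s).measurable).aestronglyMeasurable (.of_forall fun y => tr_le n _)

/-- truncated slice -/
def tsl (F : SchwartzMap (ℝ × E) ℂ) (n : ℕ) (s : ℝ) : Lp ℂ 2 (volume : Measure E) :=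
  (tsl_memLp F n s).toLp _

lemma tsl_ae (F : SchwartzMap (ℝ × E) ℂ) (n : ℕ) (s : ℝ) : tsl F n s =ᵐ[volume] fun y => tr n (F (s, y)) :=
  MemLp.coeFn_toLp _

lemma tsl_norm_le (F : SchwartzMap (ℝ × E) ℂ) (n : ℕ) (s : ℝ) (p : ℝ≥0∞) :
    eLpNorm (tsl F n s) p volume ≤ eLpNorm (fun y => F (s, y)) p := by
  rw [eLpNorm_congr_ae (tsl_ae F n s)]
  exact eLpNorm_mono fun y => tr_le n _

lemma tsl_norm (F : SchwartzMap (ℝ × E) ℂ) (n : ℕ) (s : ℝ) : ‖tsl F n s‖ ≤ ‖sl F s‖ := by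
  rw [sl, Lp.norm_toLp, Lp.norm_def]
  exact ENNReal.toReal_mono (slice_memLp F s (by norm_num) (by simp)).2.ne (tsl_norm_le F n s 2)

lemma tsl_sub (F : SchwartzMap (ℝ × E) ℂ) {τ : ℕ → ℝ} {s : ℝ}
    (hτ : Filter.Tendsto τ Filter.atTop (nhds s)) :
    Filter.Tendsto (fun n => tsl F n (τ n)) Filter.atTop (nhds (sl F s)) := by
  simp only [sl, tsl]
  rw [Lp.tendsto_Lp_iff_tendsto_eLpNorm'' (fun n y => tr n (F (τ n, y)))]
  exact slice_tendsto F (by norm_num) (by simp) hτ tr_meas tr_le tr_sub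

/-- spatial norm of a slice -/
def sN (F : SchwartzMap (ℝ × E) ℂ) (p : ℝ≥0∞) (s : ℝ) : ℝ := (eLpNorm (fun y => F (s, y)) p).toReal

lemma sN_nonneg (F : SchwartzMap (ℝ × E) ℂ) (p : ℝ≥0∞) (s : ℝ) : 0 ≤ sN F p s := ENNReal.toReal_nonneg

/-- normalized truncated slice -/
def nsl (F : SchwartzMap (ℝ × E) ℂ) (p : ℝ≥0∞) (n : ℕ) (s : ℝ) : Lp ℂ 2 (volume : Measure E) :=
  (((sN F p s)⁻¹ : ℝ) : ℂ) • tsl F n s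

lemma nsl_unit (F : SchwartzMap (ℝ × E) ℂ) {p : ℝ≥0∞} (hp1 : 1 ≤ p) (hp : p ≠ ∞) (n : ℕ) (s : ℝ) :
    eLpNorm (nsl F p n s) p volume ≤ 1 := by
  have h1 := tsl_norm_le F n s p
  have h2 : eLpNorm (fun y => F (s, y)) p = ENNReal.ofReal (sN F p s) :=
    (ENNReal.ofReal_toReal (slice_memLp F s hp1 hp).2.ne).symm
  rw [nsl, eLpNorm_congr_ae (Lp.coeFn_smul _ _), eLpNorm_const_smul]
  rw [h2] at h1
  rw [← ofReal_norm, norm_real, Real.norm_of_nonneg (inv_nonneg.2 (sN_nonneg F p s))]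
  calc _ ≤ ENNReal.ofReal (sN F p s)⁻¹ * ENNReal.ofReal (sN F p s) := by gcongr
    _ = ENNReal.ofReal ((sN F p s)⁻¹ * sN F p s) := by
      rw [ENNReal.ofReal_mul (inv_nonneg.2 (sN_nonneg F p s))]
    _ ≤ 1 := ENNReal.ofReal_le_one.2 (by
      by_cases h : sN F p s = 0
      · simp [h]
      · rw [inv_mul_cancel₀ h])

lemma sN_smul (F : SchwartzMap (ℝ × E) ℂ) {p : ℝ≥0∞} (hp1 : 1 ≤ p) (hp : p ≠ ∞) (n : ℕ) (s : ℝ) :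
    ((sN F p s : ℝ) : ℂ) • nsl F p n s = tsl F n s := by
  by_cases h : sN F p s = 0
  · have h1 := tsl_norm_le F n s p
    have h2 : eLpNorm (fun y => F (s, y)) p = ENNReal.ofReal (sN F p s) :=
      (ENNReal.ofReal_toReal (slice_memLp F s hp1 hp).2.ne).symm
    rw [h2, h, ENNReal.ofReal_zero, nonpos_iff_eq_zero,
      eLpNorm_eq_zero_iff (Lp.aestronglyMeasurable _) (zero_lt_one.trans_le hp1).ne'] at h1
    rw [nsl, Lp.eq_zero_iff_ae_eq_zero.2 h1]; simp
  · rw [nsl, smul_smul, ← ofReal_mul, mul_inv_cancel₀ h, ofReal_one, one_smul]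

lemma nsl_nice (F : SchwartzMap (ℝ × E) ℂ) (p : ℝ≥0∞) (n : ℕ) (s : ℝ) : Nice (nsl F p n s) := by
  obtain ⟨C, hC, hb⟩ := schw_bound F
  by_cases h : sN F p s = 0
  · refine ⟨1, one_pos, 1, ?_⟩
    have : nsl F p n s = 0 := by rw [nsl, h]; simp
    rw [this]
    filter_upwards [Lp.coeFn_zero ℂ 2 (volume : Measure E)] with x hx
    left; rw [hx]; rfl
  have hpos : 0 < (sN F p s)⁻¹ := inv_pos.2 (lt_of_le_of_ne (sN_nonneg F p s) (Ne.symm h))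
  refine ⟨(sN F p s)⁻¹ * (1 / ((n:ℝ) + 1)), by positivity, (sN F p s)⁻¹ * C, ?_⟩
  filter_upwards [Lp.coeFn_smul (((sN F p s)⁻¹ : ℝ) : ℂ) (tsl F n s), tsl_ae F n s] with y h1 h2
  rw [nsl, h1, Pi.smul_apply, h2, norm_smul, norm_real, Real.norm_of_nonneg hpos.le]
  unfold tr
  split_ifs with h3
  · right
    constructor
    · gcongr
    · gcongr
      refine (hb s y).trans ?_
      have := mul_le_mul (wa_le s) (ww_le y) (ww_nonneg y) zero_le_one
      rw [mul_assoc]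
      nlinarith
  · left; simp

/-- grid floor index -/
def fl (n : ℕ) (s : ℝ) : ℤ := ⌊((n:ℝ) + 1) * s⌋
/-- grid point -/
def gp (n : ℕ) (k : ℤ) : ℝ := (k : ℝ) / ((n:ℝ) + 1)

lemma fl_meas (n : ℕ) : Measurable (fl n) := Int.measurable_floor.comp (measurable_const.mul measurable_id)

lemma gp_fl (n : ℕ) (s : ℝ) : |gp n (fl n s) - s| ≤ 1 / ((n:ℝ) + 1) := by
  have hn : (0:ℝ) < (n:ℝ) + 1 := by positivity
  have h1 := Int.floor_le (((n:ℝ) + 1) * s)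
  have h2 := Int.lt_floor_add_one (((n:ℝ) + 1) * s)
  have : gp n (fl n s) - s = ((fl n s : ℝ) - ((n:ℝ) + 1) * s) / ((n:ℝ) + 1) := by
    unfold gp; field_simp
  rw [this, abs_div, abs_of_pos hn]
  gcongr
  rw [abs_le]
  unfold fl
  constructor <;> linarith

lemma gp_tendsto (s : ℝ) : Filter.Tendsto (fun n => gp n (fl n s)) Filter.atTop (nhds s) := by
  rw [tendsto_iff_norm_sub_tendsto_zero]
  exact squeeze_zero (fun _ => norm_nonneg _) (fun n => gp_fl n s) (tendsto_one_div_add_atTop_nhds_zero_nat (𝕜 := ℝ))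

lemma gp_wa (n : ℕ) (s : ℝ) : wa (gp n (fl n s)) ≤ 4 * wa s := by
  refine wa_shift ((gp_fl n s).trans ?_)
  rw [div_le_one (by positivity)]
  have : (0:ℝ) ≤ n := Nat.cast_nonneg _
  linarith

/-- grid size -/
def gL (n : ℕ) : ℕ := (n + 1) * (n + 1)

lemma good_eventually (s : ℝ) : ∀ᶠ n in Filter.atTop, |fl n s| ≤ (gL n : ℤ) := by
  filter_upwards [Filter.eventually_ge_atTop ⌈|s| + 1⌉₊] with n hn
  have hn' : |s| + 1 ≤ n := (Nat.le_ceil _).trans (by exact_mod_cast hn)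
  have h1 := gp_fl n s
  have hpos : (0:ℝ) < (n:ℝ) + 1 := by positivity
  have h2 : |gp n (fl n s)| ≤ n + 1 := by
    have := abs_sub_abs_le_abs_sub (gp n (fl n s)) s
    have : 1 / ((n:ℝ) + 1) ≤ 1 := by
      rw [div_le_one hpos]
      have : (0:ℝ) ≤ n := Nat.cast_nonneg _
      linarith
    linarith
  rw [gp, abs_div, abs_of_pos hpos, div_le_iff₀ hpos] at h2
  unfold gL
  exact_mod_cast h2

/-- coefficient on the grid -/
def cc (F : SchwartzMap (ℝ × E) ℂ) (p : ℝ≥0∞) (n : ℕ) (k : ℤ) : ℂ :=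
  if |k| ≤ (gL n : ℤ) then ((sN F p (gp n k) : ℝ) : ℂ) else 0

lemma cc_le (F : SchwartzMap (ℝ × E) ℂ) {p : ℝ≥0∞} (hp1 : 1 ≤ p) (hp : p ≠ ∞) :
    ∃ C : ℝ, 0 ≤ C ∧ ∀ n s, ‖cc F p n (fl n s)‖ ≤ C * wa s := by
  obtain ⟨C, hC, h⟩ := slice_norm F hp1 hp
  refine ⟨C * 4, by positivity, fun n s => ?_⟩
  unfold cc
  split_ifs
  · rw [norm_real, Real.norm_of_nonneg (sN_nonneg _ _ _)]
    refine (h _).trans ?_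
    rw [mul_assoc]
    gcongr
    exact gp_wa n s
  · have := wa_nonneg s
    simp; positivity

lemma cc_meas (F : SchwartzMap (ℝ × E) ℂ) (p : ℝ≥0∞) (n : ℕ) : Measurable fun s => cc F p n (fl n s) :=
  (measurable_of_countable (cc F p n)).comp (fl_meas n)

/-- step approximation -/
def apx (F : SchwartzMap (ℝ × E) ℂ) {p : ℝ≥0∞} (hp1 : 1 ≤ p) (hp : p ≠ ∞) (n : ℕ) :
    Step (volume : Measure E) p where
  c s := cc F p n (fl n s)
  cm := cc_meas F p n
  cint := (wa_int.const_mul (cc_le F hp1 hp).choose).mono' (cc_meas F p n).aestronglyMeasurable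
    (.of_forall fun s => (cc_le F hp1 hp).choose_spec.2 n s)
  M := (cc_le F hp1 hp).choose
  cbdd s := ((cc_le F hp1 hp).choose_spec.2 n s).trans
    (mul_le_of_le_one_right (cc_le F hp1 hp).choose_spec.1 (wa_le s))
  i s := if |fl n s| ≤ (gL n : ℤ) then (fl n s + gL n).toNat else 0
  im := (measurable_of_countable (fun k : ℤ => if |k| ≤ (gL n : ℤ) then (k + gL n).toNat else 0)).comp (fl_meas n)
  N := 2 * gL n + 1
  iN s := by
    split_ifs with h
    · rw [abs_le] at h; omega
    · omega
  ψ k := nsl F p n (gp n ((k : ℤ) - gL n))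
  nice k := nsl_nice F p n _
  unit k := nsl_unit F hp1 hp n _

lemma apx_V {H : Type*} [NormedAddCommGroup H] [InnerProductSpace ℂ H] [CompleteSpace H] {σ A : ℝ}
    (D : Disp (volume : Measure E) H σ A) (F : SchwartzMap (ℝ × E) ℂ) {p : ℝ≥0∞} (hp1 : 1 ≤ p) (hp : p ≠ ∞) (n : ℕ) (s : ℝ) :
    (apx F hp1 hp n).V D s = if |fl n s| ≤ (gL n : ℤ) then D.V s (tsl F n (gp n (fl n s))) else 0 := by
  simp only [Step.V, vstep, apx, cc]
  split_ifs with h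
  · rw [← map_smul, ← sN_smul F hp1 hp]
    rw [abs_le] at h
    have : (((fl n s + gL n).toNat : ℕ) : ℤ) - gL n = fl n s := by omega
    rw [this]
  · simp

lemma approx_bound {H : Type*} [NormedAddCommGroup H] [InnerProductSpace ℂ H] [CompleteSpace H] {σ A : ℝ}
    (D : Disp (volume : Measure E) H σ A) (F : SchwartzMap (ℝ × E) ℂ) {p α a b : ℝ≥0∞} {C : ℝ} (hp1 : 1 ≤ p) (hp : p ≠ ∞)
    (hα1 : 1 ≤ α) (hα : α ≠ ∞) (hB : BilB D α p a b C) (G : Step (volume : Measure E) b)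
    (hG : eLpNorm G.c a volume ≠ ∞) :
    ‖Bil (fun s => D.V s (sl F s)) (G.V D)‖ₑ ≤
      ENNReal.ofReal C * eLpNorm (fun s => ((sN F p s : ℝ) : ℂ)) α volume * eLpNorm G.c a volume := by
  obtain ⟨C₁, hC₁, h₁⟩ := cc_le F hp1 hp
  obtain ⟨C₂, hC₂, h₂⟩ := sl_norm F
  have hc : Filter.Tendsto (fun n => eLpNorm (apx F hp1 hp n).c α volume) Filter.atTop
      (nhds (eLpNorm (fun s => ((sN F p s : ℝ) : ℂ)) α volume)) := by
    refine elp_tendsto (zero_lt_one.trans_le hα1).ne' hα (b := fun s => C₁ * wa s) (fun n => cc_meas F p n)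
      ((wa_memLp hα1 hα).const_mul _) (fun n s => h₁ n s) (fun s => ?_)
    have h3 := slice_norm_tendsto F hp1 hp (gp_tendsto s)
    have h4 := (Complex.continuous_ofReal.tendsto _).comp h3
    refine h4.congr' ?_
    filter_upwards [good_eventually s] with n hn
    simp only [apx, cc, if_pos hn, sN, Function.comp]
  have hV : ∀ s, Filter.Tendsto (fun n => (apx F hp1 hp n).V D s) Filter.atTop (nhds (D.V s (sl F s))) := by
    intro s
    have h3 := ((D.V s).continuous.tendsto _).comp (tsl_sub F (gp_tendsto s))
    refine h3.congr' ?_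
    filter_upwards [good_eventually s] with n hn
    rw [apx_V, if_pos hn]; rfl
  have hVb : ∀ n s, ‖(apx F hp1 hp n).V D s‖ ≤ C₂ * 4 * wa s := by
    intro n s
    rw [apx_V]
    have := wa_nonneg s
    split_ifs
    · rw [LinearIsometry.norm_map]
      refine (tsl_norm F n _).trans ((h₂ _).trans ?_)
      rw [mul_assoc]
      gcongr
      exact gp_wa n s
    · simp; positivity
  have hBt : Filter.Tendsto (fun n => Bil ((apx F hp1 hp n).V D) (G.V D)) Filter.atTop
      (nhds (Bil (fun s => D.V s (sl F s)) (G.V D))) := by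
    unfold Bil
    refine tendsto_integral_of_dominated_convergence (fun z : ℝ × ℝ => (C₂ * 4 * wa z.1) * ‖G.V D z.2‖)
      (fun n => ?_) ?_ (fun n => .of_forall fun z => ?_) (.of_forall fun z => ?_)
    · exact (integrable_inner_prod ((apx F hp1 hp n).int D) (G.int D)).1.restrict
    · exact ((wa_int.const_mul (C₂ * 4)).mul_prod (G.int D).norm).restrict
    · refine (norm_inner_le_norm _ _).trans ?_
      gcongr
      exact hVb n z.1
    · exact (hV z.1).inner tendsto_const_nhds
  have hCt : ENNReal.ofReal C ≠ ∞ := by simp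
  have hr := ENNReal.Tendsto.mul_const (b := eLpNorm G.c a volume)
    (ENNReal.Tendsto.const_mul (a := ENNReal.ofReal C) hc (Or.inr hCt)) (Or.inr hG)
  refine le_of_tendsto_of_tendsto' ((continuous_enorm.tendsto _).comp hBt) hr fun n => ?_
  simp only [Function.comp]
  rw [mul_assoc]
  exact hB _ _
end

end


lemma ex_inv_toReal {q : ℝ≥0∞} (hq : q ≠ 0) : ex (q⁻¹).toReal = q := by
  rw [ex, ENNReal.ofReal_toReal (by simpa using hq), inv_inv]

lemma adm_of {d : ℕ} {q r : ℝ≥0∞} (h : IsAdmissible d q r) :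
    q = ex (q⁻¹).toReal ∧ r = ex (r⁻¹).toReal ∧ Adm (d / 2) (q⁻¹).toReal (r⁻¹).toReal := by
  obtain ⟨hq, hr, he, hne⟩ := h
  have two_pos' : (0:ℝ≥0∞) < 2 := by norm_num
  have hq0 := (two_pos'.trans_le hq).ne'
  have hr0 := (two_pos'.trans_le hr).ne'
  have half : ∀ {p : ℝ≥0∞}, 2 ≤ p → (p⁻¹).toReal ≤ 1/2 := fun {p} hp => by
    have := ENNReal.toReal_mono (by simp) (ENNReal.inv_le_inv.2 hp)
    simpa using this
  have he' : 2 * (q⁻¹).toReal + d * (r⁻¹).toReal = d / 2 := by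
    have := congrArg ENNReal.toReal he
    rw [div_eq_mul_inv, div_eq_mul_inv, ENNReal.toReal_add, ENNReal.toReal_mul, ENNReal.toReal_mul] at this
    · simpa using this
    · exact ENNReal.mul_ne_top (by simp) (by simpa using hq0)
    · exact ENNReal.mul_ne_top (by simp) (by simpa using hr0)
  have heq : (q⁻¹).toReal = (d / 2 : ℝ) * (1/2 - (r⁻¹).toReal) := by linarith
  refine ⟨(ex_inv_toReal hq0).symm, (ex_inv_toReal hr0).symm, ENNReal.toReal_nonneg, half hq,
    ENNReal.toReal_nonneg, half hr, heq, ?_⟩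
  rintro ⟨h1, h2⟩
  apply hne
  refine ⟨?_, ?_, ?_⟩
  · have : (d:ℝ) = 2 := by linarith
    exact_mod_cast this
  · rw [← ex_inv_toReal hq0, h2, ex_half]
  · rw [h1, h2] at heq
    have : (r⁻¹).toReal = 0 := by linarith
    rw [← ex_inv_toReal hr0, this]; simp [ex]

lemma dual_of {α α' : ℝ≥0∞} (h : 1 / α + 1 / α' = 1) (h2 : 2 ≤ α') : α = ex (1 - (α'⁻¹).toReal) := by
  have two_pos' : (0:ℝ≥0∞) < 2 := by norm_num
  have h0 := (two_pos'.trans_le h2).ne'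
  have ht : α'⁻¹ ≠ ∞ := by simpa using h0
  rw [one_div, one_div] at h
  have h3 : α⁻¹ = 1 - α'⁻¹ := ENNReal.eq_sub_of_add_eq ht h
  rw [ex, ENNReal.ofReal_sub _ ENNReal.toReal_nonneg, ENNReal.ofReal_toReal ht, ENNReal.ofReal_one, ← h3, inv_inv]

lemma mixed_eq {q : ℝ≥0∞} (hq : q ≠ 0) (g : ℝ → ℝ≥0∞) : mixedLNorm q g = eLpNorm g q volume := by
  unfold mixedLNorm
  split_ifs with h
  · subst h
    rw [eLpNorm_exponent_top, eLpNormEssSup]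
    simp
  · rw [eLpNorm_eq_lintegral_rpow_enorm_toReal hq h]
    simp

lemma ex_ne_zero (x : ℝ) : ex x ≠ 0 := by simp [ex]
lemma ex_ne_top {x : ℝ} (h : 0 < x) : ex x ≠ ∞ := by simp [ex, h]
/-- **Retarded Strichartz estimate.** For `d ≥ 1`, an admissible pair `(q,r)` and a dual
admissible pair `(α,β)`, there is `C > 0` such that for all Schwartz `F : ℝ × ℝ^d → ℂ`,
the retarded Duhamel integral `u(t) = ∫_{-∞}^t e^{i(t-s)Δ}F(s,·) ds` satisfies
`‖u‖_{L^q_t L^r_x} ≤ C ‖F‖_{L^α_t L^β_x}`. -/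
theorem strichartz_retarded (d : ℕ) (hd : 1 ≤ d) (q r α β α' β' : ℝ≥0∞)
    (hqr : IsAdmissible d q r)
    (hα : 1 / α + 1 / α' = 1) (hβ : 1 / β + 1 / β' = 1)
    (hadm : IsAdmissible d α' β') :
    ∃ C > (0 : ℝ), ∀ F : SchwartzMap (ℝ × EuclideanSpace ℝ (Fin d)) ℂ,
      mixedLNorm q (fun t : ℝ =>
          eLpNorm
            (fun x : EuclideanSpace ℝ (Fin d) =>
              ∫ s in Set.Iio t, schrod d (t - s) (fun y => F (s, y)) x) r volume) ≤
        ENNReal.ofReal C *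
          mixedLNorm α (fun s : ℝ => eLpNorm (fun y => F (s, y)) β volume) := by
  obtain ⟨hqe, hre, hA⟩ := adm_of hqr
  obtain ⟨hαe', hβe', hA₁⟩ := adm_of hadm
  have hαe := dual_of hα hadm.1
  have hβe := dual_of hβ hadm.2.1
  set x := (q⁻¹).toReal
  set y := (r⁻¹).toReal
  set x₁ := (α'⁻¹).toReal
  set y₁ := (β'⁻¹).toReal
  obtain ⟨C, hC, hB⟩ := general (schD d hd) hA₁ hA
  rw [← hαe, ← hβe] at hB
  have hx0 := hA.x0
  have hx1 := hA.x1
  have hy0 := hA.y0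
  have hy1 := hA.y1
  have hα1 : 1 ≤ α := by rw [hαe]; exact one_le_ex (by have := hA₁.x0; linarith)
  have hβ1 : 1 ≤ β := by rw [hβe]; exact one_le_ex (by have := hA₁.y0; linarith)
  have hαt : α ≠ ∞ := by rw [hαe]; exact ex_ne_top (by have := hA₁.x1; linarith)
  have hβt : β ≠ ∞ := by rw [hβe]; exact ex_ne_top (by have := hA₁.y1; linarith)
  have hq0 : q ≠ 0 := by rw [hqe]; exact ex_ne_zero _
  refine ⟨C + 1, by linarith, fun F => ?_⟩
  rw [mixed_eq hq0, mixed_eq (zero_lt_one.trans_le hα1).ne']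
  have hN : eLpNorm (fun s => eLpNorm (fun y => F (s, y)) β volume) α volume =
      eLpNorm (fun s => ((sN F β s : ℝ) : ℂ)) α volume := by
    refine eLpNorm_congr_enorm_ae (.of_forall fun s => ?_)
    simp only [enorm_eq_self]
    rw [← ofReal_norm, norm_real, Real.norm_of_nonneg (sN_nonneg _ _ _), sN,
      ENNReal.ofReal_toReal (slice_memLp F s hβ1 hβt).2.ne]
  have hNt : eLpNorm (fun s => ((sN F β s : ℝ) : ℂ)) α volume ≠ ∞ := by
    obtain ⟨C₀, hC₀, h₀⟩ := slice_norm F hβ1 hβt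
    refine (((wa_memLp hα1 hαt).const_mul C₀).of_le ?_ (.of_forall fun s => ?_)).2.ne
    · exact (Complex.continuous_ofReal.comp (slice_norm_cont F hβ1 hβt)).aestronglyMeasurable
    · rw [norm_real, Real.norm_of_nonneg (sN_nonneg _ _ _)]
      exact (h₀ s).trans (le_abs_self _)
  have hU : ∀ t, eLpNorm (fun x => ∫ s in Set.Iio t, schrod d (t - s) (fun y => F (s, y)) x) r volume =
      eLpNorm (Us (schD d hd) (fun s => schV s (sl F s)) t) r volume :=
    fun t => eLpNorm_congr_ae (duhamel_ae hd F t)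
  simp only [hU]
  rw [hN]
  have key := Us_bound (schD d hd) (schV_sl_int F) (q := q) (r := r) (q' := ex (1 - x)) (r' := ex (1 - y))
    hqr.1 hqr.2.1 (by conv_lhs => rw [hqe]
                      exact ex_conj hx0 (by linarith))
    (by conv_lhs => rw [hre]
        exact ex_conj hy0 (by linarith))
    (C := ENNReal.ofReal C * eLpNorm (fun s => ((sN F β s : ℝ) : ℂ)) α volume)
    (ENNReal.mul_ne_top (by simp) hNt)
    (fun G => approx_bound (schD d hd) F hβ1 hβt hα1 hαt hB G
      (eLpNorm_ne_top_of_bdd G.cint G.cbdd (one_le_ex (by linarith))))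
  refine key.trans ?_
  gcongr
  linarith
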